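/- arXiv:2504.19769 — 2 statements merged into one kernel-verified Lean document; each statement's English description precedes it below -/
import Mathlib

section
/- Let f ∈ S(ℝ) and let 1 ≤ p ≤ ∞. Then the support of D_k^M f is compact if and only if limsup_{n→∞} ‖Δ_{k,M⁻¹}ⁿ f‖_{L^p_k}^{1/n} < ∞. -/
open MeasureTheory Filter Complex Topology
open scoped ENNReal

noncomputable section

/-- The measure `μ_k` on `ℝ`: `dμ_k(x) = |x|^(2k+1) dx / (2^(k+1) Γ(k+1))`. -/
def muK (k : ℝ) : Measure ℝ :=
  MeasureTheory.volume.withDensity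
    (fun x : ℝ => ENNReal.ofReal (|x| ^ (2 * k + 1) / (2 ^ (k + 1) * Real.Gamma (k + 1))))

/-- The normalized Bessel function `j_k`. -/
def besselJ (k x : ℝ) : ℝ :=
  Real.Gamma (k + 1) *
    ∑' n : ℕ, (-1 : ℝ) ^ n * (x / 2) ^ (2 * n) / ((n.factorial : ℝ) * Real.Gamma ((n : ℝ) + k + 1))

/-- The Dunkl kernel `E_k(iλ, x)`. -/
def dunklKernel (k lam x : ℝ) : ℂ :=
  (besselJ k (lam * x) : ℂ) +
    Complex.I * (lam : ℂ) * (x : ℂ) / (2 * ((k : ℂ) + 1)) * (besselJ (k + 1) (lam * x) : ℂ)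

/-- The Dunkl transform `D_k f`. -/
def dunklT (k : ℝ) (f : ℝ → ℂ) (lam : ℝ) : ℂ :=
  ∫ x : ℝ, f x * dunklKernel k (-lam) x ∂(muK k)

/-- The linear canonical Dunkl transform `D_k^M` for `M = (a, b; c, d)`. -/
def lcdt (k a b d : ℝ) (f : ℝ → ℂ) (lam : ℝ) : ℂ :=
  ((Complex.I * (b : ℂ)) ^ ((k : ℂ) + 1))⁻¹ *
    ∫ x : ℝ, f x *
      Complex.exp (Complex.I / 2 * (((d / b : ℝ) : ℂ) * (lam : ℂ) ^ 2 + ((a / b : ℝ) : ℂ) * (x : ℂ) ^ 2)) *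
      dunklKernel k (-lam / b) x ∂(muK k)

/-- The Dunkl operator `Λ_k`. -/
def dunklOp (k : ℝ) (f : ℝ → ℂ) : ℝ → ℂ := fun x =>
  if x = 0 then (2 * (k : ℂ) + 2) * deriv f 0
  else deriv f x + (((2 * k + 1) / x : ℝ) : ℂ) * ((f x - f (-x)) / 2)

/-- The linear canonical Dunkl operator `Λ_{k,M⁻¹} f(x) = Λ_k f(x) + i (a/b) x f(x)`. -/
def lcdOp (k a b : ℝ) (f : ℝ → ℂ) : ℝ → ℂ := fun x =>
  dunklOp k f x + Complex.I * ((a / b : ℝ) : ℂ) * (x : ℂ) * f x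

/-- The linear canonical Dunkl operator `Λ_{k,M} f(x) = Λ_k f(x) - i (d/b) x f(x)`. -/
def lcdOpM (k d b : ℝ) (f : ℝ → ℂ) : ℝ → ℂ := fun x =>
  dunklOp k f x - Complex.I * ((d / b : ℝ) : ℂ) * (x : ℂ) * f x

/-- The linear canonical Dunkl Laplacian `Δ_{k,M⁻¹} = Λ_{k,M⁻¹} ∘ Λ_{k,M⁻¹}`. -/
def deltaOp (k a b : ℝ) : (ℝ → ℂ) → ℝ → ℂ := fun f => lcdOp k a b (lcdOp k a b f)

/-- The operator `i Λ_{k,M⁻¹}`. -/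
def iLam (k a b : ℝ) : (ℝ → ℂ) → ℝ → ℂ := fun f x => Complex.I * lcdOp k a b f x

/-- The operator `P(i Λ_{k,M⁻¹}) = Σ_j c_j (iΛ_{k,M⁻¹})^j` for `P(t) = Σ_j c_j t^j`. -/
def polyOpI (k a b : ℝ) (P : Polynomial ℝ) : (ℝ → ℂ) → ℝ → ℂ := fun f x =>
  ∑ j ∈ Finset.range (P.natDegree + 1), ((P.coeff j : ℝ) : ℂ) * (iLam k a b)^[j] f x

end

namespace DunklPaleyWiener

open scoped SchwartzMap ContDiff

/-- The `n`-th coefficient of the power series of `j_k` in the variable `(x / 2) ^ 2`. -/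
noncomputable def besselCoeff (k : ℝ) (n : ℕ) : ℝ :=
  Real.Gamma (k + 1) * ((-1) ^ n / ((n.factorial : ℝ) * Real.Gamma ((n : ℝ) + k + 1)))

/-- The entire function whose value at `(x / 2) ^ 2` is `j_k x`. -/
noncomputable def besselSeries (k s : ℝ) : ℝ := ∑' n : ℕ, besselCoeff k n * s ^ n

theorem besselJ_eq_besselSeries (k x : ℝ) : besselJ k x = besselSeries k ((x / 2) ^ 2) := by
  unfold besselJ besselSeries besselCoeff
  rw [← tsum_mul_left]
  congr 1 with n
  rw [pow_mul]
  ring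

section Bessel

variable {k : ℝ}

theorem gamma_pos (hk : -(1 / 2) ≤ k) (n : ℕ) : 0 < Real.Gamma ((n : ℝ) + k + 1) :=
  Real.Gamma_pos_of_pos (by have : (0 : ℝ) ≤ n := n.cast_nonneg; linarith)

theorem gamma_succ (hk : -(1 / 2) ≤ k) (n : ℕ) :
    Real.Gamma (((n + 1 : ℕ) : ℝ) + k + 1) = (n + k + 1) * Real.Gamma ((n : ℝ) + k + 1) := by
  rw [← Real.Gamma_add_one (by have : (0 : ℝ) ≤ n := n.cast_nonneg; linarith)]
  push_cast
  congr 1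
  ring

theorem besselCoeff_zero (hk : -(1 / 2) ≤ k) : besselCoeff k 0 = 1 := by
  have h := gamma_pos hk 0
  simp only [Nat.cast_zero, zero_add] at h
  simp [besselCoeff, h.ne']

theorem besselCoeff_succ (hk : -(1 / 2) ≤ k) (n : ℕ) :
    (n + 1) * (n + k + 1) * besselCoeff k (n + 1) = -besselCoeff k n := by
  have h := (gamma_pos hk n).ne'
  have hn : (n : ℝ) + k + 1 ≠ 0 := by have : (0 : ℝ) ≤ n := n.cast_nonneg; linarith
  have hf : (n.factorial : ℝ) ≠ 0 := by positivity
  unfold besselCoeff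
  rw [gamma_succ hk, Nat.factorial_succ]
  push_cast
  field_simp
  ring

theorem abs_besselCoeff_le (hk : -(1 / 2) ≤ k) (n : ℕ) :
    |besselCoeff k n| ≤ 2 ^ n / n.factorial := by
  induction n with
  | zero => simp [besselCoeff_zero hk]
  | succ n ih =>
    have hn0 : (0 : ℝ) ≤ n := n.cast_nonneg
    have h := congrArg abs (besselCoeff_succ hk n)
    rw [abs_neg, abs_mul, abs_mul, abs_of_pos (by linarith : (0 : ℝ) < n + 1),
      abs_of_pos (by linarith : (0 : ℝ) < n + k + 1)] at h
    rw [← h] at ih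
    rw [Nat.factorial_succ, le_div_iff₀ (by positivity)]
    rw [le_div_iff₀ (by positivity)] at ih
    have hA : 0 ≤ |besselCoeff k (n + 1)| * (n + 1) * n.factorial := by positivity
    push_cast
    rw [pow_succ]
    nlinarith

theorem besselCoeff_add_one (hk : -(1 / 2) ≤ k) (n : ℕ) :
    (n + k + 1) * besselCoeff (k + 1) n = (k + 1) * besselCoeff k n := by
  have h := (gamma_pos hk n).ne'
  have hn : (n : ℝ) + k + 1 ≠ 0 := by have : (0 : ℝ) ≤ n := n.cast_nonneg; linarith
  have hf : (n.factorial : ℝ) ≠ 0 := by positivity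
  unfold besselCoeff
  rw [Real.Gamma_add_one (by linarith : k + 1 ≠ 0),
    show (n : ℝ) + (k + 1) + 1 = ((n + 1 : ℕ) : ℝ) + k + 1 by push_cast; ring, gamma_succ hk]
  field_simp

theorem besselCoeff_succ_eq (hk : -(1 / 2) ≤ k) (n : ℕ) :
    (n + 1) * besselCoeff k (n + 1) = -(1 / (k + 1)) * besselCoeff (k + 1) n := by
  have hn : (n : ℝ) + k + 1 ≠ 0 := by have : (0 : ℝ) ≤ n := n.cast_nonneg; linarith
  have hk1 : k + 1 ≠ 0 := by linarith
  have h1 := besselCoeff_succ hk n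
  have h2 := besselCoeff_add_one hk n
  apply mul_left_cancel₀ hn
  have h3 : 1 / (k + 1) * (k + 1) = 1 := by field_simp
  linear_combination h1 + 1 / (k + 1) * h2 + besselCoeff k n * h3

theorem summable_besselCoeff_bound (r : ℝ) :
    Summable fun n : ℕ => (2 : ℝ) ^ n / n.factorial * r ^ n := by
  refine (Real.summable_pow_div_factorial (2 * r)).congr fun n => ?_
  rw [mul_pow]
  ring

theorem summable_besselSeries (hk : -(1 / 2) ≤ k) (s : ℝ) :
    Summable fun n : ℕ => besselCoeff k n * s ^ n := by
  refine Summable.of_norm_bounded (summable_besselCoeff_bound |s|) fun n => ?_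
  rw [norm_mul, norm_pow, Real.norm_eq_abs, Real.norm_eq_abs]
  gcongr
  exact abs_besselCoeff_le hk n

theorem hasDerivAt_besselSeries (hk : -(1 / 2) ≤ k) (s : ℝ) :
    HasDerivAt (besselSeries k) (-(1 / (k + 1)) * besselSeries (k + 1) s) s := by
  set r : ℝ := |s| + 1 with hr
  have hr1 : 0 < r := by positivity
  have hsum : Summable fun n : ℕ => 2 ^ n / (n.factorial : ℝ) * (n * r ^ (n - 1)) := by
    rw [← summable_nat_add_iff 1]
    refine ((summable_besselCoeff_bound r).mul_left 2).congr fun n => ?_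
    rw [Nat.factorial_succ]
    push_cast
    have : (n.factorial : ℝ) ≠ 0 := by positivity
    field_simp
    ring
  have h := hasDerivAt_tsum_of_isPreconnected (t := Metric.ball 0 r)
    (g := fun n y => besselCoeff k n * y ^ n)
    (g' := fun n y => besselCoeff k n * (n * y ^ (n - 1))) (y₀ := s) (y := s) hsum
    Metric.isOpen_ball (convex_ball 0 r).isPreconnected
    (fun n y _ => (hasDerivAt_pow n y).const_mul _)
    (fun n y hy => by
      rw [norm_mul, norm_mul, norm_pow, Real.norm_eq_abs, Real.norm_eq_abs, Nat.abs_cast]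
      have hy' : |y| ≤ r := by simpa using (Metric.mem_ball.mp hy).le
      have := abs_besselCoeff_le hk n
      rw [Real.norm_eq_abs]
      gcongr)
    (by simp [hr]) (summable_besselSeries hk s) (by simp [hr])
  refine h.congr_deriv ?_
  have hs : Summable fun n : ℕ => besselCoeff k n * (n * s ^ (n - 1)) := by
    refine Summable.of_norm_bounded hsum fun n => ?_
    rw [norm_mul, norm_mul, norm_pow, Real.norm_eq_abs, Real.norm_eq_abs, Nat.abs_cast]
    have hy' : |s| ≤ r := by simp [hr]
    have := abs_besselCoeff_le hk n
    rw [Real.norm_eq_abs]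
    gcongr
  rw [hs.tsum_eq_zero_add, besselSeries, ← tsum_mul_left]
  simp only [Nat.cast_zero, zero_mul, mul_zero, zero_add, Nat.add_sub_cancel, Nat.cast_add,
    Nat.cast_one]
  congr 1 with n
  linear_combination s ^ n * besselCoeff_succ_eq hk n

theorem besselSeries_recurrence (hk : -(1 / 2) ≤ k) (s : ℝ) :
    -(s / (k + 2)) * besselSeries (k + 2) s + (k + 1) * besselSeries (k + 1) s
      = (k + 1) * besselSeries k s := by
  have hs2 := (summable_besselSeries (k := k + 2) (by linarith) s).mul_left (-(s / (k + 2)))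
  have hs1 := (summable_besselSeries (k := k + 1) (by linarith) s).mul_left (k + 1)
  have hs0 := (summable_besselSeries hk s).mul_left (k + 1)
  have key : ∀ n : ℕ, (k + 1) * (besselCoeff (k + 1) (n + 1) * s ^ (n + 1)) +
      -(s / (k + 2)) * (besselCoeff (k + 2) n * s ^ n) =
      (k + 1) * (besselCoeff k (n + 1) * s ^ (n + 1)) := by
    intro n
    have h1 := besselCoeff_succ_eq (k := k + 1) (by linarith) n
    have h2 := besselCoeff_add_one hk (n + 1)
    rw [show k + 1 + 1 = k + 2 by ring] at h1
    push_cast at h2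
    linear_combination (-(s ^ (n + 1))) * h1 + s ^ (n + 1) * h2
  unfold besselSeries
  rw [← tsum_mul_left, ← tsum_mul_left, ← tsum_mul_left, hs1.tsum_eq_zero_add,
    hs0.tsum_eq_zero_add, ← tsum_congr key, Summable.tsum_add ((summable_nat_add_iff 1).2 hs1) hs2,
    besselCoeff_zero hk, besselCoeff_zero (k := k + 1) (by linarith)]
  ring

theorem hasDerivAt_besselJ (hk : -(1 / 2) ≤ k) (x : ℝ) :
    HasDerivAt (besselJ k) (-(x / (2 * (k + 1))) * besselJ (k + 1) x) x := by
  have h1 : HasDerivAt (fun y : ℝ => (y / 2) ^ 2) (x / 2) x := by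
    have := ((hasDerivAt_id x).div_const 2).pow 2
    refine this.congr_deriv ?_
    simp
    ring
  have h := (hasDerivAt_besselSeries hk ((x / 2) ^ 2)).comp x h1
  rw [show besselJ k = fun y => besselSeries k ((y / 2) ^ 2) from
    funext (besselJ_eq_besselSeries k), besselJ_eq_besselSeries]
  refine h.congr_deriv ?_
  have hk1 : k + 1 ≠ 0 := by linarith
  field_simp

theorem besselJ_neg (k x : ℝ) : besselJ k (-x) = besselJ k x := by
  simp only [besselJ_eq_besselSeries, neg_div, neg_sq]

theorem besselJ_zero (hk : -(1 / 2) ≤ k) : besselJ k 0 = 1 := by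
  rw [besselJ_eq_besselSeries, besselSeries, tsum_eq_single 0 (by intro n hn; simp [hn])]
  simp [besselCoeff_zero hk]

/-- The odd part of the Dunkl kernel, divided by `i`. -/
noncomputable def besselOdd (k x : ℝ) : ℝ := x / (2 * (k + 1)) * besselJ (k + 1) x

theorem hasDerivAt_besselOdd (hk : -(1 / 2) ≤ k) (x : ℝ) :
    HasDerivAt (besselOdd k)
      (besselJ k x - (2 * k + 1) / (2 * (k + 1)) * besselJ (k + 1) x) x := by
  have h := ((hasDerivAt_id x).div_const (2 * (k + 1))).mul
    (hasDerivAt_besselJ (k := k + 1) (by linarith) x)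
  have hr := besselSeries_recurrence hk ((x / 2) ^ 2)
  simp only [← besselJ_eq_besselSeries] at hr
  have hk1 : k + 1 ≠ 0 := by linarith
  have hk2 : k + 2 ≠ 0 := by linarith
  have hk3 : k + 1 + 1 ≠ 0 := by linarith
  refine h.congr_deriv ?_
  have h2 : besselJ k x = (-((x / 2) ^ 2 / (k + 2)) * besselJ (k + 2) x +
      (k + 1) * besselJ (k + 1) x) / (k + 1) := by
    rw [hr]; field_simp
  rw [h2, show k + 1 + 1 = k + 2 by ring]
  simp only [id]
  field_simp
  ring

theorem besselOdd_neg (k x : ℝ) : besselOdd k (-x) = -besselOdd k x := by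
  simp only [besselOdd, besselJ_neg]
  ring

theorem besselJ_sq_add_besselOdd_sq_le (hk : -(1 / 2) ≤ k) (x : ℝ) :
    besselJ k x ^ 2 + besselOdd k x ^ 2 ≤ 1 := by
  wlog hx : 0 ≤ x generalizing x
  · simpa [besselJ_neg, besselOdd_neg] using this (-x) (by linarith)
  have hd : ∀ y, HasDerivAt (fun y => besselJ k y ^ 2 + besselOdd k y ^ 2)
      (-(2 * (2 * k + 1) * y) * (besselJ (k + 1) y / (2 * (k + 1))) ^ 2) y := by
    intro y
    refine (((hasDerivAt_besselJ hk y).pow 2).add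
      ((hasDerivAt_besselOdd hk y).pow 2)).congr_deriv ?_
    have hk1 : k + 1 ≠ 0 := by linarith
    simp only [besselOdd]
    push_cast
    field_simp
    ring
  have hanti : AntitoneOn (fun y => besselJ k y ^ 2 + besselOdd k y ^ 2) (Set.Ici 0) := by
    refine antitoneOn_of_deriv_nonpos (convex_Ici 0)
      (fun y _ => (hd y).continuousAt.continuousWithinAt)
      (fun y _ => (hd y).differentiableAt.differentiableWithinAt) fun y hy => ?_
    rw [interior_Ici] at hy
    rw [(hd y).deriv]
    have h1 : 0 ≤ 2 * (2 * k + 1) * y := by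
      have : 0 ≤ 2 * k + 1 := by linarith
      have := (Set.mem_Ioi.1 hy).le
      positivity
    nlinarith [sq_nonneg (besselJ (k + 1) y / (2 * (k + 1)))]
  have := hanti Set.self_mem_Ici hx hx
  simpa [besselJ_zero hk, besselOdd] using this

end Bessel

/-- The Dunkl kernel as a function of the product of its two arguments. -/
noncomputable def dunklExp (k t : ℝ) : ℂ := besselJ k t + I * besselOdd k t

theorem dunklKernel_eq_dunklExp (k lam x : ℝ) :
    dunklKernel k lam x = dunklExp k (lam * x) := by
  simp only [dunklKernel, dunklExp, besselOdd]
  push_cast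
  ring

section DunklExp

variable {k : ℝ}

theorem norm_dunklExp_le (hk : -(1 / 2) ≤ k) (t : ℝ) : ‖dunklExp k t‖ ≤ 1 := by
  rw [← sq_le_one_iff₀ (norm_nonneg _), Complex.sq_norm, dunklExp, mul_comm I,
    Complex.normSq_add_mul_I]
  exact besselJ_sq_add_besselOdd_sq_le hk t

theorem hasDerivAt_dunklExp (hk : -(1 / 2) ≤ k) (t : ℝ) :
    HasDerivAt (dunklExp k) (-besselOdd k t +
      I * (besselJ k t - (2 * k + 1) / (2 * (k + 1)) * besselJ (k + 1) t)) t := by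
  have h := (hasDerivAt_besselJ hk t).ofReal_comp.add
    ((hasDerivAt_besselOdd hk t).ofReal_comp.const_mul I)
  refine h.congr_deriv ?_
  simp [besselOdd]

theorem continuous_dunklExp (hk : -(1 / 2) ≤ k) : Continuous (dunklExp k) :=
  continuous_iff_continuousAt.2 fun x => (hasDerivAt_dunklExp hk x).continuousAt

end DunklExp

/-- The density of `μ_k` with respect to Lebesgue measure. -/
noncomputable def weight (k x : ℝ) : ℝ := |x| ^ (2 * k + 1) / (2 ^ (k + 1) * Real.Gamma (k + 1))

section Weight

variable {k : ℝ}

theorem weight_const_pos (hk : -(1 / 2) ≤ k) : 0 < 2 ^ (k + 1) * Real.Gamma (k + 1) :=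
  mul_pos (by positivity) (Real.Gamma_pos_of_pos (by linarith))

theorem weight_nonneg (hk : -(1 / 2) ≤ k) (x : ℝ) : 0 ≤ weight k x :=
  div_nonneg (by positivity) (weight_const_pos hk).le

theorem weight_neg (k x : ℝ) : weight k (-x) = weight k x := by simp [weight]

theorem continuous_weight (hk : -(1 / 2) ≤ k) : Continuous (weight k) :=
  ((Real.continuous_rpow_const (by linarith)).comp continuous_abs).div_const _

theorem hasDerivAt_weight {x : ℝ} (hx : 0 < x) :
    HasDerivAt (weight k) ((2 * k + 1) / x * weight k x) x := by
  have h : HasDerivAt (fun y : ℝ => y ^ (2 * k + 1) / (2 ^ (k + 1) * Real.Gamma (k + 1)))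
      ((2 * k + 1) * x ^ (2 * k + 1 - 1) / (2 ^ (k + 1) * Real.Gamma (k + 1))) x :=
    (Real.hasDerivAt_rpow_const (Or.inl hx.ne')).div_const _
  refine (h.congr_of_eventuallyEq ?_).congr_deriv ?_
  · filter_upwards [lt_mem_nhds hx] with y hy
    rw [weight, abs_of_pos hy]
  · rw [weight, abs_of_pos hx, Real.rpow_sub_one hx.ne']
    ring

theorem measurable_weight : Measurable fun x => ENNReal.ofReal (weight k x) := by
  unfold weight
  fun_prop

theorem muK_eq (k : ℝ) : muK k = volume.withDensity fun x => ENNReal.ofReal (weight k x) := rfl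

instance : SFinite (muK k) := by rw [muK_eq]; infer_instance

theorem integral_muK (hk : -(1 / 2) ≤ k) (f : ℝ → ℂ) :
    ∫ x, f x ∂muK k = ∫ x, (weight k x : ℂ) * f x := by
  rw [muK_eq, integral_withDensity_eq_integral_toReal_smul measurable_weight
    (ae_of_all _ fun _ => ENNReal.ofReal_lt_top)]
  simp [ENNReal.toReal_ofReal (weight_nonneg hk _)]

theorem integrable_muK_iff (hk : -(1 / 2) ≤ k) {E : Type*} [NormedAddCommGroup E]
    [NormedSpace ℝ E] (f : ℝ → E) :
    Integrable f (muK k) ↔ Integrable fun x => weight k x • f x := by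
  rw [muK_eq, integrable_withDensity_iff_integrable_smul' measurable_weight
    (ae_of_all _ fun _ => ENNReal.ofReal_lt_top)]
  simp [ENNReal.toReal_ofReal (weight_nonneg hk _)]

theorem intervalIntegral_muK (hk : -(1 / 2) ≤ k) (f : ℝ → ℂ) {L : ℝ} (hL : 0 ≤ L) :
    ∫ x in (-L)..L, f x ∂muK k = ∫ x in (-L)..L, (weight k x : ℂ) * f x := by
  rw [intervalIntegral.integral_of_le (by linarith), intervalIntegral.integral_of_le (by linarith),
    muK_eq, setIntegral_withDensity_eq_setIntegral_toReal_smul measurable_weight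
    (ae_of_all _ fun _ => ENNReal.ofReal_lt_top) _ measurableSet_Ioc]
  simp [ENNReal.toReal_ofReal (weight_nonneg hk _)]

theorem weight_le (hk : -(1 / 2) ≤ k) (x : ℝ) :
    weight k x ≤ (1 + |x|) ^ ⌈2 * k + 1⌉₊ / (2 ^ (k + 1) * Real.Gamma (k + 1)) := by
  have := weight_const_pos hk
  unfold weight
  gcongr
  calc |x| ^ (2 * k + 1) ≤ (1 + |x|) ^ (2 * k + 1) :=
        Real.rpow_le_rpow (abs_nonneg x) (by linarith) (by linarith)
    _ ≤ (1 + |x|) ^ (⌈2 * k + 1⌉₊ : ℝ) :=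
        Real.rpow_le_rpow_of_exponent_le (by linarith [abs_nonneg x]) (Nat.le_ceil _)
    _ = _ := Real.rpow_natCast _ _

theorem hasTemperateGrowth_muK (hk : -(1 / 2) ≤ k) : (muK k).HasTemperateGrowth := by
  set m := ⌈2 * k + 1⌉₊ with hm
  refine ⟨⟨m + 2, (integrable_muK_iff hk _).2 ?_⟩⟩
  have h2 : Integrable fun x : ℝ => (1 + ‖x‖) ^ (-2 : ℝ) :=
    integrable_one_add_norm (by norm_num)
  refine (h2.const_mul (2 ^ (k + 1) * Real.Gamma (k + 1))⁻¹).mono' ?_ (ae_of_all _ fun x => ?_)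
  · have h1 : Continuous fun x : ℝ => (1 + ‖x‖) ^ (-((m + 2 : ℕ) : ℝ)) :=
      Continuous.rpow_const (by fun_prop) fun x => Or.inl (by positivity)
    exact ((continuous_weight hk).smul h1).aestronglyMeasurable
  · have hx : 0 < 1 + ‖x‖ := by positivity
    rw [norm_smul, Real.norm_of_nonneg (weight_nonneg hk x), Real.norm_of_nonneg (by positivity)]
    refine (mul_le_mul_of_nonneg_right (weight_le hk x) (by positivity)).trans (le_of_eq ?_)
    rw [← Real.norm_eq_abs, ← hm, ← Real.rpow_natCast, div_mul_eq_mul_div, ← Real.rpow_add hx]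
    push_cast
    rw [show (m : ℝ) + -(m + 2) = -2 by ring]
    ring

end Weight

/-- `Λu` is a continuous version of the Dunkl operator applied to the differentiable
function `u`. -/
structure HasDunklDeriv (k : ℝ) (u Λu : ℝ → ℂ) : Prop where
  differentiable : Differentiable ℝ u
  continuous : Continuous Λu
  eq : ∀ x, x ≠ 0 → Λu x = deriv u x + (2 * k + 1) / x * ((u x - u (-x)) / 2)

section HasDunklDeriv

variable {k : ℝ}

theorem hasDunklDeriv_dunklExp (hk : -(1 / 2) ≤ k) (c : ℝ) :
    HasDunklDeriv k (fun x => dunklExp k (c * x)) fun x => I * c * dunklExp k (c * x) := by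
  have hd : ∀ x, HasDerivAt (fun x : ℝ => dunklExp k (c * x))
      (c * (-besselOdd k (c * x) + I * (besselJ k (c * x) -
        (2 * k + 1) / (2 * (k + 1)) * besselJ (k + 1) (c * x)))) x := by
    intro x
    have := (hasDerivAt_dunklExp hk (c * x)).scomp x ((hasDerivAt_id x).const_mul c)
    simpa [Function.comp_def, mul_add] using this
  refine ⟨fun x => (hd x).differentiableAt, ?_, fun x hx => ?_⟩
  · exact continuous_const.mul ((continuous_dunklExp hk).comp (by fun_prop))
  · rw [(hd x).deriv]
    have hk1 : (k : ℂ) + 1 ≠ 0 := by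
      exact_mod_cast (by linarith : k + 1 ≠ 0)
    have hx' : (x : ℂ) ≠ 0 := by exact_mod_cast hx
    simp only [dunklExp, besselOdd, mul_neg, besselJ_neg, neg_div, neg_mul]
    push_cast
    field_simp
    ring_nf
    simp only [I_sq]
    ring

/-- Integration by parts for the Dunkl operator on a symmetric interval. -/
theorem HasDunklDeriv.integral_add (hk : -(1 / 2) ≤ k) {u Λu v Λv : ℝ → ℂ}
    (hu : HasDunklDeriv k u Λu) (hv : HasDunklDeriv k v Λv) {L : ℝ} (hL : 0 ≤ L) :
    ∫ x in (-L)..L, (Λu x * v x + u x * Λv x) ∂muK k =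
      weight k L * (u L * v L - u (-L) * v (-L)) := by
  have hw : Continuous fun x => (weight k x : ℂ) :=
    continuous_ofReal.comp (continuous_weight hk)
  have hcu := hu.differentiable.continuous
  have hcv := hv.differentiable.continuous
  have hcu' := hu.continuous
  have hcv' := hv.continuous
  set F : ℝ → ℂ := fun x => weight k x * (Λu x * v x + u x * Λv x) with hF
  have hFc : Continuous F := by fun_prop
  rw [intervalIntegral_muK hk _ hL]
  have hFn : Continuous fun x => F (-x) := hFc.comp continuous_neg
  have hsplit : ∫ x in (-L)..L, F x = ∫ x in (0)..L, (F x + F (-x)) := by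
    rw [intervalIntegral.integral_add (hFc.intervalIntegrable _ _)
      (hFn.intervalIntegrable _ _), intervalIntegral.integral_comp_neg,
      neg_zero, add_comm, intervalIntegral.integral_add_adjacent_intervals
      (hFc.intervalIntegrable _ _) (hFc.intervalIntegrable _ _)]
  change ∫ x in (-L)..L, F x = _
  rw [hsplit, intervalIntegral.integral_eq_sub_of_hasDerivAt_of_le
    (f := fun x => (weight k x : ℂ) * (u x * v x - u (-x) * v (-x))) hL
    (by fun_prop) ?_ (Continuous.intervalIntegrable (by fun_prop) _ _)]
  · simp
  intro x hx
  have hx0 : 0 < x := hx.1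
  have hdu := (hu.differentiable x).hasDerivAt
  have hdv := (hv.differentiable x).hasDerivAt
  have hdu' := (hu.differentiable (-x)).hasDerivAt.scomp x (hasDerivAt_neg x)
  have hdv' := (hv.differentiable (-x)).hasDerivAt.scomp x (hasDerivAt_neg x)
  refine ((hasDerivAt_weight hx0).ofReal_comp.mul
    ((hdu.mul hdv).sub (hdu'.mul hdv'))).congr_deriv ?_
  have hx' : (x : ℂ) ≠ 0 := by exact_mod_cast hx0.ne'
  simp only [hF, weight_neg, hu.eq x hx0.ne', hv.eq x hx0.ne', hu.eq (-x) (neg_ne_zero.2 hx0.ne'),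
    hv.eq (-x) (neg_ne_zero.2 hx0.ne'), neg_neg, Function.comp, Pi.mul_apply, Pi.sub_apply]
  push_cast
  simp only [neg_smul, one_smul]
  field_simp
  ring

/-- Integration by parts for the Dunkl operator on the line. -/
theorem HasDunklDeriv.integral_mul (hk : -(1 / 2) ≤ k) {u Λu v Λv : ℝ → ℂ}
    (hu : HasDunklDeriv k u Λu) (hv : HasDunklDeriv k v Λv)
    (h1 : Integrable (fun x => Λu x * v x) (muK k))
    (h2 : Integrable (fun x => u x * Λv x) (muK k))
    (h3 : Tendsto (fun L => weight k L * (u L * v L)) atTop (𝓝 0))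
    (h4 : Tendsto (fun L => weight k L * (u (-L) * v (-L))) atTop (𝓝 0)) :
    ∫ x, Λu x * v x ∂muK k = -∫ x, u x * Λv x ∂muK k := by
  rw [← add_eq_zero_iff_eq_neg, ← MeasureTheory.integral_add h1 h2]
  refine tendsto_nhds_unique (intervalIntegral_tendsto_integral (h1.add h2)
    tendsto_neg_atTop_atBot tendsto_id) ?_
  have h5 := h3.sub h4
  rw [sub_zero] at h5
  refine h5.congr' ?_
  filter_upwards [eventually_ge_atTop 0] with L hL
  have := HasDunklDeriv.integral_add hk hu hv hL
  simp only [id]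
  rw [this]
  ring

end HasDunklDeriv

/-- The `n`-th derivative of the quotient `(f x - f 0) / x`, in integral form. -/
noncomputable def quotDeriv (f : 𝓢(ℝ, ℂ)) (n : ℕ) (x : ℝ) : ℂ :=
  ∫ t in (0 : ℝ)..1, ((t ^ n : ℝ) : ℂ) * iteratedDeriv (n + 1) f (t * x)

theorem hasDerivAt_iteratedDeriv (f : 𝓢(ℝ, ℂ)) (n : ℕ) (x : ℝ) :
    HasDerivAt (iteratedDeriv n f) (iteratedDeriv (n + 1) f x) x := by
  rw [iteratedDeriv_succ]
  exact ((f.smooth (n + 1 : ℕ)).differentiable_iteratedDeriv n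
    (by exact_mod_cast n.lt_succ_self) x).hasDerivAt

theorem continuous_iteratedDeriv (f : 𝓢(ℝ, ℂ)) (n : ℕ) : Continuous (iteratedDeriv n f) :=
  continuous_iff_continuousAt.2 fun x => (hasDerivAt_iteratedDeriv f n x).continuousAt

theorem hasDerivAt_quotDeriv (f : 𝓢(ℝ, ℂ)) (n : ℕ) (x : ℝ) :
    HasDerivAt (quotDeriv f n) (quotDeriv f (n + 1) x) x := by
  have hc := fun m => continuous_iteratedDeriv f m
  refine (intervalIntegral.hasDerivAt_integral_of_dominated_loc_of_deriv_le
    (F := fun x t => ((t ^ n : ℝ) : ℂ) * iteratedDeriv (n + 1) f (t * x))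
    (F' := fun x t => ((t ^ (n + 1) : ℝ) : ℂ) * iteratedDeriv (n + 1 + 1) f (t * x))
    (bound := fun _ => SchwartzMap.seminorm ℝ 0 (n + 2) f)
    (s := Set.univ) univ_mem (.of_forall fun y => Continuous.aestronglyMeasurable ?_)
    (Continuous.intervalIntegrable ?_ _ _) (Continuous.aestronglyMeasurable ?_) ?_
    intervalIntegrable_const ?_).2
  · exact (by fun_prop : Continuous fun t : ℝ => ((t ^ n : ℝ) : ℂ)).mul
      ((hc _).comp (by fun_prop))
  · exact (by fun_prop : Continuous fun t : ℝ => ((t ^ n : ℝ) : ℂ)).mul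
      ((hc _).comp (by fun_prop))
  · exact (by fun_prop : Continuous fun t : ℝ => ((t ^ (n + 1) : ℝ) : ℂ)).mul
      ((hc _).comp (by fun_prop))
  · refine .of_forall fun t ht y _ => ?_
    rw [Set.uIoc_of_le zero_le_one] at ht
    have h := SchwartzMap.le_seminorm' ℝ 0 (n + 2) f (t * y)
    rw [pow_zero, one_mul] at h
    rw [norm_mul, norm_real, Real.norm_of_nonneg (pow_nonneg ht.1.le _)]
    exact (mul_le_of_le_one_left (norm_nonneg _) (pow_le_one₀ ht.1.le ht.2)).trans h
  · refine .of_forall fun t _ y _ => ?_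
    have h := (hasDerivAt_iteratedDeriv f (n + 1) (t * y)).scomp y ((hasDerivAt_id y).const_mul t)
    refine (h.const_mul ((t ^ n : ℝ) : ℂ)).congr_deriv ?_
    simp only [mul_one, real_smul]
    push_cast
    ring

theorem iteratedDeriv_quotDeriv (f : 𝓢(ℝ, ℂ)) (n : ℕ) :
    iteratedDeriv n (quotDeriv f 0) = quotDeriv f n := by
  induction n with
  | zero => simp
  | succ n ih =>
    rw [iteratedDeriv_succ, ih]
    exact funext fun x => (hasDerivAt_quotDeriv f n x).deriv

theorem mul_quotDeriv_zero (f : 𝓢(ℝ, ℂ)) (x : ℝ) : x * quotDeriv f 0 x = f x - f 0 := by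
  have h : ∀ t ∈ Set.uIcc (0 : ℝ) 1, HasDerivAt (fun t : ℝ => f (t * x))
      (x * iteratedDeriv 1 f (t * x)) t := fun t _ => by
    have h := (hasDerivAt_iteratedDeriv f 0 (t * x)).scomp t ((hasDerivAt_id t).mul_const x)
    simpa [Function.comp_def] using h
  have h2 := intervalIntegral.integral_eq_sub_of_hasDerivAt h
    (Continuous.intervalIntegrable (continuous_const.mul
      ((continuous_iteratedDeriv f 1).comp (by fun_prop))) _ _)
  simpa [quotDeriv] using h2

theorem mul_quotDeriv_succ (f : 𝓢(ℝ, ℂ)) (n : ℕ) (x : ℝ) :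
    x * quotDeriv f (n + 1) x + (n + 1) * quotDeriv f n x = iteratedDeriv (n + 1) f x := by
  induction n generalizing x with
  | zero =>
    have h := (hasDerivAt_id x).ofReal_comp.mul (hasDerivAt_quotDeriv f 0 x)
    have h2 := (hasDerivAt_iteratedDeriv f 0 x).sub_const (f 0)
    simp only [iteratedDeriv_zero] at h2
    have h3 := h.unique (h2.congr_of_eventuallyEq
      (.of_forall fun y => by simpa using mul_quotDeriv_zero f y))
    simp only [id, ofReal_one, one_mul] at h3
    rw [← h3]
    simp [add_comm]
  | succ n ih =>
    have h := ((hasDerivAt_id x).ofReal_comp.mul (hasDerivAt_quotDeriv f (n + 1) x)).add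
      ((hasDerivAt_quotDeriv f n x).const_mul ((n : ℂ) + 1))
    have h3 := h.unique ((hasDerivAt_iteratedDeriv f (n + 1) x).congr_of_eventuallyEq
      (.of_forall fun y => by simpa using ih y))
    simp only [id, ofReal_one, one_mul] at h3
    rw [← h3]
    push_cast
    ring

theorem norm_quotDeriv_le (f : 𝓢(ℝ, ℂ)) (n : ℕ) (x : ℝ) :
    ‖quotDeriv f n x‖ ≤ SchwartzMap.seminorm ℝ 0 (n + 1) f := by
  have h := intervalIntegral.norm_integral_le_of_norm_le_const (a := (0 : ℝ)) (b := 1)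
    (f := fun t : ℝ => ((t ^ n : ℝ) : ℂ) * iteratedDeriv (n + 1) f (t * x))
    (C := SchwartzMap.seminorm ℝ 0 (n + 1) f) fun t ht => by
      rw [Set.uIoc_of_le zero_le_one] at ht
      have h := SchwartzMap.le_seminorm' ℝ 0 (n + 1) f (t * x)
      rw [pow_zero, one_mul] at h
      rw [norm_mul, norm_real, Real.norm_of_nonneg (pow_nonneg ht.1.le _)]
      exact (mul_le_of_le_one_left (norm_nonneg _) (pow_le_one₀ ht.1.le ht.2)).trans h
  simpa [quotDeriv] using h

theorem exists_decay_quotDeriv (f : 𝓢(ℝ, ℂ)) (hf : f 0 = 0) (m n : ℕ) :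
    ∃ C : ℝ, ∀ x, |x| ^ m * ‖quotDeriv f n x‖ ≤ C := by
  induction n with
  | zero =>
    refine ⟨max (SchwartzMap.seminorm ℝ 0 1 f) (SchwartzMap.seminorm ℝ m 0 f), fun x => ?_⟩
    rcases le_total |x| 1 with hx | hx
    · exact le_max_of_le_left ((mul_le_of_le_one_left (norm_nonneg _)
        (pow_le_one₀ (abs_nonneg x) hx)).trans (norm_quotDeriv_le f 0 x))
    · refine le_max_of_le_right ((mul_le_mul_of_nonneg_left ?_ (by positivity)).trans
        (SchwartzMap.le_seminorm' ℝ m 0 f x))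
      rw [iteratedDeriv_zero, ← sub_zero (f x), ← hf, ← mul_quotDeriv_zero, norm_mul, norm_real]
      exact le_mul_of_one_le_left (norm_nonneg _) hx
  | succ n ih =>
    obtain ⟨C, hC⟩ := ih
    refine ⟨max (SchwartzMap.seminorm ℝ 0 (n + 2) f)
      (SchwartzMap.seminorm ℝ m (n + 1) f + (n + 1) * C), fun x => ?_⟩
    rcases le_total |x| 1 with hx | hx
    · exact le_max_of_le_left ((mul_le_of_le_one_left (norm_nonneg _)
        (pow_le_one₀ (abs_nonneg x) hx)).trans (norm_quotDeriv_le f (n + 1) x))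
    · refine le_max_of_le_right ?_
      have h1 : ‖quotDeriv f (n + 1) x‖ ≤
          ‖iteratedDeriv (n + 1) f x‖ + (n + 1) * ‖quotDeriv f n x‖ := by
        calc _ ≤ ‖(x : ℂ) * quotDeriv f (n + 1) x‖ := by
              rw [norm_mul, norm_real]
              exact le_mul_of_one_le_left (norm_nonneg _) hx
          _ = ‖iteratedDeriv (n + 1) f x - (n + 1) * quotDeriv f n x‖ := by
              rw [← mul_quotDeriv_succ]; simp
          _ ≤ _ := by
              refine (norm_sub_le _ _).trans (add_le_add_right (le_of_eq ?_) _)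
              rw [norm_mul]
              congr 1
              exact_mod_cast Complex.norm_natCast (n + 1)
      calc _ ≤ |x| ^ m * (‖iteratedDeriv (n + 1) f x‖ + (n + 1) * ‖quotDeriv f n x‖) := by gcongr
        _ = |x| ^ m * ‖iteratedDeriv (n + 1) f x‖ + (n + 1) * (|x| ^ m * ‖quotDeriv f n x‖) := by
          ring
        _ ≤ _ := add_le_add (SchwartzMap.le_seminorm' ℝ m (n + 1) f x)
          (mul_le_mul_of_nonneg_left (hC x) (by positivity))

/-- A Schwartz function vanishing at `y` is divisible by `x - y` in the Schwartz space. -/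
theorem exists_schwartz_eq_sub_mul (f : 𝓢(ℝ, ℂ)) {y : ℝ} (hf : f y = 0) :
    ∃ h : 𝓢(ℝ, ℂ), ∀ x, f x = (x - y) * h x := by
  wlog hy : y = 0 generalizing f y
  · obtain ⟨h, hh⟩ := this (SchwartzMap.compSubConstCLM ℝ (-y) f) (y := 0) (by simpa using hf) rfl
    refine ⟨SchwartzMap.compSubConstCLM ℝ y h, fun x => ?_⟩
    simpa using hh (x - y)
  subst hy
  refine ⟨⟨quotDeriv f 0, ?_, fun m n => ?_⟩, fun x => ?_⟩
  · exact contDiff_of_differentiable_iteratedDeriv fun n _ => by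
      rw [iteratedDeriv_quotDeriv]
      exact fun x => (hasDerivAt_quotDeriv f n x).differentiableAt
  · obtain ⟨C, hC⟩ := exists_decay_quotDeriv f hf m n
    refine ⟨C, fun x => ?_⟩
    rw [norm_iteratedFDeriv_eq_norm_iteratedDeriv, iteratedDeriv_quotDeriv]
    exact hC x
  · have := mul_quotDeriv_zero f x
    rw [hf, sub_zero] at this
    rw [← this, ofReal_zero, sub_zero]
    rfl

theorem schwartz_ext_ne_zero {u v : 𝓢(ℝ, ℂ)} (h : ∀ x, x ≠ 0 → u x = v x) : u = v := by
  have h2 : (u : ℝ → ℂ) = v := Continuous.ext_on (dense_compl_singleton (0 : ℝ))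
    u.continuous v.continuous fun x hx => h x hx
  exact SchwartzMap.ext fun x => congrFun h2 x

/-- Multiplication by the variable on the Schwartz space. -/
noncomputable def mulX : 𝓢(ℝ, ℂ) →ₗ[ℂ] 𝓢(ℝ, ℂ) :=
  (SchwartzMap.smulLeftCLM ℂ (fun x : ℝ => (x : ℂ))).toLinearMap

@[simp] theorem mulX_apply (u : 𝓢(ℝ, ℂ)) (x : ℝ) : mulX u x = x * u x :=
  SchwartzMap.smulLeftCLM_apply_apply (by fun_prop) u x

/-- The reflection `u ↦ u (-x)` on the Schwartz space. -/
noncomputable def reflect : 𝓢(ℝ, ℂ) →ₗ[ℂ] 𝓢(ℝ, ℂ) :=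
  (SchwartzMap.compCLMOfContinuousLinearEquiv ℂ (ContinuousLinearEquiv.neg ℝ (M := ℝ))).toLinearMap

@[simp] theorem reflect_apply (u : 𝓢(ℝ, ℂ)) (x : ℝ) : reflect u x = u (-x) := rfl

/-- Complex conjugation on the Schwartz space. -/
noncomputable def conjS (u : 𝓢(ℝ, ℂ)) : 𝓢(ℝ, ℂ) :=
  SchwartzMap.postcompCLM (𝕜 := ℝ) (conjCLE : ℂ →L[ℝ] ℂ) u

@[simp] theorem conjS_apply (u : 𝓢(ℝ, ℂ)) (x : ℝ) : conjS u x = starRingEnd ℂ (u x) := rfl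

theorem exists_oddQuot (u : 𝓢(ℝ, ℂ)) : ∃ q : 𝓢(ℝ, ℂ), ∀ x, (u x - u (-x)) / 2 = x * q x := by
  obtain ⟨q, hq⟩ := exists_schwartz_eq_sub_mul ((1 / 2 : ℂ) • (u - reflect u)) (y := 0) (by simp)
  refine ⟨q, fun x => ?_⟩
  rw [← sub_zero (x : ℂ), ← ofReal_zero, ← hq]
  simp
  ring

/-- The Schwartz function `(u x - u (-x)) / (2 x)`. -/
noncomputable def oddQuot (u : 𝓢(ℝ, ℂ)) : 𝓢(ℝ, ℂ) := (exists_oddQuot u).choose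

theorem mul_oddQuot (u : 𝓢(ℝ, ℂ)) (x : ℝ) : x * oddQuot u x = (u x - u (-x)) / 2 :=
  ((exists_oddQuot u).choose_spec x).symm

theorem oddQuot_of_ne (u : 𝓢(ℝ, ℂ)) {x : ℝ} (hx : x ≠ 0) :
    oddQuot u x = (u x - u (-x)) / 2 / x := by
  rw [← mul_oddQuot, mul_div_cancel_left₀ _ (ofReal_ne_zero.2 hx)]

theorem oddQuot_zero (u : 𝓢(ℝ, ℂ)) : oddQuot u 0 = deriv u 0 := by
  have h1 := (hasDerivAt_id (0 : ℝ)).ofReal_comp.mul ((oddQuot u).differentiableAt (x := 0)).hasDerivAt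
  have hu := (u.differentiableAt (x := 0)).hasDerivAt
  have hu' : HasDerivAt u (deriv u 0) (-0) := by simpa using hu
  have h2 := (hu.sub (hu'.scomp (0 : ℝ) (hasDerivAt_neg 0))).div_const 2
  have h3 := h1.unique (h2.congr_of_eventuallyEq (.of_forall fun x => by
    simpa using mul_oddQuot u x))
  simp only [id, ofReal_one, ofReal_zero, one_mul, zero_mul, add_zero] at h3
  rw [h3]
  simp

/-- The Dunkl operator on the Schwartz space. -/
noncomputable def dunklS (k : ℝ) : 𝓢(ℝ, ℂ) →ₗ[ℂ] 𝓢(ℝ, ℂ) where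
  toFun u := SchwartzMap.derivCLM ℂ ℂ u + (2 * k + 1 : ℂ) • oddQuot u
  map_add' u v := schwartz_ext_ne_zero fun x hx => by
    have h : deriv (u + v : 𝓢(ℝ, ℂ)) x = deriv u x + deriv v x :=
      deriv_add u.differentiableAt v.differentiableAt
    simp only [add_apply, smul_apply, oddQuot_of_ne _ hx,
      SchwartzMap.derivCLM_apply, h, smul_eq_mul]
    ring
  map_smul' c u := schwartz_ext_ne_zero fun x hx => by
    have h : deriv (c • u : 𝓢(ℝ, ℂ)) x = c * deriv u x := deriv_const_smul c u.differentiableAt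
    simp only [add_apply, smul_apply, oddQuot_of_ne _ hx,
      SchwartzMap.derivCLM_apply, h, smul_eq_mul, RingHom.id_apply]
    ring

theorem dunklS_of_ne (k : ℝ) (u : 𝓢(ℝ, ℂ)) {x : ℝ} (hx : x ≠ 0) :
    dunklS k u x = deriv u x + (2 * k + 1) / x * ((u x - u (-x)) / 2) := by
  change deriv u x + (2 * k + 1 : ℂ) * oddQuot u x = _
  rw [oddQuot_of_ne u hx]
  ring

theorem hasDunklDeriv_dunklS (k : ℝ) (u : 𝓢(ℝ, ℂ)) : HasDunklDeriv k u (dunklS k u) :=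
  ⟨u.differentiable, (dunklS k u).continuous, fun _ hx => dunklS_of_ne k u hx⟩

theorem dunklOp_coe (k : ℝ) (u : 𝓢(ℝ, ℂ)) : dunklOp k u = dunklS k u := by
  funext x
  rw [dunklOp]
  split_ifs with hx
  · subst hx
    change _ = deriv u 0 + (2 * k + 1 : ℂ) * oddQuot u 0
    rw [oddQuot_zero]
    ring
  · rw [dunklS_of_ne k u hx]
    push_cast
    rfl

theorem dunklS_mulX (k : ℝ) (u : 𝓢(ℝ, ℂ)) :
    dunklS k (mulX u) = mulX (dunklS k u) + u + (2 * k + 1 : ℂ) • reflect u :=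
  schwartz_ext_ne_zero fun x hx => by
    have hx' : (x : ℂ) ≠ 0 := ofReal_ne_zero.2 hx
    have h : deriv (mulX u) x = u x + x * deriv u x := by
      have h := (hasDerivAt_id x).ofReal_comp.mul (u.differentiableAt (x := x)).hasDerivAt
      refine ((h.congr_of_eventuallyEq (.of_forall fun y => by simp)).deriv).trans ?_
      simp
    simp only [add_apply, smul_apply, dunklS_of_ne _ _ hx, mulX_apply, h,
      reflect_apply, smul_eq_mul, ofReal_neg]
    field_simp
    ring

theorem dunklS_reflect (k : ℝ) (u : 𝓢(ℝ, ℂ)) : dunklS k (reflect u) = -reflect (dunklS k u) :=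
  schwartz_ext_ne_zero fun x hx => by
    have h : deriv (reflect u) x = -deriv u (-x) := deriv_comp_neg u x
    simp only [neg_apply, reflect_apply, dunklS_of_ne _ _ hx,
      dunklS_of_ne _ _ (neg_ne_zero.2 hx), h, neg_neg]
    push_cast
    ring

theorem dunklS_conjS (k : ℝ) (u : 𝓢(ℝ, ℂ)) : dunklS k (conjS u) = conjS (dunklS k u) :=
  schwartz_ext_ne_zero fun x hx => by
    have h : deriv (conjS u) x = starRingEnd ℂ (deriv u x) := deriv.star
    simp [dunklS_of_ne _ _ hx, h, Complex.conj_ofNat]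

theorem dunklS_pow_mulX (k : ℝ) (hk : -(1 / 2) ≤ k) (m : ℕ) : ∃ β : ℝ, |β| ≤ 2 * k + 1 ∧
    ∀ u : 𝓢(ℝ, ℂ), (dunklS k)^[m + 1] (mulX u) = mulX ((dunklS k)^[m + 1] u) +
      ((m : ℂ) + 1) • (dunklS k)^[m] u + (β : ℂ) • reflect ((dunklS k)^[m] u) := by
  suffices ∃ β : ℝ, (0 ≤ β ∧ β ≤ 2 * k + 1) ∧ ∀ u : 𝓢(ℝ, ℂ),
      (dunklS k)^[m + 1] (mulX u) = mulX ((dunklS k)^[m + 1] u) +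
      ((m : ℂ) + 1) • (dunklS k)^[m] u + (β : ℂ) • reflect ((dunklS k)^[m] u) by
    obtain ⟨β, ⟨h0, h1⟩, h⟩ := this
    exact ⟨β, by rwa [abs_of_nonneg h0], h⟩
  induction m with
  | zero => exact ⟨2 * k + 1, ⟨by linarith, le_rfl⟩, fun u => by simp [dunklS_mulX]⟩
  | succ m ih =>
    obtain ⟨β, ⟨h0, h1⟩, h⟩ := ih
    refine ⟨2 * k + 1 - β, ⟨by linarith, by linarith⟩, fun u => ?_⟩
    rw [Function.iterate_succ_apply' (n := m + 1), h]
    simp only [map_add, map_smul, dunklS_mulX, dunklS_reflect, ← Function.iterate_succ_apply']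
    push_cast
    module

section Transform

variable {k : ℝ}

theorem integrable_schwartz (hk : -(1 / 2) ≤ k) (u : 𝓢(ℝ, ℂ)) : Integrable u (muK k) := by
  have := hasTemperateGrowth_muK hk
  exact u.integrable

theorem integrable_schwartz_mul (hk : -(1 / 2) ≤ k) (u : 𝓢(ℝ, ℂ)) {v : ℝ → ℂ} {C : ℝ}
    (hv : Continuous v) (hb : ∀ x, ‖v x‖ ≤ C) : Integrable (fun x => u x * v x) (muK k) :=
  (integrable_schwartz hk u).mul_bdd hv.aestronglyMeasurable (ae_of_all _ hb)

theorem norm_schwartz_le (v : 𝓢(ℝ, ℂ)) (x : ℝ) : ‖v x‖ ≤ SchwartzMap.seminorm ℝ 0 0 v :=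
  v.norm_le_seminorm ℝ x

theorem one_add_abs_pow_le (x : ℝ) (m : ℕ) : (1 + |x|) ^ m ≤ 2 ^ m * (1 + |x| ^ m) := by
  rcases le_total |x| 1 with hx | hx
  · calc (1 + |x|) ^ m ≤ 2 ^ m := by gcongr; linarith
      _ ≤ _ := le_mul_of_one_le_right (by positivity) (le_add_of_nonneg_right (by positivity))
  · calc (1 + |x|) ^ m ≤ (2 * |x|) ^ m := by gcongr; linarith
      _ ≤ _ := by rw [mul_pow]; gcongr; linarith

theorem tendsto_weight_mul_of_decay (hk : -(1 / 2) ≤ k) {v : ℝ → ℂ}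
    (hv : ∀ n : ℕ, ∃ C, ∀ x, |x| ^ n * ‖v x‖ ≤ C) :
    Tendsto (fun x => weight k x * ‖v x‖) (cocompact ℝ) (𝓝 0) := by
  set m := ⌈2 * k + 1⌉₊
  obtain ⟨C₁, h₁⟩ := hv 1
  obtain ⟨C₂, h₂⟩ := hv (m + 1)
  have hc := weight_const_pos hk
  set c := 2 ^ (k + 1) * Real.Gamma (k + 1)
  have hlim : Tendsto (fun x : ℝ => 2 ^ m * (C₁ + C₂) / c * ‖x‖⁻¹) (cocompact ℝ) (𝓝 0) := by
    simpa using (tendsto_inv_atTop_zero.comp (tendsto_norm_cocompact_atTop (E := ℝ))).const_mul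
      (2 ^ m * (C₁ + C₂) / c)
  refine squeeze_zero' (.of_forall fun x => mul_nonneg (weight_nonneg hk x) (norm_nonneg _)) ?_ hlim
  have hne : ∀ᶠ x : ℝ in cocompact ℝ, x ≠ 0 := by
    filter_upwards [(isCompact_singleton (x := (0 : ℝ))).compl_mem_cocompact] with x hx using hx
  filter_upwards [hne] with x hx
  have hx' : 0 < |x| := abs_pos.2 hx
  rw [Real.norm_eq_abs, ← div_eq_mul_inv, le_div_iff₀ hx', le_div_iff₀' hc]
  have hw : c * weight k x ≤ (1 + |x|) ^ m := by
    rw [← le_div_iff₀' hc]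
    exact weight_le hk x
  calc c * (weight k x * ‖v x‖ * |x|) = (c * weight k x) * (‖v x‖ * |x|) := by ring
    _ ≤ (2 ^ m * (1 + |x| ^ m)) * (‖v x‖ * |x|) :=
      mul_le_mul_of_nonneg_right (hw.trans (one_add_abs_pow_le x m)) (by positivity)
    _ = 2 ^ m * (|x| ^ 1 * ‖v x‖ + |x| ^ (m + 1) * ‖v x‖) := by ring
    _ ≤ 2 ^ m * (C₁ + C₂) := by
      gcongr
      exacts [h₁ x, h₂ x]

theorem schwartz_decay (u : 𝓢(ℝ, ℂ)) (n : ℕ) : ∃ C, ∀ x, |x| ^ n * ‖u x‖ ≤ C :=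
  ⟨_, fun x => by simpa using SchwartzMap.le_seminorm' ℝ n 0 u x⟩

theorem integral_dunklS_mul (hk : -(1 / 2) ≤ k) (u : 𝓢(ℝ, ℂ)) {v Λv : ℝ → ℂ} {C C' : ℝ}
    (hv : HasDunklDeriv k v Λv) (hb : ∀ x, ‖v x‖ ≤ C) (hb' : ∀ x, ‖Λv x‖ ≤ C') :
    ∫ x, dunklS k u x * v x ∂muK k = -∫ x, u x * Λv x ∂muK k := by
  have h : Tendsto (fun x => (weight k x : ℂ) * (u x * v x)) (cocompact ℝ) (𝓝 0) := by
    refine squeeze_zero_norm (fun x => ?_) (by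
      simpa using (tendsto_weight_mul_of_decay hk (schwartz_decay u)).mul_const C)
    rw [norm_mul, norm_mul, norm_real, Real.norm_of_nonneg (weight_nonneg hk x), mul_assoc]
    exact mul_le_mul_of_nonneg_left (mul_le_mul_of_nonneg_left (hb x) (norm_nonneg _))
      (weight_nonneg hk x)
  refine HasDunklDeriv.integral_mul hk (hasDunklDeriv_dunklS k u) hv
    (integrable_schwartz_mul hk _ hv.differentiable.continuous hb)
    (integrable_schwartz_mul hk _ hv.continuous hb') (h.mono_left atTop_le_cocompact) ?_
  refine ((h.mono_left atBot_le_cocompact).comp tendsto_neg_atTop_atBot).congr fun L => ?_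
  simp only [Function.comp, weight_neg]

theorem dunklT_eq (k : ℝ) (u : ℝ → ℂ) (lam : ℝ) :
    dunklT k u lam = ∫ x, u x * dunklExp k (-lam * x) ∂muK k := by
  simp only [dunklT, dunklKernel_eq_dunklExp]

theorem continuous_dunklExp_mul (hk : -(1 / 2) ≤ k) (c : ℝ) :
    Continuous fun x => dunklExp k (c * x) :=
  (continuous_dunklExp hk).comp (by fun_prop)

theorem integrable_schwartz_mul_dunklExp (hk : -(1 / 2) ≤ k) (u : 𝓢(ℝ, ℂ)) (c : ℝ) :
    Integrable (fun x => u x * dunklExp k (c * x)) (muK k) :=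
  integrable_schwartz_mul hk u (continuous_dunklExp_mul hk c) fun _ => norm_dunklExp_le hk _

theorem dunklT_dunklS (hk : -(1 / 2) ≤ k) (u : 𝓢(ℝ, ℂ)) (lam : ℝ) :
    dunklT k (dunklS k u) lam = I * lam * dunklT k u lam := by
  rw [dunklT_eq, dunklT_eq, integral_dunklS_mul hk u (hasDunklDeriv_dunklExp hk (-lam))
    (fun x => norm_dunklExp_le hk _) (C' := |lam|) fun x => ?_, ← integral_neg, ← integral_const_mul]
  · congr 1 with x
    push_cast
    ring
  · rw [norm_mul, norm_mul, norm_I, norm_real, Real.norm_eq_abs, abs_neg, one_mul]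
    exact mul_le_of_le_one_right (abs_nonneg _) (norm_dunklExp_le hk _)

theorem dunklT_iterate (hk : -(1 / 2) ≤ k) (u : 𝓢(ℝ, ℂ)) (lam : ℝ) (n : ℕ) :
    dunklT k ((dunklS k)^[n] u) lam = (I * lam) ^ n * dunklT k u lam := by
  induction n with
  | zero => simp
  | succ n ih => rw [Function.iterate_succ_apply', dunklT_dunklS hk, ih, pow_succ']; ring

theorem norm_dunklT_le (hk : -(1 / 2) ≤ k) (u : 𝓢(ℝ, ℂ)) (lam : ℝ) :
    ‖dunklT k u lam‖ ≤ ∫ x, ‖u x‖ ∂muK k := by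
  rw [dunklT_eq]
  refine norm_integral_le_of_norm_le (integrable_schwartz hk u).norm (ae_of_all _ fun x => ?_)
  rw [norm_mul]
  exact mul_le_of_le_one_right (norm_nonneg _) (norm_dunklExp_le hk _)

theorem pow_mul_norm_dunklT_le (hk : -(1 / 2) ≤ k) (u : 𝓢(ℝ, ℂ)) (n : ℕ) (lam : ℝ) :
    |lam| ^ n * ‖dunklT k u lam‖ ≤ ∫ x, ‖(dunklS k)^[n] u x‖ ∂muK k := by
  have h := norm_dunklT_le hk ((dunklS k)^[n] u) lam
  rw [dunklT_iterate hk] at h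
  simpa using h

theorem dunklT_decay (hk : -(1 / 2) ≤ k) (u : 𝓢(ℝ, ℂ)) (n : ℕ) :
    ∃ C, ∀ x, |x| ^ n * ‖dunklT k u x‖ ≤ C :=
  ⟨_, pow_mul_norm_dunklT_le hk u n⟩

theorem continuous_dunklT (hk : -(1 / 2) ≤ k) (u : 𝓢(ℝ, ℂ)) : Continuous (dunklT k u) := by
  rw [funext (dunklT_eq k u)]
  refine continuous_of_dominated (bound := fun x => ‖u x‖) (fun lam =>
    (integrable_schwartz_mul_dunklExp hk u (-lam)).aestronglyMeasurable)
    (fun lam => ae_of_all _ fun x => ?_) (integrable_schwartz hk u).norm (ae_of_all _ fun x => ?_)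
  · rw [norm_mul]
    exact mul_le_of_le_one_right (norm_nonneg _) (norm_dunklExp_le hk _)
  · exact continuous_const.mul ((continuous_dunklExp hk).comp (by fun_prop))

theorem integrable_dunklT (hk : -(1 / 2) ≤ k) (u : 𝓢(ℝ, ℂ)) :
    Integrable (dunklT k u) (muK k) := by
  obtain ⟨n, hn⟩ := (hasTemperateGrowth_muK hk).exists_integrable
  obtain ⟨C₁, h₁⟩ := dunklT_decay hk u 0
  obtain ⟨C₂, h₂⟩ := dunklT_decay hk u n
  refine (hn.const_mul (2 ^ n * (C₁ + C₂))).mono' (continuous_dunklT hk u).aestronglyMeasurable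
    (ae_of_all _ fun x => ?_)
  have hx : 0 < 1 + ‖x‖ := by positivity
  rw [Real.rpow_neg hx.le, Real.rpow_natCast, ← div_eq_mul_inv, le_div_iff₀ (by positivity),
    Real.norm_eq_abs x]
  calc _ ≤ ‖dunklT k u x‖ * (2 ^ n * (1 + |x| ^ n)) := by
        gcongr
        exact one_add_abs_pow_le x n
    _ = 2 ^ n * (|x| ^ 0 * ‖dunklT k u x‖ + |x| ^ n * ‖dunklT k u x‖) := by ring
    _ ≤ _ := by
      gcongr
      exacts [h₁ x, h₂ x]

end Transform

theorem abs_pow_mul_gaussian_le (n : ℕ) (x : ℝ) :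
    |x| ^ n * Real.exp (-(x ^ 2 / 2)) ≤ 1 + 2 ^ n * n.factorial := by
  rw [Real.exp_neg, ← div_eq_mul_inv, div_le_iff₀ (Real.exp_pos _)]
  have h1 := Real.pow_div_factorial_le_exp (x ^ 2 / 2) (by positivity) n
  have h2 : 1 ≤ Real.exp (x ^ 2 / 2) := Real.one_le_exp (by positivity)
  rw [div_le_iff₀ (by positivity), div_pow, div_le_iff₀ (by positivity), pow_right_comm] at h1
  have h3 : |x| ^ n ≤ 1 + (x ^ n) ^ 2 := by
    rw [← abs_pow, ← sq_abs (x ^ n)]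
    nlinarith [sq_nonneg (|x ^ n| - 1)]
  nlinarith

theorem exists_polynomial_mul_gaussian_le (P : Polynomial ℝ) :
    ∃ C : ℝ, ∀ x : ℝ, |P.eval x| * Real.exp (-(x ^ 2 / 2)) ≤ C := by
  induction P using Polynomial.induction_on' with
  | add p q hp hq =>
    obtain ⟨C, hC⟩ := hp
    obtain ⟨D, hD⟩ := hq
    refine ⟨C + D, fun x => ?_⟩
    rw [Polynomial.eval_add]
    calc _ ≤ (|p.eval x| + |q.eval x|) * Real.exp (-(x ^ 2 / 2)) := by
          gcongr
          exact abs_add_le _ _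
      _ ≤ _ := by
        rw [add_mul]
        exact add_le_add (hC x) (hD x)
  | monomial n a =>
    refine ⟨|a| * (1 + 2 ^ n * n.factorial), fun x => ?_⟩
    rw [Polynomial.eval_monomial, abs_mul, abs_pow, mul_assoc]
    exact mul_le_mul_of_nonneg_left (abs_pow_mul_gaussian_le n x) (abs_nonneg a)

/-- The real Gaussian `exp (-x² / 2)` as a Schwartz function. -/
noncomputable def gaussianReal : 𝓢(ℝ, ℝ) where
  toFun x := Real.exp (-(x ^ 2 / 2))
  smooth' := by fun_prop
  decay' m n := by
    obtain ⟨C, hC⟩ := exists_polynomial_mul_gaussian_le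
      (Polynomial.X ^ m * (Polynomial.hermite n).map (Int.castRingHom ℝ))
    refine ⟨C, fun x => (le_of_eq ?_).trans (hC x)⟩
    rw [norm_iteratedFDeriv_eq_norm_iteratedDeriv, iteratedDeriv_eq_iterate,
      Polynomial.deriv_gaussian_eq_hermite_mul_gaussian, norm_mul, norm_mul, norm_pow, norm_neg,
      norm_one, one_pow, one_mul, Real.norm_of_nonneg (Real.exp_pos _).le, Polynomial.eval_mul,
      abs_mul, Polynomial.eval_pow, Polynomial.eval_X, abs_pow, Polynomial.eval_map,
      Polynomial.aeval_def, Real.norm_eq_abs, Real.norm_eq_abs, mul_assoc]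
    rfl

/-- The Gaussian `exp (-x² / 2)` as a complex-valued Schwartz function. -/
noncomputable def gaussianS : 𝓢(ℝ, ℂ) := SchwartzMap.postcompCLM (𝕜 := ℝ) ofRealCLM gaussianReal

theorem gaussianS_apply (x : ℝ) : gaussianS x = (Real.exp (-(x ^ 2 / 2)) : ℝ) := rfl

section GaussianMoment

variable {k : ℝ}

theorem gaussian_moment_eq (hk : -(1 / 2) ≤ k) (n : ℕ) (x : ℝ) :
    weight k x * (Real.exp (-(x ^ 2 / 2)) * x ^ (2 * n)) =
      (2 ^ (k + 1) * Real.Gamma (k + 1))⁻¹ *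
        (fun y => y ^ (2 * k + 1 + 2 * n) * Real.exp (-(1 / 2) * y ^ (2 : ℝ))) |x| := by
  have h : |x| ^ (2 * k + 1 + 2 * n) = |x| ^ (2 * k + 1) * x ^ (2 * n) := by
    rw [Real.rpow_add_of_nonneg (abs_nonneg x) (by linarith) (by positivity),
      ← Even.pow_abs (even_two_mul n) x, ← Real.rpow_natCast |x| (2 * n)]
    push_cast
    rfl
  simp only [h, weight, Real.rpow_two, sq_abs]
  rw [show -(1 / 2) * x ^ 2 = -(x ^ 2 / 2) by ring]
  ring

theorem integral_gaussian_moment (hk : -(1 / 2) ≤ k) (n : ℕ) :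
    ∫ x, weight k x * (Real.exp (-(x ^ 2 / 2)) * x ^ (2 * n)) =
      2 ^ n * Real.Gamma (n + k + 1) / Real.Gamma (k + 1) := by
  have hn : (0 : ℝ) ≤ n := n.cast_nonneg
  simp_rw [gaussian_moment_eq hk]
  rw [integral_const_mul, integral_comp_abs
    (f := fun y => y ^ (2 * k + 1 + 2 * n) * Real.exp (-(1 / 2) * y ^ (2 : ℝ))),
    integral_rpow_mul_exp_neg_mul_rpow two_pos (by linarith) (by norm_num),
    show (2 * k + 1 + 2 * n + 1) / 2 = n + (k + 1) by ring,
    show -(2 * k + 1 + 2 * n + 1) / 2 = -(n + (k + 1)) by ring, ← add_assoc,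
    one_div, Real.inv_rpow two_pos.le, Real.rpow_neg two_pos.le, inv_inv, add_assoc,
    Real.rpow_add two_pos n, Real.rpow_natCast]
  have h1 : (2 : ℝ) ^ (k + 1) ≠ 0 := by positivity
  field_simp

theorem integrable_gaussian_moment (hk : -(1 / 2) ≤ k) (n : ℕ) :
    Integrable fun x => weight k x * (Real.exp (-(x ^ 2 / 2)) * x ^ (2 * n)) := by
  by_contra h
  have h1 := integral_gaussian_moment hk n
  rw [integral_undef h] at h1
  have h2 := gamma_pos hk n
  have h3 := gamma_pos hk 0
  simp only [Nat.cast_zero, zero_add] at h3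
  exact (by positivity : 0 < 2 ^ n * Real.Gamma (n + k + 1) / Real.Gamma (k + 1)).ne h1

theorem besselCoeff_mul_moment (hk : -(1 / 2) ≤ k) (n : ℕ) (r : ℝ) :
    besselCoeff k n * (r / 2) ^ (2 * n) * (2 ^ n * Real.Gamma (n + k + 1) / Real.Gamma (k + 1)) =
      (-(r ^ 2 / 2)) ^ n / n.factorial := by
  have h2 := (gamma_pos hk n).ne'
  have h3 := gamma_pos hk 0
  simp only [Nat.cast_zero, zero_add] at h3
  have h3 := h3.ne'
  rw [besselCoeff, pow_mul, show -(r ^ 2 / 2) = -1 * (r / 2) ^ 2 * 2 by ring, mul_pow, mul_pow]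
  field_simp

theorem integral_gaussian_besselJ (hk : -(1 / 2) ≤ k) (r : ℝ) :
    ∫ x, weight k x * (Real.exp (-(x ^ 2 / 2)) * besselJ k (r * x)) =
      Real.exp (-(r ^ 2 / 2)) := by
  set F : ℕ → ℝ → ℝ := fun n x => besselCoeff k n * (r / 2) ^ (2 * n) *
    (weight k x * (Real.exp (-(x ^ 2 / 2)) * x ^ (2 * n))) with hF
  have hint : ∀ n, Integrable (F n) := fun n => (integrable_gaussian_moment hk n).const_mul _
  have hI : ∀ n, ∫ x, F n x = (-(r ^ 2 / 2)) ^ n / n.factorial := fun n => by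
    rw [integral_const_mul, integral_gaussian_moment hk, besselCoeff_mul_moment hk]
  have hN : ∀ n, ∫ x, ‖F n x‖ = (r ^ 2 / 2) ^ n / n.factorial := fun n => by
    have h1 : ∀ x, ‖F n x‖ = |besselCoeff k n * (r / 2) ^ (2 * n)| *
        (weight k x * (Real.exp (-(x ^ 2 / 2)) * x ^ (2 * n))) := fun x => by
      have h0 : 0 ≤ weight k x * (Real.exp (-(x ^ 2 / 2)) * x ^ (2 * n)) :=
        mul_nonneg (weight_nonneg hk x) (mul_nonneg (Real.exp_pos _).le
          (Even.pow_nonneg (even_two_mul n) x))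
      rw [hF, norm_mul, Real.norm_of_nonneg h0, Real.norm_eq_abs]
    have h2 : 0 ≤ 2 ^ n * Real.Gamma (n + k + 1) / Real.Gamma (k + 1) := by
      rw [← integral_gaussian_moment hk]
      exact integral_nonneg fun x => mul_nonneg (weight_nonneg hk x)
        (mul_nonneg (Real.exp_pos _).le (Even.pow_nonneg (even_two_mul n) x))
    simp_rw [h1]
    rw [integral_const_mul, integral_gaussian_moment hk, ← abs_of_nonneg h2, ← abs_mul,
      besselCoeff_mul_moment hk, abs_div, abs_pow, abs_neg, Nat.abs_cast,
      abs_of_nonneg (by positivity : 0 ≤ r ^ 2 / 2)]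
  have hs := hasSum_integral_of_summable_integral_norm hint (by
    simp_rw [hN]
    exact Real.summable_pow_div_factorial _)
  simp_rw [hI] at hs
  have hexp : HasSum (fun n : ℕ => (-(r ^ 2 / 2)) ^ n / n.factorial) (Real.exp (-(r ^ 2 / 2))) := by
    rw [Real.exp_eq_exp_ℝ]
    exact NormedSpace.expSeries_div_hasSum_exp _
  rw [← hs.unique hexp]
  congr 1 with x
  rw [besselJ_eq_besselSeries, besselSeries, ← tsum_mul_left, ← tsum_mul_left]
  congr 1 with n
  simp only [hF, mul_div_right_comm r x, pow_mul, mul_pow]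
  ring

theorem dunklT_gaussianS (hk : -(1 / 2) ≤ k) (lam : ℝ) :
    dunklT k gaussianS lam = gaussianS lam := by
  have hodd : ∫ x, gaussianS x * (I * besselOdd k (-lam * x)) ∂muK k = 0 := by
    rw [integral_muK hk]
    have h := integral_neg_eq_self
      (fun x : ℝ => (weight k x : ℂ) * (gaussianS x * (I * besselOdd k (-lam * x)))) volume
    simp only [weight_neg, gaussianS_apply, neg_sq, mul_neg, besselOdd_neg, ofReal_neg,
      integral_neg] at h
    simp only [gaussianS_apply]
    exact CharZero.eq_neg_self_iff.1 h.symm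
  have hJ : ∫ x, gaussianS x * (besselJ k (-lam * x) : ℂ) ∂muK k = gaussianS lam := by
    rw [integral_muK hk, gaussianS_apply, ← neg_sq lam, ← integral_gaussian_besselJ hk,
      ← integral_complex_ofReal]
    congr 1 with x
    rw [gaussianS_apply]
    push_cast
    rfl
  have hre : ∀ x, (besselJ k (-lam * x) : ℂ) =
      (dunklExp k (-lam * x) + dunklExp k (lam * x)) / 2 := fun x => by
    simp only [dunklExp, neg_mul, besselJ_neg, besselOdd_neg, ofReal_neg]
    ring
  have him : ∀ x, I * (besselOdd k (-lam * x) : ℂ) =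
      (dunklExp k (-lam * x) - dunklExp k (lam * x)) / 2 := fun x => by
    simp only [dunklExp, neg_mul, besselJ_neg, besselOdd_neg, ofReal_neg]
    ring
  have i1 := integrable_schwartz_mul_dunklExp hk gaussianS (-lam)
  have i2 := integrable_schwartz_mul_dunklExp hk gaussianS lam
  rw [dunklT_eq, ← hJ, ← add_zero (∫ x, gaussianS x * (besselJ k (-lam * x) : ℂ) ∂muK k), ← hodd,
    ← integral_add]
  · congr 1 with x
    rw [dunklExp]
    ring
  · simp_rw [hre]
    exact ((i1.add i2).div_const 2).congr (ae_of_all _ fun x => by simp only [Pi.add_apply]; ring)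
  · simp_rw [him]
    exact ((i1.sub i2).div_const 2).congr (ae_of_all _ fun x => by simp only [Pi.sub_apply]; ring)

end GaussianMoment

section Inversion

variable {k : ℝ}

theorem isLocallyFiniteMeasure_muK (hk : -(1 / 2) ≤ k) : IsLocallyFiniteMeasure (muK k) :=
  IsLocallyFiniteMeasure.withDensity_ofReal (continuous_weight hk)

/-- A Christoffel–Darboux type formula for the Dunkl kernel. -/
theorem sub_mul_intervalIntegral_dunklExp (hk : -(1 / 2) ≤ k) (x y : ℝ) {L : ℝ} (hL : 0 ≤ L) :
    (x - y) * ∫ t in (-L)..L, dunklExp k (-t * x) * dunklExp k (t * y) ∂muK k =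
      I * weight k L * (dunklExp k (-L * x) * dunklExp k (L * y) -
        dunklExp k (L * x) * dunklExp k (-L * y)) := by
  have h := HasDunklDeriv.integral_add hk (hasDunklDeriv_dunklExp hk (-x))
    (hasDunklDeriv_dunklExp hk y) hL
  have h2 : ∀ t : ℝ, I * (-x : ℝ) * dunklExp k (-x * t) * dunklExp k (y * t) +
      dunklExp k (-x * t) * (I * y * dunklExp k (y * t)) =
      (I * (y - x)) * (dunklExp k (-t * x) * dunklExp k (t * y)) := fun t => by
    rw [show -x * t = -t * x by ring, mul_comm y t]
    push_cast
    ring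
  simp_rw [h2] at h
  rw [intervalIntegral.integral_const_mul] at h
  rw [show (x : ℂ) - y = I * (I * (y - x)) by ring_nf; simp [I_sq]; ring, mul_assoc I, h]
  rw [show -x * L = -L * x by ring, show -x * -L = L * x by ring, mul_comm y L,
    show y * -L = -L * y by ring]
  ring

theorem intervalIntegral_dunklT_of_sub_mul (hk : -(1 / 2) ≤ k) {u h : 𝓢(ℝ, ℂ)} {y : ℝ}
    (hu : ∀ x, u x = (x - y) * h x) {L : ℝ} (hL : 0 ≤ L) :
    ∫ t in (-L)..L, dunklT k u t * dunklExp k (t * y) ∂muK k =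
      I * weight k L * (dunklT k h L * dunklExp k (L * y) -
        dunklT k h (-L) * dunklExp k (-L * y)) := by
  have := isLocallyFiniteMeasure_muK hk
  have he := continuous_dunklExp hk
  have hswap : ∫ t in (-L)..L, ∫ x, u x * (dunklExp k (-t * x) * dunklExp k (t * y)) ∂muK k ∂muK k =
      ∫ x, ∫ t in (-L)..L, u x * (dunklExp k (-t * x) * dunklExp k (t * y)) ∂muK k ∂muK k := by
    simp only [intervalIntegral.integral_of_le (neg_le_self hL)]
    have : IsFiniteMeasure ((muK k).restrict (Set.Ioc (-L) L)) :=
      ⟨by rw [Measure.restrict_apply_univ]; exact measure_Ioc_lt_top⟩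
    refine integral_integral_swap ?_
    have hi : Integrable (fun z : ℝ × ℝ => u z.2) (((muK k).restrict (Set.Ioc (-L) L)).prod (muK k)) :=
      (integrable_schwartz hk u).comp_snd _
    refine hi.mul_bdd (c := 1) (Continuous.aestronglyMeasurable ?_) (ae_of_all _ fun z => ?_)
    · exact (he.comp (by fun_prop)).mul (he.comp (by fun_prop))
    · rw [norm_mul]
      exact mul_le_one₀ (norm_dunklExp_le hk _) (norm_nonneg _) (norm_dunklExp_le hk _)
  have hl : ∀ t, dunklT k u t * dunklExp k (t * y) =
      ∫ x, u x * (dunklExp k (-t * x) * dunklExp k (t * y)) ∂muK k := fun t => by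
    rw [dunklT_eq, ← integral_mul_const]
    congr 1 with x
    ring
  have hr : ∀ x, ∫ t in (-L)..L, u x * (dunklExp k (-t * x) * dunklExp k (t * y)) ∂muK k =
      I * weight k L * (h x * dunklExp k (-L * x) * dunklExp k (L * y) -
        h x * dunklExp k (L * x) * dunklExp k (-L * y)) := fun x => by
    rw [intervalIntegral.integral_const_mul, hu, mul_right_comm, mul_comm _ (h x), mul_assoc (h x),
      sub_mul_intervalIntegral_dunklExp hk x y hL]
    ring
  simp_rw [hl]
  rw [hswap]
  simp_rw [hr]
  rw [integral_const_mul, integral_sub ((integrable_schwartz_mul_dunklExp hk h _).mul_const _)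
    ((integrable_schwartz_mul_dunklExp hk h _).mul_const _), integral_mul_const,
    integral_mul_const, dunklT_eq, dunklT_eq, neg_neg]

theorem integrable_dunklT_mul (hk : -(1 / 2) ≤ k) (u : 𝓢(ℝ, ℂ)) (y : ℝ) :
    Integrable (fun t => dunklT k u t * dunklExp k (t * y)) (muK k) :=
  (integrable_dunklT hk u).mul_bdd (c := 1)
    ((continuous_dunklExp hk).comp (by fun_prop)).aestronglyMeasurable
    (ae_of_all _ fun _ => norm_dunklExp_le hk _)

theorem integral_dunklT_of_apply_eq_zero (hk : -(1 / 2) ≤ k) (u : 𝓢(ℝ, ℂ)) {y : ℝ} (hu : u y = 0) :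
    ∫ t, dunklT k u t * dunklExp k (t * y) ∂muK k = 0 := by
  obtain ⟨h, hh⟩ := exists_schwartz_eq_sub_mul u hu
  have hlim := tendsto_weight_mul_of_decay hk (dunklT_decay hk h)
  refine tendsto_nhds_unique (intervalIntegral_tendsto_integral (integrable_dunklT_mul hk u y)
    tendsto_neg_atTop_atBot tendsto_id) ?_
  have h1 := (hlim.mono_left atTop_le_cocompact).add
    ((hlim.mono_left atBot_le_cocompact).comp tendsto_neg_atTop_atBot)
  rw [add_zero] at h1
  refine squeeze_zero_norm' ?_ h1
  filter_upwards [eventually_ge_atTop 0] with L hL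
  rw [id, intervalIntegral_dunklT_of_sub_mul hk hh hL, norm_mul, norm_mul, norm_I, one_mul,
    norm_real, Real.norm_of_nonneg (weight_nonneg hk L), Function.comp, weight_neg, ← mul_add]
  refine mul_le_mul_of_nonneg_left ((norm_sub_le _ _).trans (add_le_add ?_ ?_)) (weight_nonneg hk L)
  all_goals
    rw [norm_mul]
    exact mul_le_of_le_one_right (norm_nonneg _) (norm_dunklExp_le hk _)

theorem dunklT_sub_smul (hk : -(1 / 2) ≤ k) (u v : 𝓢(ℝ, ℂ)) (c : ℂ) (t : ℝ) :
    dunklT k (u - c • v : 𝓢(ℝ, ℂ)) t = dunklT k u t - c * dunklT k v t := by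
  rw [dunklT_eq, dunklT_eq, dunklT_eq, ← integral_const_mul, ← integral_sub
    (integrable_schwartz_mul_dunklExp hk u _) ((integrable_schwartz_mul_dunklExp hk v _).const_mul _)]
  congr 1 with x
  simp only [sub_apply, smul_apply, smul_eq_mul]
  ring

/-- The inversion formula for the Dunkl transform on the Schwartz space. -/
theorem integral_dunklT_mul_dunklExp (hk : -(1 / 2) ≤ k) (g : 𝓢(ℝ, ℂ)) (y : ℝ) :
    ∫ t, dunklT k g t * dunklExp k (t * y) ∂muK k = g y := by
  have hne : gaussianS y ≠ 0 := by
    rw [gaussianS_apply]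
    exact ofReal_ne_zero.2 (Real.exp_pos _).ne'
  set c := g y / gaussianS y
  have h := integral_dunklT_of_apply_eq_zero hk (g - c • gaussianS) (y := y) (by
    simp only [sub_apply, smul_apply, smul_eq_mul, c]
    field_simp
    simp)
  simp_rw [dunklT_sub_smul hk, sub_mul, mul_assoc] at h
  rw [integral_sub (integrable_dunklT_mul hk g y) ((integrable_dunklT_mul hk gaussianS y).const_mul _),
    integral_const_mul, sub_eq_zero] at h
  have h2 : ∫ t, dunklT k gaussianS t * dunklExp k (t * y) ∂muK k = gaussianS y := by
    simp_rw [dunklT_gaussianS hk]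
    have h3 := dunklT_gaussianS hk (-y)
    rw [dunklT_eq, neg_neg] at h3
    simp_rw [mul_comm _ y]
    rw [h3, gaussianS_apply, gaussianS_apply, neg_sq]
  rw [h, h2]
  exact div_mul_cancel₀ _ hne

theorem norm_iterate_le_of_support (hk : -(1 / 2) ≤ k) (g : 𝓢(ℝ, ℂ)) {R : ℝ}
    (hR : ∀ t, R < |t| → dunklT k g t = 0) (n : ℕ) (y : ℝ) :
    ‖(dunklS k)^[n] g y‖ ≤ |R| ^ n * ∫ t, ‖dunklT k g t‖ ∂muK k := by
  rw [← integral_dunklT_mul_dunklExp hk, ← integral_const_mul]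
  refine norm_integral_le_of_norm_le ((integrable_dunklT hk g).norm.const_mul _)
    (ae_of_all _ fun t => ?_)
  rw [norm_mul, dunklT_iterate hk]
  refine (mul_le_of_le_one_right (norm_nonneg _) (norm_dunklExp_le hk _)).trans ?_
  rw [norm_mul, norm_pow, norm_mul, norm_I, one_mul, norm_real, Real.norm_eq_abs]
  rcases le_or_gt |t| R with ht | ht
  · exact mul_le_mul_of_nonneg_right
      (pow_le_pow_left₀ (abs_nonneg t) (ht.trans (le_abs_self R)) n) (norm_nonneg _)
  · simp [hR t ht]

end Inversion

section Bootstrap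

variable {k : ℝ}

/-- The bilinear pairing of Schwartz functions with respect to `muK k`. -/
noncomputable def pairing (k : ℝ) (u h : 𝓢(ℝ, ℂ)) : ℂ := ∫ x, u x * h x ∂muK k

theorem integrable_mul_schwartz (hk : -(1 / 2) ≤ k) (u h : 𝓢(ℝ, ℂ)) :
    Integrable (fun x => u x * h x) (muK k) :=
  integrable_schwartz_mul hk u h.continuous (norm_schwartz_le h)

theorem pairing_add (hk : -(1 / 2) ≤ k) (u v h : 𝓢(ℝ, ℂ)) :
    pairing k (u + v) h = pairing k u h + pairing k v h := by
  simp only [pairing]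
  rw [← integral_add (integrable_mul_schwartz hk u h) (integrable_mul_schwartz hk v h)]
  simp only [add_apply, add_mul]

theorem pairing_smul (c : ℂ) (u h : 𝓢(ℝ, ℂ)) : pairing k (c • u) h = c * pairing k u h := by
  simp only [pairing]
  rw [← integral_const_mul]
  simp only [smul_apply, smul_eq_mul, mul_assoc]

theorem pairing_mulX (u h : 𝓢(ℝ, ℂ)) : pairing k (mulX u) h = pairing k u (mulX h) := by
  simp only [pairing, mulX_apply]
  congr 1 with x
  ring

theorem pairing_reflect (hk : -(1 / 2) ≤ k) (u h : 𝓢(ℝ, ℂ)) :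
    pairing k (reflect u) h = pairing k u (reflect h) := by
  simp only [pairing, integral_muK hk, reflect_apply]
  rw [← integral_neg_eq_self]
  simp only [weight_neg, neg_neg]

theorem pairing_dunklS (hk : -(1 / 2) ≤ k) (u h : 𝓢(ℝ, ℂ)) :
    pairing k (dunklS k u) h = -pairing k u (dunklS k h) :=
  integral_dunklS_mul hk u (hasDunklDeriv_dunklS k h) (norm_schwartz_le _) (norm_schwartz_le _)

theorem pairing_iterate (hk : -(1 / 2) ≤ k) (u h : 𝓢(ℝ, ℂ)) (n : ℕ) :
    pairing k ((dunklS k)^[n] u) h = (-1) ^ n * pairing k u ((dunklS k)^[n] h) := by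
  induction n generalizing h with
  | zero => simp
  | succ n ih =>
    rw [Function.iterate_succ_apply', pairing_dunklS hk, ih, Function.iterate_succ_apply, pow_succ]
    ring

theorem norm_pairing_mulX_le (hk : -(1 / 2) ≤ k) (m : ℕ) (w h : 𝓢(ℝ, ℂ)) :
    ‖pairing k ((dunklS k)^[m + 1] (mulX w)) h‖ ≤
      ‖pairing k ((dunklS k)^[m + 1] w) (mulX h)‖ + (m + 1) * ‖pairing k ((dunklS k)^[m] w) h‖ +
        (2 * k + 1) * ‖pairing k ((dunklS k)^[m] w) (reflect h)‖ := by
  obtain ⟨β, hβ, h1⟩ := dunklS_pow_mulX k hk m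
  rw [h1, pairing_add hk, pairing_add hk, pairing_smul, pairing_smul, pairing_mulX,
    pairing_reflect hk]
  refine (norm_add₃_le).trans ?_
  rw [norm_mul, norm_mul, norm_real, Real.norm_eq_abs]
  have h2 : ‖(m : ℂ) + 1‖ = m + 1 := by exact_mod_cast Complex.norm_natCast (m + 1)
  rw [h2]
  gcongr

theorem exists_pairing_mulX_iterate_le (hk : -(1 / 2) ≤ k) {g : 𝓢(ℝ, ℂ)}
    (hg : ∀ h : 𝓢(ℝ, ℂ), ∃ C R : ℝ, 0 ≤ C ∧ 1 ≤ R ∧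
      ∀ n, ‖pairing k ((dunklS k)^[n] g) h‖ ≤ C * R ^ n) (j : ℕ) (h : 𝓢(ℝ, ℂ)) :
    ∃ C R : ℝ, 0 ≤ C ∧ 1 ≤ R ∧ ∀ m n,
      ‖pairing k ((dunklS k)^[m] (mulX^[j] ((dunklS k)^[n] g))) h‖ ≤ C * R ^ (m + n) := by
  induction j generalizing h with
  | zero =>
    obtain ⟨C, R, hC, hR, H⟩ := hg h
    refine ⟨C, R, hC, hR, fun m n => ?_⟩
    rw [Function.iterate_zero_apply, ← Function.iterate_add_apply]
    exact H _
  | succ j ih =>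
    obtain ⟨C₁, R₁, hC₁, hR₁, h₁⟩ := ih (mulX h)
    obtain ⟨C₂, R₂, hC₂, hR₂, h₂⟩ := ih h
    obtain ⟨C₃, R₃, hC₃, hR₃, h₃⟩ := ih (reflect h)
    have hk' : 0 ≤ 2 * k + 1 := by linarith
    refine ⟨C₁ + C₂ + (2 * k + 1) * C₃, 2 * (R₁ + R₂ + R₃), by positivity, by linarith,
      fun m n => ?_⟩
    set R := 2 * (R₁ + R₂ + R₃) with hR
    rw [Function.iterate_succ_apply']
    rcases m with _ | m
    · rw [Function.iterate_zero_apply, pairing_mulX]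
      refine (h₁ 0 n).trans (mul_le_mul ?_ ?_ (by positivity) (by positivity))
      · have : 0 ≤ (2 * k + 1) * C₃ := by positivity
        linarith
      · exact pow_le_pow_left₀ (by linarith) (by linarith) _
    · refine (norm_pairing_mulX_le hk m _ h).trans ?_
      have e1 : R₁ ^ (m + 1 + n) ≤ R ^ (m + 1 + n) :=
        pow_le_pow_left₀ (by linarith) (by linarith) _
      have e2 : (m + 1) * R₂ ^ (m + n) ≤ R ^ (m + 1 + n) := by
        have h4 : ((m : ℝ) + 1) ≤ 2 ^ (m + n) := by
          calc ((m : ℝ) + 1) ≤ 2 ^ m := by exact_mod_cast Nat.lt_two_pow_self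
            _ ≤ 2 ^ (m + n) := pow_le_pow_right₀ (by norm_num) (by omega)
        calc _ ≤ 2 ^ (m + n) * R₂ ^ (m + n) := by gcongr
          _ = (2 * R₂) ^ (m + n) := (mul_pow _ _ _).symm
          _ ≤ R ^ (m + n) := pow_le_pow_left₀ (by linarith) (by linarith) _
          _ ≤ _ := pow_le_pow_right₀ (by linarith) (by omega)
      have e3 : R₃ ^ (m + n) ≤ R ^ (m + 1 + n) :=
        (pow_le_pow_left₀ (by linarith) (by linarith) _).trans
          (pow_le_pow_right₀ (by linarith) (by omega))
      calc _ ≤ C₁ * R₁ ^ (m + 1 + n) + (m + 1) * (C₂ * R₂ ^ (m + n)) +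
            (2 * k + 1) * (C₃ * R₃ ^ (m + n)) := by
            gcongr
            exacts [h₁ (m + 1) n, h₂ m n, h₃ m n]
        _ = C₁ * R₁ ^ (m + 1 + n) + C₂ * ((m + 1) * R₂ ^ (m + n)) +
            (2 * k + 1) * (C₃ * R₃ ^ (m + n)) := by ring
        _ ≤ C₁ * R ^ (m + 1 + n) + C₂ * R ^ (m + 1 + n) +
            (2 * k + 1) * (C₃ * R ^ (m + 1 + n)) := by gcongr
        _ = _ := by ring

theorem iterate_dunklS_conjS (u : 𝓢(ℝ, ℂ)) (n : ℕ) :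
    (dunklS k)^[n] (conjS u) = conjS ((dunklS k)^[n] u) := by
  induction n with
  | zero => rfl
  | succ n ih => rw [Function.iterate_succ_apply', ih, dunklS_conjS, Function.iterate_succ_apply']

theorem iterate_mulX_apply (u : 𝓢(ℝ, ℂ)) (j : ℕ) (x : ℝ) : mulX^[j] u x = x ^ j * u x := by
  induction j with
  | zero => simp
  | succ j ih => rw [Function.iterate_succ_apply', mulX_apply, ih, pow_succ']; ring

theorem pairing_mulX_conjS (u : 𝓢(ℝ, ℂ)) (j : ℕ) :
    pairing k (mulX^[j] u) (conjS u) = (∫ x, x ^ j * ‖u x‖ ^ 2 ∂muK k : ℝ) := by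
  rw [pairing, ← integral_complex_ofReal]
  congr 1 with x
  rw [iterate_mulX_apply, conjS_apply, mul_assoc, mul_conj, normSq_eq_norm_sq]
  push_cast
  rfl

theorem exists_integral_sq_le (hk : -(1 / 2) ≤ k) {g : 𝓢(ℝ, ℂ)}
    (hg : ∀ h : 𝓢(ℝ, ℂ), ∃ C R : ℝ, 0 ≤ C ∧ 1 ≤ R ∧
      ∀ n, ‖pairing k ((dunklS k)^[n] g) h‖ ≤ C * R ^ n) (j : ℕ) :
    ∃ C R : ℝ, 0 ≤ C ∧ 1 ≤ R ∧ ∀ n,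
      ∫ x, x ^ j * ‖(dunklS k)^[n] g x‖ ^ 2 ∂muK k ≤ C * R ^ n := by
  obtain ⟨C, R, hC, hR, H⟩ := exists_pairing_mulX_iterate_le hk hg j (conjS g)
  refine ⟨C, R ^ 2, hC, one_le_pow₀ hR, fun n => ?_⟩
  rw [← pow_mul, two_mul]
  refine le_trans ?_ (H n n)
  rw [pairing_iterate hk, iterate_dunklS_conjS, pairing_mulX_conjS, norm_mul, norm_pow, norm_neg,
    norm_one, one_pow, one_mul, norm_real]
  exact le_abs_self _

theorem integrable_pow_mul_norm_sq (hk : -(1 / 2) ≤ k) (u : 𝓢(ℝ, ℂ)) (j : ℕ) :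
    Integrable (fun x => x ^ j * ‖u x‖ ^ 2) (muK k) := by
  have h := (integrable_mul_schwartz hk (mulX^[j] u) (conjS u)).re
  refine h.congr (ae_of_all _ fun x => ?_)
  simp only [iterate_mulX_apply, conjS_apply, mul_assoc, mul_conj, normSq_eq_norm_sq]
  norm_cast

theorem le_inv_add_mul_sq {t w : ℝ} (hw : 0 < w) : t ≤ w⁻¹ + w * t ^ 2 := by
  rw [inv_eq_one_div, div_add' _ _ _ hw.ne', le_div_iff₀ hw]
  nlinarith [sq_nonneg (t * w - 1), sq_nonneg (t * w)]

theorem one_add_norm_pow_le (N : ℕ) (x : ℝ) : (1 + ‖x‖) ^ N ≤ 2 ^ N * (2 + x ^ (2 * N)) := by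
  refine (one_add_abs_pow_le x N).trans (mul_le_mul_of_nonneg_left ?_ (by positivity))
  have h : x ^ (2 * N) = (|x| ^ N) ^ 2 := by rw [pow_mul', ← sq_abs (x ^ N), abs_pow]
  rw [h]
  nlinarith [sq_nonneg (|x| ^ N - 1)]

theorem norm_le_rpow_add (N : ℕ) (u : 𝓢(ℝ, ℂ)) (x : ℝ) :
    ‖u x‖ ≤ (1 + ‖x‖) ^ (-(N : ℝ)) +
      2 ^ N * (2 * (x ^ 0 * ‖u x‖ ^ 2) + x ^ (2 * N) * ‖u x‖ ^ 2) := by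
  rw [Real.rpow_neg (by positivity), Real.rpow_natCast]
  refine (le_inv_add_mul_sq (w := (1 + ‖x‖) ^ N) (by positivity)).trans (add_le_add le_rfl ?_)
  refine (mul_le_mul_of_nonneg_right (one_add_norm_pow_le N x) (sq_nonneg _)).trans_eq ?_
  ring

theorem integral_norm_le (hk : -(1 / 2) ≤ k) {N : ℕ}
    (hN : Integrable (fun x : ℝ => (1 + ‖x‖) ^ (-(N : ℝ))) (muK k)) (u : 𝓢(ℝ, ℂ)) :
    ∫ x, ‖u x‖ ∂muK k ≤ ∫ x : ℝ, (1 + ‖x‖) ^ (-(N : ℝ)) ∂muK k +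
      2 ^ N * (2 * (∫ x, x ^ 0 * ‖u x‖ ^ 2 ∂muK k) + ∫ x, x ^ (2 * N) * ‖u x‖ ^ 2 ∂muK k) := by
  have i1 := (integrable_pow_mul_norm_sq hk u 0).const_mul 2
  have i2 := integrable_pow_mul_norm_sq hk u (2 * N)
  have i3 := (i1.add i2).const_mul (2 ^ N)
  refine (integral_mono (integrable_schwartz hk u).norm (hN.add i3)
    (norm_le_rpow_add N u)).trans_eq ?_
  refine (integral_add hN i3).trans ?_
  rw [← integral_const_mul, ← integral_add i1 i2, ← integral_const_mul]
  rfl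

theorem exists_integral_norm_le (hk : -(1 / 2) ≤ k) {g : 𝓢(ℝ, ℂ)}
    (hg : ∀ h : 𝓢(ℝ, ℂ), ∃ C R : ℝ, 0 ≤ C ∧ 1 ≤ R ∧
      ∀ n, ‖pairing k ((dunklS k)^[n] g) h‖ ≤ C * R ^ n) :
    ∃ C R : ℝ, 0 ≤ C ∧ 1 ≤ R ∧ ∀ n, ∫ x, ‖(dunklS k)^[n] g x‖ ∂muK k ≤ C * R ^ n := by
  have hμ := hasTemperateGrowth_muK hk
  obtain ⟨N, hN⟩ := hμ.exists_integrable
  obtain ⟨C₁, R₁, hC₁, hR₁, h₁⟩ := exists_integral_sq_le hk hg 0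
  obtain ⟨C₂, R₂, hC₂, hR₂, h₂⟩ := exists_integral_sq_le hk hg (2 * N)
  have hA0 : 0 ≤ ∫ x : ℝ, (1 + ‖x‖) ^ (-(N : ℝ)) ∂muK k := integral_nonneg fun x => by positivity
  have key := fun n => integral_norm_le hk hN ((dunklS k)^[n] g)
  generalize ∫ x : ℝ, (1 + ‖x‖) ^ (-(N : ℝ)) ∂muK k = A at hA0 key
  refine ⟨A + 2 ^ N * (2 * C₁ + C₂), R₁ + R₂, by positivity, by linarith, fun n => ?_⟩
  have e1 : C₁ * R₁ ^ n ≤ C₁ * (R₁ + R₂) ^ n :=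
    mul_le_mul_of_nonneg_left (pow_le_pow_left₀ (by linarith) (by linarith) _) hC₁
  have e2 : C₂ * R₂ ^ n ≤ C₂ * (R₁ + R₂) ^ n :=
    mul_le_mul_of_nonneg_left (pow_le_pow_left₀ (by linarith) (by linarith) _) hC₂
  have e3 : A ≤ A * (R₁ + R₂) ^ n := le_mul_of_one_le_right hA0 (one_le_pow₀ (by linarith))
  have e4 := (h₁ n).trans e1
  have e5 := (h₂ n).trans e2
  have e6 : (0 : ℝ) ≤ 2 ^ N := by positivity
  refine (key n).trans ?_
  calc _ ≤ A * (R₁ + R₂) ^ n + 2 ^ N * (2 * (C₁ * (R₁ + R₂) ^ n) + C₂ * (R₁ + R₂) ^ n) :=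
      add_le_add e3 (mul_le_mul_of_nonneg_left
        (add_le_add (mul_le_mul_of_nonneg_left e4 zero_le_two) e5) e6)
    _ = _ := by ring

end Bootstrap

section Chirp

variable {k : ℝ}

/-- The chirp `x ↦ exp (i c x²)`. -/
noncomputable def chirp (c : ℝ) (x : ℝ) : ℂ := Complex.exp (I * ((c * x ^ 2 : ℝ) : ℂ))

theorem hasDerivAt_exp_I_mul (s : ℝ) :
    HasDerivAt (fun s : ℝ => Complex.exp (I * s)) (I * Complex.exp (I * s)) s := by
  have h := ((hasDerivAt_id (s : ℂ)).const_mul I).cexp.comp_ofReal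
  simpa [mul_comm] using h

theorem iteratedDeriv_exp_I_mul (n : ℕ) :
    iteratedDeriv n (fun s : ℝ => Complex.exp (I * s)) =
      fun s : ℝ => I ^ n * Complex.exp (I * s) := by
  induction n with
  | zero => simp
  | succ n ih =>
    rw [iteratedDeriv_succ, ih]
    ext s
    rw [((hasDerivAt_exp_I_mul s).const_mul (I ^ n)).deriv, pow_succ, mul_assoc]

theorem norm_exp_I_mul (s : ℝ) : ‖Complex.exp (I * s)‖ = 1 := by
  rw [mul_comm, norm_exp_ofReal_mul_I]

theorem hasTemperateGrowth_chirp (c : ℝ) : (chirp c).HasTemperateGrowth := by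
  have h1 : (fun s : ℝ => Complex.exp (I * s)).HasTemperateGrowth := by
    refine ⟨((contDiff_const.mul ofRealCLM.contDiff).cexp), fun n => ⟨0, 1, fun s => ?_⟩⟩
    rw [norm_iteratedFDeriv_eq_norm_iteratedDeriv, iteratedDeriv_exp_I_mul]
    simp
  have h2 : (fun x : ℝ => c * x ^ 2).HasTemperateGrowth := by fun_prop
  exact h1.comp h2

theorem norm_chirp (c x : ℝ) : ‖chirp c x‖ = 1 := norm_exp_I_mul _

theorem chirp_neg_arg (c x : ℝ) : chirp c (-x) = chirp c x := by simp [chirp]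

theorem chirp_neg_mul_chirp (c x : ℝ) : chirp (-c) x * chirp c x = 1 := by
  rw [chirp, chirp, ← Complex.exp_add, ← Complex.exp_zero]
  congr 1
  push_cast
  ring

theorem hasDerivAt_chirp (c x : ℝ) :
    HasDerivAt (chirp c) (2 * I * c * x * chirp c x) x := by
  have h := (hasDerivAt_exp_I_mul (c * x ^ 2)).scomp x ((hasDerivAt_pow 2 x).const_mul c)
  refine h.congr_deriv ?_
  simp only [chirp, real_smul]
  push_cast
  ring

/-- Multiplication of a Schwartz function by a chirp. -/
noncomputable def chirpMul (c : ℝ) (u : 𝓢(ℝ, ℂ)) : 𝓢(ℝ, ℂ) := SchwartzMap.smulLeftCLM ℂ (chirp c) u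

theorem chirpMul_apply (c : ℝ) (u : 𝓢(ℝ, ℂ)) (x : ℝ) : chirpMul c u x = chirp c x * u x := by
  rw [chirpMul, SchwartzMap.smulLeftCLM_apply_apply (hasTemperateGrowth_chirp c), smul_eq_mul]

theorem chirpMul_neg_chirpMul (c : ℝ) (u : 𝓢(ℝ, ℂ)) : chirpMul (-c) (chirpMul c u) = u := by
  ext x
  rw [chirpMul_apply, chirpMul_apply, ← mul_assoc, chirp_neg_mul_chirp, one_mul]

theorem deriv_chirpMul (c : ℝ) (u : 𝓢(ℝ, ℂ)) (x : ℝ) :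
    deriv (chirpMul c u) x = 2 * I * c * x * chirpMul c u x + chirp c x * deriv u x := by
  have h : (chirpMul c u : ℝ → ℂ) = chirp c * ⇑u := funext (chirpMul_apply c u)
  rw [h, ((hasDerivAt_chirp c x).mul u.differentiableAt.hasDerivAt).deriv, Pi.mul_apply, mul_assoc]

theorem dunklS_chirpMul (c : ℝ) (u : 𝓢(ℝ, ℂ)) :
    dunklS k (chirpMul c u) = (2 * I * c) • mulX (chirpMul c u) + chirpMul c (dunklS k u) := by
  refine schwartz_ext_ne_zero fun x hx => ?_
  simp only [add_apply, smul_apply, smul_eq_mul, mulX_apply]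
  rw [dunklS_of_ne k _ hx, deriv_chirpMul, chirpMul_apply c (dunklS k u), dunklS_of_ne k _ hx,
    chirpMul_apply, chirpMul_apply, chirp_neg_arg]
  ring

theorem lcdOp_chirpMul (a b : ℝ) (u : 𝓢(ℝ, ℂ)) :
    lcdOp k a b (chirpMul (-(a / b / 2)) u) = chirpMul (-(a / b / 2)) (dunklS k u) := by
  ext x
  rw [lcdOp, dunklOp_coe, dunklS_chirpMul]
  simp only [add_apply, smul_apply, smul_eq_mul, mulX_apply]
  push_cast
  ring

theorem iterate_deltaOp (a b : ℝ) (f : 𝓢(ℝ, ℂ)) (n : ℕ) :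
    (deltaOp k a b)^[n] f =
      chirpMul (-(a / b / 2)) ((dunklS k)^[2 * n] (chirpMul (a / b / 2) f)) := by
  induction n with
  | zero => simp [chirpMul_neg_chirpMul]
  | succ n ih =>
    rw [Function.iterate_succ_apply', ih, deltaOp, lcdOp_chirpMul, lcdOp_chirpMul, mul_add_one,
      Function.iterate_succ_apply', Function.iterate_succ_apply']

theorem eLpNorm_iterate_deltaOp (a b : ℝ) (f : 𝓢(ℝ, ℂ)) (n : ℕ) (p : ℝ≥0∞) (μ : Measure ℝ) :
    eLpNorm ((deltaOp k a b)^[n] f) p μ =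
      eLpNorm ((dunklS k)^[2 * n] (chirpMul (a / b / 2) f)) p μ := by
  rw [iterate_deltaOp]
  refine eLpNorm_congr_norm_ae (ae_of_all _ fun x => ?_)
  rw [chirpMul_apply, norm_mul, norm_chirp, one_mul]

theorem lcdt_eq (a b d : ℝ) (f : 𝓢(ℝ, ℂ)) (lam : ℝ) :
    lcdt k a b d f lam = ((I * (b : ℂ)) ^ ((k : ℂ) + 1))⁻¹ * chirp (d / b / 2) lam *
      dunklT k (chirpMul (a / b / 2) f) (lam / b) := by
  rw [lcdt, dunklT, mul_assoc ((I * (b : ℂ)) ^ ((k : ℂ) + 1))⁻¹,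
    ← integral_const_mul (chirp (d / b / 2) lam)]
  congr 1
  refine integral_congr_ae (ae_of_all _ fun x => ?_)
  have h : Complex.exp (I / 2 * (((d / b : ℝ) : ℂ) * (lam : ℂ) ^ 2 +
      ((a / b : ℝ) : ℂ) * (x : ℂ) ^ 2)) = chirp (d / b / 2) lam * chirp (a / b / 2) x := by
    rw [chirp, chirp, ← Complex.exp_add]
    congr 1
    push_cast
    ring
  simp only [h, chirpMul_apply, neg_div]
  ring

theorem lcdt_eq_zero_iff {b : ℝ} (hb : b ≠ 0) (a d : ℝ) (f : 𝓢(ℝ, ℂ)) (lam : ℝ) :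
    lcdt k a b d f lam = 0 ↔ dunklT k (chirpMul (a / b / 2) f) (lam / b) = 0 := by
  have h1 : ((I * (b : ℂ)) ^ ((k : ℂ) + 1))⁻¹ ≠ 0 := by
    refine inv_ne_zero ?_
    simp [cpow_eq_zero_iff, hb]
  have h2 : chirp (d / b / 2) lam ≠ 0 := Complex.exp_ne_zero _
  rw [lcdt_eq, mul_eq_zero, or_iff_right (mul_ne_zero h1 h2)]

theorem isCompact_tsupport_lcdt_iff {b : ℝ} (hb : b ≠ 0) (a d : ℝ) (f : 𝓢(ℝ, ℂ)) :
    IsCompact (tsupport (lcdt k a b d f)) ↔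
      ∃ R, ∀ t, R < |t| → dunklT k (chirpMul (a / b / 2) f) t = 0 := by
  have hb' : 0 < |b| := abs_pos.2 hb
  constructor
  · intro h
    obtain ⟨R, hR⟩ := h.isBounded.subset_closedBall 0
    refine ⟨R / |b|, fun t ht => ?_⟩
    by_contra hne
    have h1 : lcdt k a b d f (t * b) ≠ 0 := by
      rwa [ne_eq, lcdt_eq_zero_iff hb, mul_div_cancel_right₀ _ hb]
    have h2 := hR (subset_tsupport _ h1)
    rw [mem_closedBall_zero_iff, Real.norm_eq_abs, abs_mul] at h2
    rw [div_lt_iff₀ hb'] at ht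
    linarith
  · rintro ⟨R, hR⟩
    refine HasCompactSupport.of_support_subset_isCompact
      (isCompact_closedBall (0 : ℝ) (R * |b|)) fun lam hlam => ?_
    by_contra hne
    rw [mem_closedBall_zero_iff, Real.norm_eq_abs, not_le] at hne
    refine hlam ((lcdt_eq_zero_iff hb a d f lam).2 (hR _ ?_))
    rwa [abs_div, lt_div_iff₀ hb']

end Chirp

section Growth

open scoped NNReal

theorem limsup_rpow_inv_lt_top_iff {x : ℕ → ℝ≥0∞} (hx : ∀ n, x n < ⊤) :
    limsup (fun n : ℕ => x n ^ (1 / (n : ℝ))) atTop < ⊤ ↔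
      ∃ C R : ℝ≥0, 1 ≤ R ∧ ∀ n, x n ≤ C * (R : ℝ≥0∞) ^ n := by
  constructor
  · intro h
    obtain ⟨r, hr, -⟩ := ENNReal.lt_iff_exists_nnreal_btwn.1 h
    obtain ⟨N, hN⟩ := eventually_atTop.1 (eventually_lt_of_limsup_lt hr)
    refine ⟨1 + ∑ n ∈ Finset.range (N + 1), (x n).toNNReal, max 1 r, le_max_left _ _, fun n => ?_⟩
    have hR : (1 : ℝ≥0∞) ≤ ((max 1 r : ℝ≥0) : ℝ≥0∞) := by exact_mod_cast le_max_left 1 r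
    rcases lt_or_ge n (N + 1) with hn | hn
    · have h1 : (x n).toNNReal ≤ 1 + ∑ n ∈ Finset.range (N + 1), (x n).toNNReal :=
        (Finset.single_le_sum (f := fun n => (x n).toNNReal) (fun _ _ => zero_le)
          (Finset.mem_range.2 hn)).trans le_add_self
      calc x n = ((x n).toNNReal : ℝ≥0∞) := (ENNReal.coe_toNNReal (hx n).ne).symm
        _ ≤ ((1 + ∑ n ∈ Finset.range (N + 1), (x n).toNNReal : ℝ≥0) : ℝ≥0∞) := by
          exact_mod_cast h1
        _ ≤ _ := le_mul_of_one_le_right' (one_le_pow₀ hR)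
    · have hn0 : (n : ℝ) ≠ 0 := by exact_mod_cast (by omega : n ≠ 0)
      have h1 : x n ≤ (r : ℝ≥0∞) ^ n := by
        calc x n = (x n ^ (1 / (n : ℝ))) ^ n := by
              rw [← ENNReal.rpow_natCast, ← ENNReal.rpow_mul, one_div_mul_cancel hn0,
                ENNReal.rpow_one]
          _ ≤ _ := pow_le_pow_left' (hN n (by omega)).le n
      have h2 : (r : ℝ≥0∞) ^ n ≤ ((max 1 r : ℝ≥0) : ℝ≥0∞) ^ n :=
        pow_le_pow_left' (by exact_mod_cast le_max_right 1 r) n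
      refine (h1.trans h2).trans (le_mul_of_one_le_left' ?_)
      exact_mod_cast le_self_add
  · rintro ⟨C, R, -, h⟩
    refine lt_of_le_of_lt (limsup_le_of_le (a := ((1 + C) * R : ℝ≥0∞)) (by isBoundedDefault) ?_)
      (by finiteness)
    filter_upwards [eventually_ge_atTop 1] with n hn
    have hn0 : (n : ℝ) ≠ 0 := by exact_mod_cast (by omega : n ≠ 0)
    have hn1 : (1 : ℝ) ≤ n := by exact_mod_cast hn
    calc x n ^ (1 / (n : ℝ)) ≤ ((1 + C) * (R : ℝ≥0∞) ^ n) ^ (1 / (n : ℝ)) :=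
          ENNReal.rpow_le_rpow ((h n).trans (by gcongr; exact le_add_self)) (by positivity)
      _ = (1 + C : ℝ≥0∞) ^ (1 / (n : ℝ)) * R := by
          rw [ENNReal.mul_rpow_of_nonneg _ _ (by positivity), ← ENNReal.rpow_natCast,
            ← ENNReal.rpow_mul, mul_one_div_cancel hn0, ENNReal.rpow_one]
      _ ≤ (1 + C : ℝ≥0∞) ^ (1 : ℝ) * R := by
          gcongr
          · exact le_self_add
          · rw [div_le_one (by linarith)]
            exact hn1
      _ = _ := by rw [ENNReal.rpow_one]

theorem eLpNorm_le_of_bound {α : Type*} [MeasurableSpace α] {μ : Measure α} {u : α → ℂ} {B : ℝ≥0∞}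
    (h1 : ∀ x, ‖u x‖ₑ ≤ B) (h2 : ∫⁻ x, ‖u x‖ₑ ∂μ ≤ B) (hB : B ≠ ⊤)
    {p : ℝ≥0∞} (hp : 1 ≤ p) : eLpNorm u p μ ≤ B := by
  rcases eq_or_ne p ⊤ with rfl | hp'
  · rw [eLpNorm_exponent_top]
    exact essSup_le_of_ae_le _ (ae_of_all _ h1)
  have hq : 1 ≤ p.toReal := by
    rw [← ENNReal.toReal_one]
    exact ENNReal.toReal_mono hp' hp
  rw [eLpNorm_eq_lintegral_rpow_enorm_toReal (by positivity) hp']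
  generalize p.toReal = q at hq
  calc (∫⁻ x, ‖u x‖ₑ ^ q ∂μ) ^ (1 / q) ≤ (B ^ (q - 1) * B) ^ (1 / q) := by
        refine ENNReal.rpow_le_rpow ?_ (by positivity)
        calc ∫⁻ x, ‖u x‖ₑ ^ q ∂μ ≤ ∫⁻ x, B ^ (q - 1) * ‖u x‖ₑ ∂μ := by
              refine lintegral_mono fun x => ?_
              calc ‖u x‖ₑ ^ q = ‖u x‖ₑ ^ (q - 1) * ‖u x‖ₑ := by
                    conv_rhs => rw [← ENNReal.rpow_one ‖u x‖ₑ, ← ENNReal.rpow_mul, one_mul]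
                    rw [← ENNReal.rpow_add_of_nonneg _ _ (by linarith) zero_le_one, sub_add_cancel]
                _ ≤ _ := by
                    gcongr
                    exact h1 x
          _ = B ^ (q - 1) * ∫⁻ x, ‖u x‖ₑ ∂μ :=
              lintegral_const_mul' _ _ (ENNReal.rpow_ne_top_of_nonneg (by linarith) hB)
          _ ≤ _ := by gcongr
    _ = B := by
        nth_rw 2 [← ENNReal.rpow_one B]
        rw [← ENNReal.rpow_add_of_nonneg _ _ (by linarith) zero_le_one, sub_add_cancel,
          ← ENNReal.rpow_mul, mul_one_div_cancel (by linarith), ENNReal.rpow_one]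

end Growth

section PaleyWiener

open scoped NNReal

variable {k : ℝ}

theorem exists_norm_pairing_le (hk : -(1 / 2) ≤ k) {p : ℝ≥0∞} (hp : 1 ≤ p) (h : 𝓢(ℝ, ℂ)) :
    ∃ D : ℝ≥0, ∀ u : 𝓢(ℝ, ℂ), ‖pairing k u h‖ₑ ≤ D * eLpNorm u p (muK k) := by
  have hμ := hasTemperateGrowth_muK hk
  have hpq := ENNReal.HolderConjugate.conjExponent hp
  refine ⟨(eLpNorm h p.conjExponent (muK k)).toNNReal, fun u => ?_⟩
  rw [ENNReal.coe_toNNReal (h.eLpNorm_lt_top _ _).ne]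
  calc ‖pairing k u h‖ₑ ≤ ∫⁻ x, ‖u x * h x‖ₑ ∂muK k := enorm_integral_le_lintegral_enorm _
    _ = eLpNorm (fun x => u x * h x) 1 (muK k) := eLpNorm_one_eq_lintegral_enorm.symm
    _ ≤ (1 : ℝ≥0) * eLpNorm u p (muK k) * eLpNorm h p.conjExponent (muK k) :=
        eLpNorm_le_eLpNorm_mul_eLpNorm'_of_norm u.continuous.aestronglyMeasurable
          h.continuous.aestronglyMeasurable (· * ·) 1 (ae_of_all _ fun x => by simp)
    _ = _ := by rw [ENNReal.coe_one, one_mul, mul_comm]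

theorem exists_pairing_le_of_eLpNorm_le (hk : -(1 / 2) ≤ k) {p : ℝ≥0∞} (hp : 1 ≤ p)
    {g : 𝓢(ℝ, ℂ)} {C R : ℝ≥0} (hR : 1 ≤ R)
    (hg : ∀ n, eLpNorm ((dunklS k)^[2 * n] g) p (muK k) ≤ C * (R : ℝ≥0∞) ^ n) (h : 𝓢(ℝ, ℂ)) :
    ∃ C R : ℝ, 0 ≤ C ∧ 1 ≤ R ∧ ∀ n, ‖pairing k ((dunklS k)^[n] g) h‖ ≤ C * R ^ n := by
  have even_bound : ∀ h : 𝓢(ℝ, ℂ), ∃ D : ℝ≥0, ∀ n,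
      ‖pairing k ((dunklS k)^[2 * n] g) h‖ ≤ D * C * R ^ n := fun h => by
    obtain ⟨D, hD⟩ := exists_norm_pairing_le hk hp h
    refine ⟨D, fun n => ?_⟩
    have h1 : ‖pairing k ((dunklS k)^[2 * n] g) h‖ₑ ≤ ((D * C * R ^ n : ℝ≥0) : ℝ≥0∞) := by
      refine (hD _).trans ?_
      push_cast
      rw [mul_assoc]
      gcongr
      exact hg n
    rw [enorm_eq_nnnorm, ENNReal.coe_le_coe] at h1
    exact_mod_cast h1
  obtain ⟨D₁, h₁⟩ := even_bound h
  obtain ⟨D₂, h₂⟩ := even_bound (dunklS k h)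
  have hR' : (1 : ℝ) ≤ R := by exact_mod_cast hR
  refine ⟨(D₁ + D₂) * C, R, by positivity, hR', fun n => ?_⟩
  have aux : ∀ (D : ℝ≥0) (m : ℕ), D ≤ D₁ + D₂ → m ≤ n →
      (D * C * R ^ m : ℝ) ≤ (D₁ + D₂) * C * R ^ n := fun D m hD hm => by
    have hD' : (D : ℝ) ≤ D₁ + D₂ := by exact_mod_cast hD
    gcongr
  obtain ⟨m, rfl | rfl⟩ := Nat.even_or_odd' n
  · exact (h₁ m).trans (aux D₁ m le_self_add (by omega))
  · rw [Function.iterate_succ_apply', pairing_dunklS hk, norm_neg]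
    exact (h₂ m).trans (aux D₂ m le_add_self (by omega))

theorem dunklT_eq_zero_of_integral_norm_le (hk : -(1 / 2) ≤ k) {g : 𝓢(ℝ, ℂ)} {C R : ℝ}
    (hR : 1 ≤ R) (hg : ∀ n, ∫ x, ‖(dunklS k)^[n] g x‖ ∂muK k ≤ C * R ^ n) {t : ℝ} (ht : R < |t|) :
    dunklT k g t = 0 := by
  have ht0 : 0 < |t| := by linarith
  have h1 : ∀ n : ℕ, ‖dunklT k g t‖ ≤ C * (R / |t|) ^ n := fun n => by
    rw [div_pow, ← mul_div_assoc, le_div_iff₀ (by positivity), mul_comm]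
    exact (pow_mul_norm_dunklT_le hk g n t).trans (hg n)
  have h2 : Tendsto (fun n : ℕ => C * (R / |t|) ^ n) atTop (𝓝 (C * 0)) :=
    (tendsto_pow_atTop_nhds_zero_of_lt_one (by positivity)
      ((div_lt_one ht0).2 ht)).const_mul C
  rw [mul_zero] at h2
  exact norm_le_zero_iff.1 (ge_of_tendsto' h2 h1)

theorem exists_eLpNorm_le_of_support (hk : -(1 / 2) ≤ k) {p : ℝ≥0∞} (hp : 1 ≤ p) {g : 𝓢(ℝ, ℂ)}
    {R : ℝ} (hR : ∀ t, R < |t| → dunklT k g t = 0) :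
    ∃ C R : ℝ≥0, 1 ≤ R ∧ ∀ n, eLpNorm ((dunklS k)^[2 * n] g) p (muK k) ≤ C * (R : ℝ≥0∞) ^ n := by
  have hR1 := norm_iterate_le_of_support hk g hR
  have hA : 0 ≤ ∫ t, ‖dunklT k g t‖ ∂muK k := integral_nonneg fun _ => norm_nonneg _
  generalize ∫ t, ‖dunklT k g t‖ ∂muK k = A at hR1 hA
  obtain ⟨C, S, hC, hS, H⟩ := exists_integral_norm_le hk (g := g) fun h => by
    refine ⟨A * ∫ x, ‖h x‖ ∂muK k, 1 + |R|,
      mul_nonneg hA (integral_nonneg fun _ => norm_nonneg _), by simp, fun n => ?_⟩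
    calc ‖pairing k ((dunklS k)^[n] g) h‖ ≤ ∫ x, |R| ^ n * A * ‖h x‖ ∂muK k := by
          refine norm_integral_le_of_norm_le ((integrable_schwartz hk h).norm.const_mul _)
            (ae_of_all _ fun x => ?_)
          rw [norm_mul]
          exact mul_le_mul_of_nonneg_right (hR1 n x) (norm_nonneg _)
      _ = A * (∫ x, ‖h x‖ ∂muK k) * |R| ^ n := by rw [integral_const_mul]; ring
      _ ≤ _ := by
          refine mul_le_mul_of_nonneg_left
            (pow_le_pow_left₀ (abs_nonneg _) (by linarith) _)
            (mul_nonneg hA (integral_nonneg fun _ => norm_nonneg _))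
  refine ⟨(A + C).toNNReal, ((|R| + S) ^ 2).toNNReal, ?_, fun n => ?_⟩
  · rw [Real.one_le_toNNReal]
    exact one_le_pow₀ (by linarith [abs_nonneg R])
  have hRS : 0 ≤ |R| + S := by positivity
  have e : (((A + C).toNNReal : ℝ≥0∞)) * (((|R| + S) ^ 2).toNNReal : ℝ≥0∞) ^ n =
      ENNReal.ofReal ((A + C) * (|R| + S) ^ (2 * n)) := by
    rw [pow_mul, ENNReal.ofReal_mul (by positivity), ENNReal.ofReal_pow (by positivity)]
    rfl
  rw [e]
  have hS' := pow_le_pow_left₀ (by linarith) (by linarith [abs_nonneg R] : S ≤ |R| + S) (2 * n)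
  have hR' := pow_le_pow_left₀ (abs_nonneg R) (by linarith : |R| ≤ |R| + S) (2 * n)
  refine eLpNorm_le_of_bound (fun x => ?_) ?_ ENNReal.ofReal_ne_top hp
  · rw [← ofReal_norm]
    refine ENNReal.ofReal_le_ofReal ((hR1 _ x).trans ?_)
    rw [mul_comm]
    exact mul_le_mul (by linarith) hR' (by positivity) (by positivity)
  · rw [← ofReal_integral_norm_eq_lintegral_enorm (integrable_schwartz hk _)]
    exact ENNReal.ofReal_le_ofReal ((H _).trans
      (mul_le_mul (by linarith) hS' (by positivity) (by positivity)))

theorem dunklT_support_bounded_iff (hk : -(1 / 2) ≤ k) {p : ℝ≥0∞} (hp : 1 ≤ p) (g : 𝓢(ℝ, ℂ)) :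
    (∃ R, ∀ t, R < |t| → dunklT k g t = 0) ↔
      ∃ C R : ℝ≥0, 1 ≤ R ∧
        ∀ n, eLpNorm ((dunklS k)^[2 * n] g) p (muK k) ≤ C * (R : ℝ≥0∞) ^ n := by
  constructor
  · rintro ⟨R, hR⟩
    exact exists_eLpNorm_le_of_support hk hp hR
  · rintro ⟨C, R, hR, h⟩
    obtain ⟨C', R', -, hR', H⟩ :=
      exists_integral_norm_le hk (exists_pairing_le_of_eLpNorm_le hk hp hR h)
    exact ⟨R', fun t ht => dunklT_eq_zero_of_integral_norm_le hk hR' H ht⟩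

end PaleyWiener

end DunklPaleyWiener

/-- **Real Paley-Wiener theorem for the linear canonical Dunkl Laplacian.** For
`f ∈ S(ℝ)` and `1 ≤ p ≤ ∞`, the support of `D_k^M f` is compact iff
`limsup_n ‖Δ_{k,M⁻¹}ⁿ f‖_{L^p_k}^{1/n} < ∞`. -/
theorem stmt_2 (k a b c d : ℝ) (hk : -(1/2) ≤ k) (hM : a * d - b * c = 1) (hb : b ≠ 0)
    (f : SchwartzMap ℝ ℂ) (p : ℝ≥0∞) (hp : 1 ≤ p) :
    IsCompact (tsupport (lcdt k a b d ⇑f)) ↔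
      Filter.limsup
        (fun n : ℕ => (eLpNorm ((deltaOp k a b)^[n] ⇑f) p (muK k)) ^ (1 / (n : ℝ)))
        Filter.atTop < ⊤ := by
  have hμ := DunklPaleyWiener.hasTemperateGrowth_muK hk
  rw [DunklPaleyWiener.isCompact_tsupport_lcdt_iff hb,
    DunklPaleyWiener.dunklT_support_bounded_iff hk hp]
  simp only [DunklPaleyWiener.eLpNorm_iterate_deltaOp]
  exact (DunklPaleyWiener.limsup_rpow_inv_lt_top_iff fun n =>
    SchwartzMap.eLpNorm_lt_top _ _ _).symm
end

section
/- Let m ∈ ℕ. There exist constants C₁, C₂ > 0 (depending only on k, M and m) such that for every f ∈ S(ℝ): C₁ Σ_{n=0}^m ‖Λ_{k,M⁻¹}ⁿ f‖²_{L^2_k} ≤ ‖(1+λ²)^{m/2} D_k^M f‖²_{L^2_k} ≤ C₂ Σ_{n=0}^m ‖Λ_{k,M⁻¹}ⁿ f‖²_{L^2_k}. -/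
open MeasureTheory Filter Complex Topology
open scoped ENNReal

open scoped SchwartzMap ContDiff

/-- The coefficients of the entire function `y ↦ ∑ a n * y ^ n` with `j_k(x) = ∑ a n * x ^ (2 n)`. -/
noncomputable def besselCoeff (k : ℝ) (n : ℕ) : ℝ :=
  (-1) ^ n * Real.Gamma (k + 1) / (4 ^ n * n.factorial * Real.Gamma (n + k + 1))

lemma Gamma_natCast_add_pos {k : ℝ} (hk : -(1/2) ≤ k) (n : ℕ) : 0 < Real.Gamma (n + k + 1) :=
  Real.Gamma_pos_of_pos (by have := n.cast_nonneg (α := ℝ); linarith)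

lemma Gamma_natCast_succ_add {k : ℝ} (hk : -(1/2) ≤ k) (n : ℕ) :
    Real.Gamma ((n + 1 : ℕ) + k + 1) = (n + k + 1) * Real.Gamma (n + k + 1) := by
  rw [← Real.Gamma_add_one (by have := n.cast_nonneg (α := ℝ); linarith)]
  push_cast; ring_nf

lemma Gamma_add_one_le {k : ℝ} (hk : -(1/2) ≤ k) (n : ℕ) :
    Real.Gamma (k + 1) ≤ 2 ^ n * Real.Gamma (n + k + 1) := by
  induction n with
  | zero => simp
  | succ n ih =>
    rw [Gamma_natCast_succ_add hk]
    have h := Gamma_natCast_add_pos hk n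
    have h2 : (1 : ℝ) ≤ 2 * (n + k + 1) := by have := n.cast_nonneg (α := ℝ); linarith
    calc _ ≤ 2 ^ n * Real.Gamma (n + k + 1) * 1 := by simpa using ih
      _ ≤ 2 ^ n * Real.Gamma (n + k + 1) * (2 * (n + k + 1)) := by gcongr
      _ = _ := by ring

lemma abs_besselCoeff_le {k : ℝ} (hk : -(1/2) ≤ k) (n : ℕ) :
    |besselCoeff k n| ≤ ((n.factorial : ℝ))⁻¹ := by
  have h := Gamma_natCast_add_pos hk n
  have h0 : 0 < Real.Gamma (k + 1) := Real.Gamma_pos_of_pos (by linarith)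
  have hf : (0 : ℝ) < n.factorial := by positivity
  rw [besselCoeff, abs_div, abs_mul, abs_pow, abs_neg, abs_one, one_pow, one_mul, abs_of_pos h0,
    abs_of_pos (by positivity), div_le_iff₀ (by positivity)]
  have h24 : (2 : ℝ) ^ n ≤ 4 ^ n := by gcongr; norm_num
  calc _ ≤ 2 ^ n * Real.Gamma (n + k + 1) := Gamma_add_one_le hk n
    _ ≤ 4 ^ n * Real.Gamma (n + k + 1) := by gcongr
    _ = _ := by field_simp

lemma summable_besselCoeff_mul_pow {k : ℝ} (hk : -(1/2) ≤ k) (y : ℝ) :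
    Summable fun n => besselCoeff k n * y ^ n := by
  refine .of_norm_bounded (Real.summable_pow_div_factorial |y|) fun n => ?_
  rw [norm_mul, norm_pow, Real.norm_eq_abs, Real.norm_eq_abs, div_eq_inv_mul]
  gcongr
  exact abs_besselCoeff_le hk n

lemma besselCoeff_zero {k : ℝ} (hk : -(1/2) ≤ k) : besselCoeff k 0 = 1 := by
  have h0 : 0 < Real.Gamma (k + 1) := Real.Gamma_pos_of_pos (by linarith)
  simp [besselCoeff, h0.ne']

lemma succ_mul_besselCoeff_succ {k : ℝ} (hk : -(1/2) ≤ k) (n : ℕ) :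
    (n + 1) * besselCoeff k (n + 1) = -(besselCoeff (k + 1) n / (4 * (k + 1))) := by
  have h0 : k + 1 ≠ 0 := by linarith
  have h := Gamma_natCast_add_pos hk (n + 1)
  have h1 : ((n : ℝ) + (k + 1) + 1) = (n + 1 : ℕ) + k + 1 := by push_cast; ring
  have hn : (n : ℝ) + 1 ≠ 0 := by positivity
  rw [besselCoeff, besselCoeff, h1, Real.Gamma_add_one h0, Nat.factorial_succ]
  push_cast at h ⊢
  field_simp
  ring

lemma add_mul_besselCoeff_add_one {k : ℝ} (hk : -(1/2) ≤ k) (n : ℕ) :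
    (n + k + 1) * besselCoeff (k + 1) n = (k + 1) * besselCoeff k n := by
  have h0 : k + 1 ≠ 0 := by linarith
  have h := Gamma_natCast_add_pos hk n
  have hn : (n : ℝ) + k + 1 ≠ 0 := by have := n.cast_nonneg (α := ℝ); linarith
  have h1 : ((n : ℝ) + (k + 1) + 1) = (n + 1 : ℕ) + k + 1 := by push_cast; ring
  rw [besselCoeff, besselCoeff, h1, Real.Gamma_add_one h0, Gamma_natCast_succ_add hk]
  field_simp

/-- The entire function `F` with `j_k(x) = F(x ^ 2)`. -/
noncomputable def besselF (k y : ℝ) : ℝ := ∑' n, besselCoeff k n * y ^ n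

lemma besselJ_eq_besselF (k x : ℝ) : besselJ k x = besselF k (x ^ 2) := by
  rw [besselJ, besselF, ← tsum_mul_left]
  congr 1 with n
  rw [besselCoeff, div_pow, ← pow_mul, pow_mul 2 2 n]
  norm_num
  ring

lemma hasDerivAt_besselF {k : ℝ} (hk : -(1/2) ≤ k) (y : ℝ) :
    HasDerivAt (besselF k) (-(besselF (k + 1) y / (4 * (k + 1)))) y := by
  have key : HasDerivAt (besselF k) (∑' n : ℕ, besselCoeff k n * (n * y ^ (n - 1))) y := by
    refine hasDerivAt_tsum_of_isPreconnected
      (u := fun n : ℕ => ((n.factorial : ℝ))⁻¹ * (n * (|y| + 1) ^ (n - 1))) (t := Metric.ball 0 (|y| + 1))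
      (g := fun n y => besselCoeff k n * y ^ n) (g' := fun n y => besselCoeff k n * (n * y ^ (n - 1)))
      (y₀ := y) ?_ Metric.isOpen_ball
      (convex_ball _ _).isPreconnected (fun n z _ => ?_) (fun n z hz => ?_)
      (by simp) (summable_besselCoeff_mul_pow hk y) (by simp)
    · rw [← summable_nat_add_iff 1]
      refine (Real.summable_pow_div_factorial (|y| + 1)).congr fun n => ?_
      rw [Nat.factorial_succ]
      push_cast
      simp
      field_simp
    · exact (hasDerivAt_pow n z).const_mul _
    · have hz' : |z| ≤ |y| + 1 := by simpa using (Metric.mem_ball.1 hz).le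
      rw [norm_mul, norm_mul, norm_pow, Real.norm_eq_abs, Real.norm_eq_abs, Real.norm_eq_abs, Nat.abs_cast]
      gcongr
      exact abs_besselCoeff_le hk n
  convert key using 1
  have hs : Summable fun n : ℕ => besselCoeff k n * (n * y ^ (n - 1)) := by
    rw [← summable_nat_add_iff 1]
    refine ((summable_besselCoeff_mul_pow (k := k + 1) (by linarith) y).mul_left
      (-(1 / (4 * (k + 1))))).congr fun n => ?_
    have := succ_mul_besselCoeff_succ hk n
    push_cast
    linear_combination (-y ^ n) * this
  rw [hs.tsum_eq_zero_add, besselF, ← tsum_div_const, ← tsum_neg]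
  simp only [CharP.cast_eq_zero, zero_mul, mul_zero, zero_add, Nat.add_sub_cancel]
  congr 1 with n
  have := succ_mul_besselCoeff_succ hk n
  push_cast
  linear_combination (-y ^ n) * this

lemma besselF_recurrence {k : ℝ} (hk : -(1/2) ≤ k) (y : ℝ) :
    (k + 1) * besselF (k + 1) y - y * (besselF (k + 2) y / (4 * (k + 2))) =
      (k + 1) * besselF k y := by
  have h1 := summable_besselCoeff_mul_pow (k := k + 1) (by linarith) y
  have h2 := summable_besselCoeff_mul_pow (k := k + 2) (by linarith) y
  have e : y * (besselF (k + 2) y / (4 * (k + 2))) =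
      -∑' n : ℕ, n * besselCoeff (k + 1) n * y ^ n := by
    have hs : Summable fun n : ℕ => n * besselCoeff (k + 1) n * y ^ n := by
      rw [← summable_nat_add_iff 1]
      refine (h2.mul_left (-(y / (4 * (k + 2))))).congr fun n => ?_
      have := succ_mul_besselCoeff_succ (k := k + 1) (by linarith) n
      rw [show k + 1 + 1 = k + 2 by ring] at this
      push_cast
      linear_combination (-y ^ (n + 1)) * this
    rw [hs.tsum_eq_zero_add, besselF, ← tsum_div_const, ← tsum_mul_left]
    simp only [CharP.cast_eq_zero, zero_mul, zero_add]
    rw [← tsum_neg]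
    congr 1 with n
    have := succ_mul_besselCoeff_succ (k := k + 1) (by linarith) n
    rw [show k + 1 + 1 = k + 2 by ring] at this
    push_cast
    linear_combination (y ^ (n + 1)) * this
  have hs : Summable fun n : ℕ => n * besselCoeff (k + 1) n * y ^ n := by
    refine (((summable_besselCoeff_mul_pow hk y).mul_left (k + 1)).sub (h1.mul_left (k + 1))).congr
      fun n => ?_
    linear_combination (-y ^ n) * add_mul_besselCoeff_add_one hk n
  rw [e, besselF, besselF, ← tsum_mul_left, ← tsum_mul_left, sub_neg_eq_add,
    ← (h1.mul_left (k + 1)).tsum_add hs]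
  congr 1 with n
  linear_combination (y ^ n) * add_mul_besselCoeff_add_one hk n

/-- The odd part of the Dunkl kernel divided by its argument. -/
noncomputable def dunklW (k t : ℝ) : ℝ := besselJ (k + 1) t / (2 * (k + 1))

lemma besselJ_neg (k t : ℝ) : besselJ k (-t) = besselJ k t := by
  simp [besselJ_eq_besselF]

lemma dunklW_neg (k t : ℝ) : dunklW k (-t) = dunklW k t := by
  simp [dunklW, besselJ_neg]

lemma besselJ_zero {k : ℝ} (hk : -(1/2) ≤ k) : besselJ k 0 = 1 := by
  rw [besselJ_eq_besselF, besselF, tsum_eq_single 0 (by simp +contextual)]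
  simp [besselCoeff_zero hk]

lemma hasDerivAt_besselJ {k : ℝ} (hk : -(1/2) ≤ k) (t : ℝ) :
    HasDerivAt (besselJ k) (-(t * dunklW k t)) t := by
  have h : besselJ k = fun x => besselF k (x ^ 2) := funext (besselJ_eq_besselF k)
  rw [h]
  have := (hasDerivAt_besselF hk (t ^ 2)).comp t (hasDerivAt_pow 2 t)
  refine this.congr_deriv ?_
  have h0 : k + 1 ≠ 0 := by linarith
  rw [dunklW, besselJ_eq_besselF]
  field_simp
  norm_num
  ring

lemma hasDerivAt_mul_dunklW {k : ℝ} (hk : -(1/2) ≤ k) (t : ℝ) :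
    HasDerivAt (fun t => t * dunklW k t) (besselJ k t - (2 * k + 1) * dunklW k t) t := by
  have h0 : k + 1 ≠ 0 := by linarith
  have h2 : k + 1 + 1 ≠ 0 := by linarith
  have h3 : k + 2 ≠ 0 := by linarith
  have hd : HasDerivAt (dunklW k) (-(t * dunklW (k + 1) t) / (2 * (k + 1))) t :=
    (hasDerivAt_besselJ (k := k + 1) (by linarith) t).div_const _
  refine ((hasDerivAt_id t).mul hd).congr_deriv ?_
  have := besselF_recurrence hk (t ^ 2)
  simp only [dunklW, besselJ_eq_besselF, show k + 1 + 1 = k + 2 by ring, id]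
  field_simp
  field_simp at this
  linear_combination this

lemma continuous_besselJ {k : ℝ} (hk : -(1/2) ≤ k) : Continuous (besselJ k) :=
  continuous_iff_continuousAt.2 fun t => (hasDerivAt_besselJ hk t).continuousAt

lemma continuous_dunklW {k : ℝ} (hk : -(1/2) ≤ k) : Continuous (dunklW k) :=
  (continuous_besselJ (by linarith)).div_const _

lemma besselJ_sq_add_sq_le_one {k : ℝ} (hk : -(1/2) ≤ k) (t : ℝ) :
    besselJ k t ^ 2 + (t * dunklW k t) ^ 2 ≤ 1 := by
  wlog ht : 0 ≤ t generalizing t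
  · simpa [besselJ_neg, dunklW_neg] using this (-t) (by linarith)
  have hd (s : ℝ) : HasDerivAt (fun t => besselJ k t ^ 2 + (t * dunklW k t) ^ 2)
      (-(2 * (2 * k + 1) * s * dunklW k s ^ 2)) s := by
    refine (((hasDerivAt_besselJ hk s).pow 2).add ((hasDerivAt_mul_dunklW hk s).pow 2)).congr_deriv ?_
    simp
    ring
  have hanti : AntitoneOn (fun t => besselJ k t ^ 2 + (t * dunklW k t) ^ 2) (Set.Ici 0) := by
    refine antitoneOn_of_deriv_nonpos (convex_Ici 0)
      (fun s _ => (hd s).continuousAt.continuousWithinAt)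
      (fun s _ => (hd s).differentiableAt.differentiableWithinAt) fun s hs => ?_
    rw [interior_Ici] at hs
    have hs : 0 < s := hs
    have : 0 ≤ 2 * k + 1 := by linarith
    rw [(hd s).deriv]
    have : 0 ≤ 2 * (2 * k + 1) * s * dunklW k s ^ 2 := by positivity
    linarith
  have := hanti (Set.mem_Ici.2 le_rfl) (Set.mem_Ici.2 ht) ht
  simpa [besselJ_zero hk] using this

lemma abs_besselJ_le_one {k : ℝ} (hk : -(1/2) ≤ k) (t : ℝ) : |besselJ k t| ≤ 1 := by
  rw [← sq_le_one_iff_abs_le_one]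
  nlinarith [besselJ_sq_add_sq_le_one hk t, sq_nonneg (t * dunklW k t)]

lemma abs_dunklW_le_one {k : ℝ} (hk : -(1/2) ≤ k) (t : ℝ) : |dunklW k t| ≤ 1 := by
  rw [dunklW, abs_div, abs_of_pos (a := 2 * (k + 1)) (by linarith), div_le_one (by linarith)]
  exact (abs_besselJ_le_one (by linarith) t).trans (by linarith)

/-- The Dunkl kernel as a function of the product of its arguments. -/
noncomputable def dunklE (k t : ℝ) : ℂ := (besselJ k t : ℂ) + I * ((t * dunklW k t : ℝ) : ℂ)

lemma dunklKernel_eq {k : ℝ} (lam x : ℝ) : dunklKernel k lam x = dunklE k (lam * x) := by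
  simp only [dunklKernel, dunklE, dunklW]
  push_cast
  ring

lemma hasDerivAt_dunklE {k : ℝ} (hk : -(1/2) ≤ k) (t : ℝ) :
    HasDerivAt (dunklE k) (I * dunklE k t - I * (2 * k + 1) * dunklW k t) t := by
  refine ((hasDerivAt_besselJ hk t).ofReal_comp.add
    ((hasDerivAt_mul_dunklW hk t).ofReal_comp.const_mul I)).congr_deriv ?_
  simp only [dunklE]
  push_cast
  linear_combination (-(t : ℂ) * dunklW k t) * I_mul_I

lemma continuous_dunklE {k : ℝ} (hk : -(1/2) ≤ k) : Continuous (dunklE k) :=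
  continuous_iff_continuousAt.2 fun t => (hasDerivAt_dunklE hk t).continuousAt

lemma norm_dunklE_le_one {k : ℝ} (hk : -(1/2) ≤ k) (t : ℝ) : ‖dunklE k t‖ ≤ 1 := by
  rw [← sq_le_one_iff₀ (norm_nonneg _), ← normSq_eq_norm_sq, dunklE, mul_comm I, normSq_add_mul_I]
  exact besselJ_sq_add_sq_le_one hk t

lemma conj_dunklE (k t : ℝ) : (starRingEnd ℂ) (dunklE k t) = dunklE k (-t) := by
  simp only [dunklE, besselJ_neg, dunklW_neg, map_add, map_mul, conj_ofReal, conj_I]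
  push_cast
  ring

lemma dunklE_sub_neg (k t : ℝ) : (dunklE k t - dunklE k (-t)) / 2 = I * t * dunklW k t := by
  simp only [dunklE, besselJ_neg, dunklW_neg]
  push_cast
  ring

/-- A smooth function `q` such that `x * q x` is a Schwartz function is a Schwartz function. -/
lemma exists_schwartz_of_mul_id {q : ℝ → ℂ} (hq : ContDiff ℝ ∞ q) {h : 𝓢(ℝ, ℂ)}
    (hh : ∀ x : ℝ, x * q x = h x) : ∃ g : 𝓢(ℝ, ℂ), ∀ x, g x = q x := by
  have hd (n : ℕ) (x : ℝ) : HasDerivAt (iteratedDeriv n q) (iteratedDeriv (n + 1) q x) x := by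
    rw [iteratedDeriv_succ]
    exact ((hq.differentiable_iteratedDeriv n (by exact_mod_cast WithTop.coe_lt_top _)) x).hasDerivAt
  have hdh (n : ℕ) (x : ℝ) : HasDerivAt (iteratedDeriv n h) (iteratedDeriv (n + 1) h x) x := by
    rw [iteratedDeriv_succ]
    exact (((h.smooth ⊤).differentiable_iteratedDeriv n
      (by exact_mod_cast WithTop.coe_lt_top _)) x).hasDerivAt
  have leib (n : ℕ) : ∀ x : ℝ, x * iteratedDeriv (n + 1) q x + (n + 1) * iteratedDeriv n q x =
      iteratedDeriv (n + 1) h x := by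
    induction n with
    | zero =>
      intro x
      have h1 := ((hasDerivAt_id x).ofReal_comp.mul (hd 0 x))
      have h2 : ((fun y : ℝ => ((id y : ℝ) : ℂ)) * iteratedDeriv 0 q) = iteratedDeriv 0 h := by
        ext y; simpa using hh y
      rw [h2] at h1
      have := h1.unique (hdh 0 x)
      simp at this ⊢
      linear_combination this
    | succ n ih =>
      intro x
      have h1 := ((hasDerivAt_id x).ofReal_comp.mul (hd (n + 1) x)).add
        ((hd n x).const_mul ((n : ℂ) + 1))
      have h2 : (((fun y : ℝ => ((id y : ℝ) : ℂ)) * iteratedDeriv (n + 1) q) +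
          fun y => ((n : ℂ) + 1) * iteratedDeriv n q y) = iteratedDeriv (n + 1) h := by
        ext y; simpa using ih y
      rw [h2] at h1
      have := h1.unique (hdh (n + 1) x)
      simp at this ⊢
      linear_combination this
  have aux (n j : ℕ) : (∃ C, ∀ x : ℝ, |x| ^ (j + 1) * ‖iteratedDeriv n q x‖ ≤ C) →
      ∃ C, ∀ x : ℝ, |x| ^ j * ‖iteratedDeriv n q x‖ ≤ C := by
    rintro ⟨C, hC⟩
    obtain ⟨C', hC'⟩ := (isCompact_Icc (a := (-1 : ℝ)) (b := 1)).exists_bound_of_continuousOn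
      (f := iteratedDeriv n q) (hq.continuous_iteratedDeriv n (by exact_mod_cast le_top)).continuousOn
    refine ⟨max C C', fun x => ?_⟩
    rcases le_total |x| 1 with hx | hx
    · refine le_max_of_le_right ((mul_le_of_le_one_left (norm_nonneg _)
        (pow_le_one₀ (abs_nonneg _) hx)).trans (hC' x (abs_le.1 hx)))
    · refine le_max_of_le_left (le_trans ?_ (hC x))
      gcongr ?_ * _
      exact pow_le_pow_right₀ hx j.le_succ
  have bdd (n : ℕ) : ∀ j : ℕ, ∃ C, ∀ x : ℝ, |x| ^ j * ‖iteratedDeriv n q x‖ ≤ C := by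
    induction n with
    | zero =>
      intro j
      refine aux _ j ⟨SchwartzMap.seminorm ℝ j 0 h, fun x => ?_⟩
      have := h.le_seminorm' ℝ j 0 x
      rw [iteratedDeriv_zero, ← hh, norm_mul, norm_real, Real.norm_eq_abs] at this
      rw [iteratedDeriv_zero]
      calc _ = |x| ^ j * (|x| * ‖q x‖) := by ring
        _ ≤ _ := this
    | succ n ih =>
      intro j
      obtain ⟨C, hC⟩ := ih j
      refine aux _ j ⟨SchwartzMap.seminorm ℝ j (n + 1) h + (n + 1) * C, fun x => ?_⟩
      have h1 := h.le_seminorm' ℝ j (n + 1) x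
      have e : x * iteratedDeriv (n + 1) q x = iteratedDeriv (n + 1) h x -
        (n + 1) * iteratedDeriv n q x := by linear_combination leib n x
      calc _ = |x| ^ j * ‖x * iteratedDeriv (n + 1) q x‖ := by
            rw [norm_mul, norm_real, Real.norm_eq_abs]; ring
        _ ≤ |x| ^ j * (‖iteratedDeriv (n + 1) h x‖ + (n + 1) * ‖iteratedDeriv n q x‖) := by
            rw [e]
            gcongr
            refine (norm_sub_le _ _).trans_eq ?_
            rw [norm_mul]
            congr 2
            exact_mod_cast Complex.norm_natCast (n + 1)
        _ = |x| ^ j * ‖iteratedDeriv (n + 1) h x‖ + (n + 1) * (|x| ^ j * ‖iteratedDeriv n q x‖) := by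
            ring
        _ ≤ _ := by gcongr; exact hC x
  refine ⟨⟨q, hq, fun j n => ?_⟩, fun x => rfl⟩
  obtain ⟨C, hC⟩ := bdd n j
  exact ⟨C, fun x => by simpa [norm_iteratedFDeriv_eq_norm_iteratedDeriv] using hC x⟩

lemma hasDerivAt_integral_pow_mul_comp_mul (f : 𝓢(ℝ, ℂ)) (j : ℕ) (x : ℝ) :
    HasDerivAt (fun x : ℝ => ∫ t in (0:ℝ)..1, (t : ℂ) ^ j * f (t * x))
      (∫ t in (0:ℝ)..1, (t : ℂ) ^ (j + 1) * SchwartzMap.derivCLM ℝ ℂ f (t * x)) x := by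
  refine (intervalIntegral.hasDerivAt_integral_of_dominated_loc_of_deriv_le (s := Set.univ)
    (F := fun x t => (t : ℂ) ^ j * f (t * x))
    (F' := fun x t => (t : ℂ) ^ (j + 1) * SchwartzMap.derivCLM ℝ ℂ f (t * x))
    (bound := fun _ => SchwartzMap.seminorm ℝ 0 0 (SchwartzMap.derivCLM ℝ ℂ f)) univ_mem
    (.of_forall fun y => ?_) ?_ ?_ (.of_forall fun t ht y _ => ?_)
    intervalIntegrable_const (.of_forall fun t _ y _ => ?_)).2
  · exact (by fun_prop : Continuous fun t : ℝ => (t : ℂ) ^ j * f (t * y)).aestronglyMeasurable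
  · exact (by fun_prop : Continuous fun t : ℝ => (t : ℂ) ^ j * f (t * x)).intervalIntegrable _ _
  · exact (by fun_prop : Continuous fun t : ℝ =>
      (t : ℂ) ^ (j + 1) * SchwartzMap.derivCLM ℝ ℂ f (t * x)).aestronglyMeasurable
  · rw [Set.uIoc_of_le zero_le_one] at ht
    rw [norm_mul, norm_pow, norm_real, Real.norm_eq_abs, abs_of_pos ht.1]
    exact (mul_le_of_le_one_left (norm_nonneg _) (pow_le_one₀ ht.1.le ht.2)).trans
      (SchwartzMap.norm_le_seminorm ℝ _ _)
  · have h1 : HasDerivAt (f : ℝ → ℂ) (deriv f (t * y)) (t * y) :=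
      (f.differentiable (t * y)).hasDerivAt
    have := ((h1.scomp y ((hasDerivAt_id y).const_mul t)).const_mul ((t : ℂ) ^ j))
    refine this.congr_deriv ?_
    simp [SchwartzMap.derivCLM_apply]
    ring

lemma contDiff_integral_pow_mul_comp_mul (n : ℕ) : ∀ (f : 𝓢(ℝ, ℂ)) (j : ℕ),
    ContDiff ℝ n fun x : ℝ => ∫ t in (0:ℝ)..1, (t : ℂ) ^ j * f (t * x) := by
  induction n with
  | zero =>
    intro f j
    rw [Nat.cast_zero, contDiff_zero]
    exact continuous_iff_continuousAt.2 fun x =>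
      (hasDerivAt_integral_pow_mul_comp_mul f j x).continuousAt
  | succ n ih =>
    intro f j
    rw [Nat.cast_succ, contDiff_succ_iff_deriv]
    refine ⟨fun x => (hasDerivAt_integral_pow_mul_comp_mul f j x).differentiableAt, by simp, ?_⟩
    rw [funext fun x => (hasDerivAt_integral_pow_mul_comp_mul f j x).deriv]
    exact ih _ _

/-- Hadamard's lemma in the Schwartz space. -/
lemma exists_schwartz_sub_mul_eq (f : 𝓢(ℝ, ℂ)) (y : ℝ) (hf : f y = 0) :
    ∃ g : 𝓢(ℝ, ℂ), ∀ x : ℝ, f x = ((x : ℂ) - y) * g x := by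
  wlog hy : y = 0 generalizing f y
  · obtain ⟨g, hg⟩ := this (SchwartzMap.compSubConstCLM ℝ (-y) f) 0 (by simpa using hf) rfl
    refine ⟨SchwartzMap.compSubConstCLM ℝ y g, fun x => ?_⟩
    have := hg (x - y)
    simpa using this
  subst hy
  set q : ℝ → ℂ := fun x => ∫ t in (0:ℝ)..1, (t : ℂ) ^ 0 * SchwartzMap.derivCLM ℝ ℂ f (t * x)
  have hq : ContDiff ℝ ∞ q :=
    contDiff_infty.2 fun n => contDiff_integral_pow_mul_comp_mul n _ 0
  have hxq (x : ℝ) : x * q x = f x := by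
    have hd (t : ℝ) : HasDerivAt (fun t : ℝ => f (t * x))
        (x * SchwartzMap.derivCLM ℝ ℂ f (t * x)) t := by
      have h1 : HasDerivAt (f : ℝ → ℂ) (deriv f (t * x)) (t * x) :=
        (f.differentiable (t * x)).hasDerivAt
      refine (h1.scomp t ((hasDerivAt_id t).mul_const x)).congr_deriv ?_
      simp [SchwartzMap.derivCLM_apply]
    have := intervalIntegral.integral_eq_sub_of_hasDerivAt (a := 0) (b := 1) (fun t _ => hd t)
      ((by fun_prop : Continuous fun t : ℝ =>
        (x : ℂ) * SchwartzMap.derivCLM ℝ ℂ f (t * x)).intervalIntegrable _ _)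
    rw [intervalIntegral.integral_const_mul] at this
    simpa [q, hf] using this
  obtain ⟨g, hg⟩ := exists_schwartz_of_mul_id hq hxq
  exact ⟨g, fun x => by simp [hg, hxq]⟩

/-- The reflection of a Schwartz function. -/
noncomputable def schwartzReflect (f : 𝓢(ℝ, ℂ)) : 𝓢(ℝ, ℂ) :=
  SchwartzMap.compCLMOfContinuousLinearEquiv ℝ (ContinuousLinearEquiv.neg ℝ) f

@[simp] lemma schwartzReflect_apply (f : 𝓢(ℝ, ℂ)) (x : ℝ) : schwartzReflect f x = f (-x) := rfl

lemma exists_schwartz_dunklOp (k : ℝ) (f : 𝓢(ℝ, ℂ)) :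
    ∃ g : 𝓢(ℝ, ℂ), ⇑g = dunklOp k f := by
  obtain ⟨q, hq⟩ := exists_schwartz_sub_mul_eq ((2⁻¹ : ℂ) • (f - schwartzReflect f)) 0 (by simp)
  replace hq (x : ℝ) : (f x - f (-x)) / 2 = x * q x := by
    rw [← sub_zero (x : ℂ), ← ofReal_zero, ← hq]
    simp; ring
  refine ⟨SchwartzMap.derivCLM ℝ ℂ f + (2 * (k : ℂ) + 1) • q, funext fun x => ?_⟩
  rcases eq_or_ne x 0 with rfl | hx
  · have h1 : HasDerivAt (f : ℝ → ℂ) (deriv f 0) 0 := (f.differentiable 0).hasDerivAt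
    have h1' : HasDerivAt (f : ℝ → ℂ) (deriv f 0) (-0) := by simpa using h1
    have h2 := (h1.sub (h1'.scomp (0 : ℝ) (hasDerivAt_neg (0 : ℝ)))).div_const 2
    have h3 := (hasDerivAt_id (0 : ℝ)).ofReal_comp.mul (q.differentiable 0).hasDerivAt
    have h4 : (fun x => ((f : ℝ → ℂ) - (f : ℝ → ℂ) ∘ Neg.neg) x / 2) =
      ((fun y : ℝ => ((id y : ℝ) : ℂ)) * (q : ℝ → ℂ)) := by
      ext x; simpa using hq x
    rw [h4] at h2
    have := h2.unique h3
    simp at this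
    simp [dunklOp, SchwartzMap.derivCLM_apply, ← this]
    ring
  · have hx' : (x : ℂ) ≠ 0 := by exact_mod_cast hx
    simp [dunklOp, hx, hq, SchwartzMap.derivCLM_apply]
    field_simp

lemma exists_schwartz_mul {m : ℝ → ℂ} (hm : m.HasTemperateGrowth) (f : 𝓢(ℝ, ℂ)) :
    ∃ g : 𝓢(ℝ, ℂ), ∀ x, g x = m x * f x :=
  ⟨SchwartzMap.smulLeftCLM ℂ m f, fun x => by
    rw [SchwartzMap.smulLeftCLM_apply_apply hm, smul_eq_mul]⟩

lemma hasTemperateGrowth_cexp_mul_sq (s : ℝ) :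
    Function.HasTemperateGrowth fun x : ℝ => cexp (I * (s * x ^ 2 : ℝ)) := by
  have h1 : Function.HasTemperateGrowth fun t : ℝ => cexp (I * t) := by
    have hd (n : ℕ) : iteratedDeriv n (fun t : ℝ => cexp (I * t)) =
        fun t : ℝ => I ^ n * cexp (I * t) := by
      induction n with
      | zero => simp
      | succ n ih =>
        rw [iteratedDeriv_succ, ih]
        ext t
        refine HasDerivAt.deriv (((((hasDerivAt_id t).ofReal_comp.const_mul I).cexp).const_mul
          (I ^ n)).congr_deriv ?_)
        simp
        ring
    refine ⟨(contDiff_const.mul ofRealCLM.contDiff).cexp, fun n => ⟨0, 1, fun t => ?_⟩⟩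
    rw [norm_iteratedFDeriv_eq_norm_iteratedDeriv, hd]
    simp [mul_comm I, norm_exp_ofReal_mul_I]
  have h2 : Function.HasTemperateGrowth fun x : ℝ => s * x ^ 2 :=
    (Function.HasTemperateGrowth.const s).mul (Function.HasTemperateGrowth.id'.pow 2)
  exact h1.comp h2

/-- The density of `muK k`. -/
noncomputable def muDensity (k x : ℝ) : ℝ := |x| ^ (2 * k + 1) / (2 ^ (k + 1) * Real.Gamma (k + 1))

lemma muK_const_pos {k : ℝ} (hk : -(1/2) ≤ k) : 0 < 2 ^ (k + 1) * Real.Gamma (k + 1) :=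
  mul_pos (by positivity) (Real.Gamma_pos_of_pos (by linarith))

lemma muDensity_nonneg {k : ℝ} (hk : -(1/2) ≤ k) (x : ℝ) : 0 ≤ muDensity k x :=
  div_nonneg (by positivity) (muK_const_pos hk).le

lemma muDensity_neg (k x : ℝ) : muDensity k (-x) = muDensity k x := by simp [muDensity]

lemma continuous_muDensity {k : ℝ} (hk : -(1/2) ≤ k) : Continuous (muDensity k) :=
  (continuous_abs.rpow_const fun _ => Or.inr (by linarith)).div_const _

lemma muK_eq (k : ℝ) : muK k = volume.withDensity fun x => ENNReal.ofReal (muDensity k x) := rfl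

lemma measurable_muDensity {k : ℝ} (hk : -(1/2) ≤ k) :
    Measurable fun x => ENNReal.ofReal (muDensity k x) :=
  (continuous_muDensity hk).measurable.ennreal_ofReal

lemma integral_muK {k : ℝ} (hk : -(1/2) ≤ k) (g : ℝ → ℂ) :
    ∫ x, g x ∂(muK k) = ∫ x, (muDensity k x : ℂ) * g x := by
  rw [muK_eq, integral_withDensity_eq_integral_toReal_smul (measurable_muDensity hk) (by simp)]
  congr 1 with x
  rw [ENNReal.toReal_ofReal (muDensity_nonneg hk x), real_smul]

lemma integrable_muK_iff {k : ℝ} (hk : -(1/2) ≤ k) {g : ℝ → ℂ} :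
    Integrable g (muK k) ↔ Integrable fun x => (muDensity k x : ℂ) * g x := by
  rw [muK_eq, integrable_withDensity_iff_integrable_smul' (measurable_muDensity hk) (by simp)]
  congr! 2 with x
  rw [ENNReal.toReal_ofReal (muDensity_nonneg hk x), real_smul]

lemma hasDerivAt_muDensity (k : ℝ) {x : ℝ} (hx : 0 < x) :
    HasDerivAt (muDensity k) ((2 * k + 1) / x * muDensity k x) x := by
  have h1 : HasDerivAt (fun x : ℝ => x ^ (2 * k + 1) / (2 ^ (k + 1) * Real.Gamma (k + 1)))
      ((2 * k + 1) / x * muDensity k x) x := by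
    refine ((Real.hasDerivAt_rpow_const (p := 2 * k + 1) (Or.inl hx.ne')).div_const _).congr_deriv ?_
    rw [muDensity, abs_of_pos hx, Real.rpow_sub_one hx.ne']
    ring
  refine h1.congr_of_eventuallyEq ?_
  filter_upwards [lt_mem_nhds hx] with y hy
  rw [muDensity, abs_of_pos hy]

lemma exists_muDensity_le {k : ℝ} (hk : -(1/2) ≤ k) :
    ∃ C, ∃ N : ℕ, 0 ≤ C ∧ ∀ x, muDensity k x ≤ C * (1 + |x|) ^ N := by
  refine ⟨1 / (2 ^ (k + 1) * Real.Gamma (k + 1)), ⌈2 * k + 1⌉₊,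
    by have := muK_const_pos hk; positivity, fun x => ?_⟩
  rw [muDensity, div_mul_eq_mul_div, one_mul]
  have := muK_const_pos hk
  gcongr
  rw [← Real.rpow_natCast]
  calc |x| ^ (2 * k + 1) ≤ (1 + |x|) ^ (2 * k + 1) := by
        gcongr
        · linarith
        · linarith
    _ ≤ _ := Real.rpow_le_rpow_of_exponent_le (by linarith [abs_nonneg x]) (Nat.le_ceil _)

lemma hasTemperateGrowth_muK {k : ℝ} (hk : -(1/2) ≤ k) : (muK k).HasTemperateGrowth := by
  obtain ⟨C, N, hC, h⟩ := exists_muDensity_le hk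
  refine ⟨N + 2, ?_⟩
  rw [muK_eq, integrable_withDensity_iff_integrable_smul' (measurable_muDensity hk) (by simp)]
  have hi : Integrable fun x : ℝ => C * (1 + ‖x‖) ^ (-2 : ℝ) :=
    (integrable_one_add_norm (by simp)).const_mul C
  refine hi.mono' ?_ (.of_forall fun x => ?_)
  · have := continuous_muDensity hk
    refine (Measurable.aestronglyMeasurable ?_)
    fun_prop
  · have hx : 0 < 1 + |x| := by positivity
    rw [ENNReal.toReal_ofReal (muDensity_nonneg hk x), norm_smul,
      Real.norm_of_nonneg (muDensity_nonneg hk x), Real.norm_of_nonneg (by positivity)]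
    simp only [Real.norm_eq_abs]
    calc _ ≤ C * (1 + |x|) ^ N * (1 + |x|) ^ (-((N + 2 : ℕ) : ℝ)) := by gcongr; exact h x
      _ = _ := by
        rw [mul_assoc, ← Real.rpow_natCast, ← Real.rpow_add hx]
        congr 2
        push_cast
        ring

/-- Decay faster than any power. -/
def RapidDecay (h : ℝ → ℂ) : Prop := ∀ n : ℕ, ∃ C, ∀ x : ℝ, |x| ^ n * ‖h x‖ ≤ C

lemma RapidDecay.mul_bounded {h g : ℝ → ℂ} (hh : RapidDecay h) {B : ℝ} (hg : ∀ x, ‖g x‖ ≤ B) :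
    RapidDecay fun x => h x * g x := by
  intro n
  obtain ⟨C, hC⟩ := hh n
  have hB : 0 ≤ B := (norm_nonneg _).trans (hg 0)
  refine ⟨C * B, fun x => ?_⟩
  rw [norm_mul, ← mul_assoc]
  exact mul_le_mul (hC x) (hg x) (norm_nonneg _) (le_trans (by positivity) (hC x))

lemma SchwartzMap.rapidDecay (f : 𝓢(ℝ, ℂ)) : RapidDecay f := fun n =>
  ⟨SchwartzMap.seminorm ℝ n 0 f, fun x => SchwartzMap.norm_pow_mul_le_seminorm ℝ f n x⟩

lemma RapidDecay.integrable {k : ℝ} (hk : -(1/2) ≤ k) {h : ℝ → ℂ} (hh : RapidDecay h)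
    (hc : Continuous h) : Integrable h (muK k) := by
  have := hasTemperateGrowth_muK hk
  obtain ⟨C₁, h₁⟩ := hh 0
  obtain ⟨C₂, h₂⟩ := hh (0 + (muK k).integrablePower)
  have := integrable_of_le_of_pow_mul_le (μ := muK k) (k := 0) (f := h) (C₁ := C₁) (C₂ := C₂)
    (fun x => by simpa using h₁ x) h₂ hc.aestronglyMeasurable
  rw [← integrable_norm_iff hc.aestronglyMeasurable]
  simpa using this

lemma RapidDecay.tendsto_muDensity_mul {k : ℝ} (hk : -(1/2) ≤ k) {h : ℝ → ℂ} (hh : RapidDecay h) :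
    Tendsto (fun x => (muDensity k x : ℂ) * h x) (cocompact ℝ) (𝓝 0) := by
  obtain ⟨C, N, hC, hle⟩ := exists_muDensity_le hk
  obtain ⟨C₁, h₁⟩ := hh 1
  obtain ⟨C₂, h₂⟩ := hh (N + 1)
  set B := C * 2 ^ N * (C₁ + C₂)
  have hB (x : ℝ) : ‖(muDensity k x : ℂ) * h x‖ ≤ B * ‖x‖⁻¹ ∨ x = 0 := by
    by_cases hx : x = 0
    · exact .inr hx
    left
    have hx' : 0 < ‖x‖ := norm_pos_iff.2 hx
    rw [← div_eq_mul_inv, le_div_iff₀ hx', norm_mul, norm_real,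
      Real.norm_of_nonneg (muDensity_nonneg hk x), Real.norm_eq_abs]
    have hp : (1 + |x|) ^ N ≤ 2 ^ N * (1 + |x| ^ N) := by
      rcases le_total |x| 1 with hx1 | hx1
      · calc (1 + |x|) ^ N ≤ (2 : ℝ) ^ N := by gcongr; linarith
          _ ≤ _ := le_mul_of_one_le_right (by positivity) (by linarith [pow_nonneg (abs_nonneg x) N])
      · calc (1 + |x|) ^ N ≤ (2 * |x|) ^ N := by gcongr; linarith
          _ = 2 ^ N * |x| ^ N := mul_pow _ _ _
          _ ≤ _ := by gcongr; linarith
    calc _ ≤ C * (2 ^ N * (1 + |x| ^ N)) * ‖h x‖ * |x| := by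
          gcongr
          exact (hle x).trans (by gcongr)
      _ = C * 2 ^ N * (|x| ^ 1 * ‖h x‖ + |x| ^ (N + 1) * ‖h x‖) := by ring
      _ ≤ _ := by
        simp only [B]
        gcongr
        exacts [h₁ x, h₂ x]
  refine squeeze_zero_norm' (a := fun x => B * ‖x‖⁻¹) ?_ ?_
  · filter_upwards [(isCompact_singleton (x := (0 : ℝ))).compl_mem_cocompact] with x hx
    exact (hB x).resolve_right hx
  · simpa using (tendsto_inv_atTop_zero.comp (tendsto_norm_cocompact_atTop (E := ℝ))).const_mul B

lemma integral_dunklOp_mul {k : ℝ} (hk : -(1/2) ≤ k) {f g : ℝ → ℂ} (hf : Differentiable ℝ f)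
    (hg : Differentiable ℝ g) (h1 : Integrable (fun x => dunklOp k f x * g x) (muK k))
    (h2 : Integrable (fun x => f x * dunklOp k g x) (muK k))
    (h0 : Tendsto (fun x => (muDensity k x : ℂ) * (f x * g x)) (cocompact ℝ) (𝓝 0)) :
    ∫ x, dunklOp k f x * g x ∂(muK k) = -∫ x, f x * dunklOp k g x ∂(muK k) := by
  rw [eq_neg_iff_add_eq_zero, ← integral_add h1 h2, integral_muK hk]
  have hΦ := (integrable_muK_iff hk).1 (h1.add h2)
  simp only [Pi.add_apply] at hΦ
  set Φ : ℝ → ℂ := fun x => (muDensity k x : ℂ) * (dunklOp k f x * g x + f x * dunklOp k g x)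
  rw [← intervalIntegral.integral_Iic_add_Ioi (b := 0) hΦ.integrableOn hΦ.integrableOn,
    ← neg_zero, ← integral_comp_neg_Ioi, neg_zero,
    ← integral_add hΦ.comp_neg.integrableOn hΦ.integrableOn]
  set Q : ℝ → ℂ := fun x => (muDensity k x : ℂ) * (f x * g x - f (-x) * g (-x))
  have hneg : Tendsto (fun x : ℝ => -x) atTop (cocompact ℝ) :=
    tendsto_neg_atTop_atBot.mono_right atBot_le_cocompact
  have hQ : Tendsto Q atTop (𝓝 0) := by
    have e : Q = fun x => (muDensity k x : ℂ) * (f x * g x) -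
        (muDensity k (-x) : ℂ) * (f (-x) * g (-x)) := by
      ext x; simp only [Q, muDensity_neg]; ring
    rw [e]
    simpa using (h0.mono_left atTop_le_cocompact).sub (h0.comp hneg)
  have := integral_Ioi_of_hasDerivAt_of_tendsto (a := 0) (f := Q) (f' := fun x => Φ (-x) + Φ x) (m := 0)
    (Continuous.continuousWithinAt ?_) (fun x hx => ?_)
    (hΦ.comp_neg.add hΦ).integrableOn hQ
  · rw [this]; simp [Q]
  · have := continuous_muDensity hk
    have := hf.continuous
    have := hg.continuous
    fun_prop
  · have hx : 0 < x := hx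
    have hx' : (x : ℂ) ≠ 0 := by exact_mod_cast hx.ne'
    have hfx := (hf x).hasDerivAt
    have hgx := (hg x).hasDerivAt
    have hfn := (hf (-x)).hasDerivAt.scomp x (hasDerivAt_neg x)
    have hgn := (hg (-x)).hasDerivAt.scomp x (hasDerivAt_neg x)
    refine ((hasDerivAt_muDensity k hx).ofReal_comp.mul
      ((hfx.mul hgx).sub (hfn.mul hgn))).congr_deriv ?_
    simp [Φ, dunklOp, hx.ne', muDensity_neg]
    field_simp
    ring

lemma hasDerivAt_dunklE_mul {k : ℝ} (hk : -(1/2) ≤ k) (s x : ℝ) :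
    HasDerivAt (fun x => dunklE k (s * x))
      (s * (I * dunklE k (s * x) - I * (2 * k + 1) * dunklW k (s * x))) x := by
  refine ((hasDerivAt_dunklE hk (s * x)).scomp x ((hasDerivAt_id x).const_mul s)).congr_deriv ?_
  simp

lemma dunklW_zero {k : ℝ} (hk : -(1/2) ≤ k) : dunklW k 0 = 1 / (2 * (k + 1)) := by
  rw [dunklW, besselJ_zero (by linarith)]

lemma dunklE_zero {k : ℝ} (hk : -(1/2) ≤ k) : dunklE k 0 = 1 := by
  simp [dunklE, besselJ_zero hk]

lemma dunklOp_dunklE {k : ℝ} (hk : -(1/2) ≤ k) (s x : ℝ) :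
    dunklOp k (fun x => dunklE k (s * x)) x = I * s * dunklE k (s * x) := by
  rcases eq_or_ne x 0 with rfl | hx
  · have h0 : (k : ℂ) + 1 ≠ 0 := by exact_mod_cast (by linarith : k + 1 ≠ 0)
    simp only [dunklOp, if_true, (hasDerivAt_dunklE_mul hk s 0).deriv]
    simp only [mul_zero, dunklE_zero hk, dunklW_zero hk]
    push_cast
    field_simp
    ring
  · have hx' : (x : ℂ) ≠ 0 := by exact_mod_cast hx
    simp only [dunklOp, if_neg hx, (hasDerivAt_dunklE_mul hk s x).deriv, mul_neg s, dunklE_sub_neg]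
    push_cast
    field_simp
    ring

lemma integral_dunklOp_mul_dunklE {k : ℝ} (hk : -(1/2) ≤ k) {h : ℝ → ℂ} (hd : Differentiable ℝ h)
    (hh : RapidDecay h) (hc : Continuous (dunklOp k h)) (hh' : RapidDecay (dunklOp k h)) (s : ℝ) :
    ∫ x, dunklOp k h x * dunklE k (s * x) ∂(muK k) =
      -(I * s) * ∫ x, h x * dunklE k (s * x) ∂(muK k) := by
  have hE := continuous_dunklE hk
  have hb : ∀ x, ‖dunklE k (s * x)‖ ≤ 1 := fun x => norm_dunklE_le_one hk _
  have hi : Integrable (fun x => h x * dunklE k (s * x)) (muK k) :=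
    (hh.mul_bounded hb).integrable hk (by have := hd.continuous; fun_prop)
  have e : (fun x => h x * dunklOp k (fun x => dunklE k (s * x)) x) =
      fun x => I * s * (h x * dunklE k (s * x)) := by
    ext x; rw [dunklOp_dunklE hk]; ring
  rw [integral_dunklOp_mul hk hd
    (fun x => (hasDerivAt_dunklE_mul hk s x).differentiableAt)
    ((hh'.mul_bounded hb).integrable hk (by fun_prop))
    (by rw [e]; exact hi.const_mul _) ((hh.mul_bounded hb).tendsto_muDensity_mul hk), e,
    integral_const_mul, neg_mul]

lemma dunklT_eq (k : ℝ) (f : ℝ → ℂ) (lam : ℝ) :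
    dunklT k f lam = ∫ x, f x * dunklE k (-lam * x) ∂(muK k) := by
  simp only [dunklT, dunklKernel_eq]

lemma integrable_mul_dunklE {k : ℝ} (hk : -(1/2) ≤ k) (f : 𝓢(ℝ, ℂ)) (s : ℝ) :
    Integrable (fun x => f x * dunklE k (s * x)) (muK k) :=
  (f.rapidDecay.mul_bounded (fun x => norm_dunklE_le_one hk _)).integrable hk
    (by have := continuous_dunklE hk; fun_prop)

/-- Multiplication of a Schwartz function by the variable. -/
noncomputable def schwartzMulId (f : 𝓢(ℝ, ℂ)) : 𝓢(ℝ, ℂ) :=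
  SchwartzMap.smulLeftCLM ℂ (fun x : ℝ => (x : ℂ)) f

@[simp] lemma schwartzMulId_apply (f : 𝓢(ℝ, ℂ)) (x : ℝ) : schwartzMulId f x = x * f x :=
  SchwartzMap.smulLeftCLM_apply_apply Function.Complex.hasTemperateGrowth_ofReal f x

lemma hasDerivAt_dunklT {k : ℝ} (hk : -(1/2) ≤ k) (f : 𝓢(ℝ, ℂ)) (lam : ℝ) :
    HasDerivAt (dunklT k f) (∫ x, f x *
      (-x * (I * dunklE k (-lam * x) - I * (2 * k + 1) * dunklW k (-lam * x))) ∂(muK k)) lam := by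
  have := hasTemperateGrowth_muK hk
  have hE := continuous_dunklE hk
  have hW := continuous_dunklW hk
  rw [funext (dunklT_eq k f)]
  refine (hasDerivAt_integral_of_dominated_loc_of_deriv_le (s := Set.univ)
    (F := fun lam x => f x * dunklE k (-lam * x))
    (F' := fun lam x => f x *
      (-x * (I * dunklE k (-lam * x) - I * (2 * k + 1) * dunklW k (-lam * x))))
    (bound := fun x => (1 + |2 * k + 1|) * (‖x‖ ^ 1 * ‖f x‖)) univ_mem
    (.of_forall fun y => (integrable_mul_dunklE hk f _).1) (integrable_mul_dunklE hk f _) ?_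
    (.of_forall fun x y _ => ?_) ((f.integrable_pow_mul (muK k) 1).const_mul _)
    (.of_forall fun x y _ => ?_)).2
  · exact (by fun_prop : Continuous fun x : ℝ => f x * (-x * (I * dunklE k (-lam * x) -
      I * (2 * k + 1) * dunklW k (-lam * x)))).aestronglyMeasurable
  · have hb : ‖I * dunklE k (-y * x) - I * (2 * k + 1) * dunklW k (-y * x)‖ ≤ 1 + |2 * k + 1| := by
      refine (norm_sub_le _ _).trans ?_
      rw [norm_mul, norm_mul, norm_mul, norm_I, one_mul, one_mul, norm_real,
        show (2 * (k : ℂ) + 1) = ((2 * k + 1 : ℝ) : ℂ) by push_cast; ring, norm_real]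
      gcongr
      · exact norm_dunklE_le_one hk _
      · exact mul_le_of_le_one_right (by positivity) (abs_dunklW_le_one hk _)
    rw [norm_mul, norm_mul, norm_neg, norm_real, pow_one]
    calc _ ≤ ‖f x‖ * (‖x‖ * (1 + |2 * k + 1|)) := by gcongr
      _ = _ := by ring
  · have := (hasDerivAt_dunklE hk (-y * x)).scomp y (((hasDerivAt_id y).neg).mul_const x)
    refine (this.const_mul (f x)).congr_deriv ?_
    simp

lemma dunklOp_dunklT {k : ℝ} (hk : -(1/2) ≤ k) (f : 𝓢(ℝ, ℂ)) (lam : ℝ) :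
    dunklOp k (dunklT k f) lam = -I * dunklT k (schwartzMulId f) lam := by
  have hE := continuous_dunklE hk
  have hW := continuous_dunklW hk
  have hWi : Integrable (fun x => x * f x * (dunklW k (lam * x) : ℂ)) (muK k) := by
    refine (((schwartzMulId f).rapidDecay.mul_bounded (g := fun x => (dunklW k (lam * x) : ℂ))
      (B := 1) fun x => ?_).integrable hk (by fun_prop)).congr (.of_forall fun x => by simp)
    rw [norm_real]
    exact abs_dunklW_le_one hk _
  have e : ∫ x, f x * (-x * (I * dunklE k (-lam * x) - I * (2 * k + 1) * dunklW k (-lam * x)))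
      ∂(muK k) = -I * dunklT k (schwartzMulId f) lam +
        I * (2 * k + 1) * ∫ x, x * f x * (dunklW k (lam * x) : ℂ) ∂(muK k) := by
    rw [dunklT_eq, ← integral_const_mul, ← integral_const_mul, ← integral_add]
    · congr 1 with x
      rw [neg_mul lam, dunklW_neg, schwartzMulId_apply]
      ring
    · exact (integrable_mul_dunklE hk _ _).const_mul _
    · exact hWi.const_mul _
  rcases eq_or_ne lam 0 with rfl | hx
  · have h0 : (k : ℂ) + 1 ≠ 0 := by exact_mod_cast (by linarith : k + 1 ≠ 0)
    simp only [dunklOp, if_true, (hasDerivAt_dunklT hk f 0).deriv]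
    rw [e]
    simp only [dunklT_eq, zero_mul, neg_zero, dunklW_zero hk, dunklE_zero hk, schwartzMulId_apply,
      mul_one, integral_mul_const]
    push_cast
    field_simp
    ring
  · have hx' : (lam : ℂ) ≠ 0 := by exact_mod_cast hx
    have e2 : (dunklT k f lam - dunklT k f (-lam)) / 2 =
        -I * lam * ∫ x, x * f x * (dunklW k (lam * x) : ℂ) ∂(muK k) := by
      rw [dunklT_eq, dunklT_eq, ← integral_sub (integrable_mul_dunklE hk _ _)
        (integrable_mul_dunklE hk _ _), ← integral_div, ← integral_const_mul]
      congr 1 with x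
      have := dunklE_sub_neg k (lam * x)
      rw [neg_neg, neg_mul]
      push_cast at this
      linear_combination (-f x) * this
    simp only [dunklOp, if_neg hx, (hasDerivAt_dunklT hk f lam).deriv, e, e2]
    push_cast
    field_simp
    ring

lemma continuous_dunklT {k : ℝ} (hk : -(1/2) ≤ k) (f : 𝓢(ℝ, ℂ)) : Continuous (dunklT k f) :=
  continuous_iff_continuousAt.2 fun t => (hasDerivAt_dunklT hk f t).continuousAt

lemma dunklT_dunklOp {k : ℝ} (hk : -(1/2) ≤ k) (f : 𝓢(ℝ, ℂ)) (lam : ℝ) :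
    dunklT k (dunklOp k f) lam = I * lam * dunklT k f lam := by
  obtain ⟨g, hg⟩ := exists_schwartz_dunklOp k f
  rw [dunklT_eq, dunklT_eq, integral_dunklOp_mul_dunklE hk f.differentiable f.rapidDecay
    (hg ▸ g.continuous) (hg ▸ g.rapidDecay)]
  push_cast
  ring

lemma exists_schwartz_dunklOp_iterate (k : ℝ) (f : 𝓢(ℝ, ℂ)) (n : ℕ) :
    ∃ g : 𝓢(ℝ, ℂ), ⇑g = (dunklOp k)^[n] f := by
  induction n with
  | zero => exact ⟨f, rfl⟩
  | succ n ih =>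
    obtain ⟨g, hg⟩ := ih
    rw [Function.iterate_succ_apply', ← hg]
    exact exists_schwartz_dunklOp k g

lemma dunklT_dunklOp_iterate {k : ℝ} (hk : -(1/2) ≤ k) (f : 𝓢(ℝ, ℂ)) (n : ℕ) (lam : ℝ) :
    dunklT k ((dunklOp k)^[n] f) lam = (I * lam) ^ n * dunklT k f lam := by
  induction n with
  | zero => simp
  | succ n ih =>
    obtain ⟨g, hg⟩ := exists_schwartz_dunklOp_iterate k f n
    rw [Function.iterate_succ_apply', ← hg, dunklT_dunklOp hk, hg, ih]
    ring

lemma rapidDecay_dunklT {k : ℝ} (hk : -(1/2) ≤ k) (f : 𝓢(ℝ, ℂ)) : RapidDecay (dunklT k f) := by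
  intro n
  obtain ⟨g, hg⟩ := exists_schwartz_dunklOp_iterate k f n
  refine ⟨∫ x, ‖g x‖ ∂(muK k), fun lam => ?_⟩
  have e : |lam| ^ n * ‖dunklT k f lam‖ = ‖dunklT k g lam‖ := by
    rw [hg, dunklT_dunklOp_iterate hk, norm_mul, norm_pow, norm_mul, norm_I, one_mul, norm_real,
      Real.norm_eq_abs]
  rw [e, dunklT_eq]
  refine norm_integral_le_of_norm_le (g.rapidDecay.integrable hk g.continuous).norm
    (.of_forall fun x => ?_)
  rw [norm_mul]
  exact mul_le_of_le_one_right (norm_nonneg _) (norm_dunklE_le_one hk _)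

lemma exists_bound_pow_mul_polynomial_mul_gaussian (p : Polynomial ℝ) :
    ∀ j : ℕ, ∃ C, ∀ x : ℝ, |x| ^ j * |p.eval x * Real.exp (-(x ^ 2 / 2))| ≤ C := by
  induction p using Polynomial.induction_on' with
  | add p q hp hq =>
    intro j
    obtain ⟨C, hC⟩ := hp j
    obtain ⟨C', hC'⟩ := hq j
    refine ⟨C + C', fun x => (le_trans ?_ (add_le_add (hC x) (hC' x)))⟩
    rw [← mul_add, Polynomial.eval_add, add_mul]
    gcongr
    exact abs_add_le _ _
  | monomial n a =>
    intro j
    refine ⟨|a| * (1 + 2 ^ (n + j) * (n + j).factorial), fun x => ?_⟩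
    have h1 := Real.pow_div_factorial_le_exp (x ^ 2 / 2) (by positivity) (n + j)
    have h2 : |x| ^ (n + j) ≤
        (1 + 2 ^ (n + j) * (n + j).factorial) * Real.exp (x ^ 2 / 2) := by
      have h3 : |x| ^ (n + j) ≤ 1 + (x ^ 2) ^ (n + j) := by
        rw [← sq_abs, ← pow_mul, mul_comm, pow_mul]
        nlinarith [sq_nonneg (|x| ^ (n + j) - 1)]
      have h4 : (x ^ 2) ^ (n + j) ≤ 2 ^ (n + j) * (n + j).factorial * Real.exp (x ^ 2 / 2) := by
        rw [div_pow, div_div, div_le_iff₀ (by positivity)] at h1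
        linarith
      have h5 : 1 ≤ Real.exp (x ^ 2 / 2) := Real.one_le_exp (by positivity)
      linarith
    rw [Polynomial.eval_monomial, abs_mul, abs_mul, abs_pow, Real.abs_exp, Real.exp_neg]
    calc _ = |a| * (|x| ^ (n + j) / Real.exp (x ^ 2 / 2)) := by rw [pow_add]; ring
      _ ≤ _ := by gcongr; rwa [div_le_iff₀ (Real.exp_pos _)]

/-- The standard Gaussian as a Schwartz function. -/
noncomputable def schwartzGaussian : 𝓢(ℝ, ℂ) :=
  SchwartzMap.postcompCLM (𝕜 := ℝ) ofRealCLM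
    { toFun := fun x : ℝ => Real.exp (-(x ^ 2 / 2))
      smooth' := by fun_prop
      decay' := fun j n => by
        obtain ⟨C, hC⟩ := exists_bound_pow_mul_polynomial_mul_gaussian
          ((-1) ^ n * (Polynomial.hermite n).map (Int.castRingHom ℝ)) j
        refine ⟨C, fun x => ?_⟩
        rw [norm_iteratedFDeriv_eq_norm_iteratedDeriv, iteratedDeriv_eq_iterate,
          Polynomial.deriv_gaussian_eq_hermite_mul_gaussian]
        simpa [Polynomial.aeval_def, Polynomial.eval_map] using hC x }

lemma schwartzGaussian_apply (x : ℝ) :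
    schwartzGaussian x = ((Real.exp (-(x ^ 2 / 2)) : ℝ) : ℂ) := rfl

lemma schwartzGaussian_neg (x : ℝ) : schwartzGaussian (-x) = schwartzGaussian x := by
  simp [schwartzGaussian_apply]

lemma schwartzGaussian_ne_zero (x : ℝ) : schwartzGaussian x ≠ 0 := by
  rw [schwartzGaussian_apply]
  exact_mod_cast (Real.exp_pos _).ne'

lemma hasDerivAt_schwartzGaussian (x : ℝ) :
    HasDerivAt schwartzGaussian (-x * schwartzGaussian x) x := by
  have := (((hasDerivAt_pow 2 x).div_const 2).neg.exp).ofReal_comp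
  refine this.congr_deriv ?_
  rw [schwartzGaussian_apply]
  simp only [Pi.neg_apply]
  push_cast
  ring

lemma dunklOp_schwartzGaussian (k : ℝ) :
    dunklOp k schwartzGaussian = -schwartzMulId schwartzGaussian := by
  ext x
  rcases eq_or_ne x 0 with rfl | hx
  · simp [dunklOp, (hasDerivAt_schwartzGaussian 0).deriv]
  · simp [dunklOp, hx, (hasDerivAt_schwartzGaussian x).deriv, schwartzGaussian_neg]

/-- The total mass of the Gaussian for `muK k`. -/
noncomputable def gaussianMass (k : ℝ) : ℝ := ∫ x, muDensity k x * Real.exp (-(x ^ 2 / 2))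

lemma gaussianMass_pos {k : ℝ} (hk : -(1/2) ≤ k) : 0 < gaussianMass k := by
  have hi := (integrable_muK_iff hk).1
    (schwartzGaussian.rapidDecay.integrable hk schwartzGaussian.continuous)
  have hρ := continuous_muDensity hk
  refine integral_pos_of_integrable_nonneg_nonzero (x := 1) (by fun_prop) ?_
    (fun x => mul_nonneg (muDensity_nonneg hk x) (Real.exp_pos _).le) ?_
  · refine hi.re.congr (.of_forall fun x => ?_)
    simp only [schwartzGaussian_apply, ← ofReal_mul]
    rfl
  · have := muK_const_pos hk
    exact mul_ne_zero (div_ne_zero (by simp) this.ne') (Real.exp_pos _).ne'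

lemma integral_muK_comp_neg {k : ℝ} (hk : -(1/2) ≤ k) (g : ℝ → ℂ) :
    ∫ x, g (-x) ∂(muK k) = ∫ x, g x ∂(muK k) := by
  rw [integral_muK hk, integral_muK hk, ← integral_neg_eq_self]
  simp [muDensity_neg]

lemma dunklT_schwartzGaussian {k : ℝ} (hk : -(1/2) ≤ k) (lam : ℝ) :
    dunklT k schwartzGaussian lam = gaussianMass k * schwartzGaussian lam := by
  set h := dunklT k schwartzGaussian with hdef
  have hev (l : ℝ) : h (-l) = h l := by
    rw [hdef, dunklT_eq, dunklT_eq, ← integral_muK_comp_neg hk]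
    simp [schwartzGaussian_neg]
  have hΛ (l : ℝ) : dunklOp k h l = -l * h l := by
    have h1 := dunklT_dunklOp hk schwartzGaussian l
    rw [dunklOp_schwartzGaussian] at h1
    have h2 : dunklT k (⇑(-schwartzMulId schwartzGaussian)) l =
        -dunklT k (schwartzMulId schwartzGaussian) l := by
      rw [dunklT_eq, dunklT_eq, ← integral_neg]
      simp
    have h2' := h1
    rw [show (-⇑(schwartzMulId schwartzGaussian)) = ⇑(-schwartzMulId schwartzGaussian) from rfl, h2]
      at h2'
    rw [dunklOp_dunklT hk]
    linear_combination I * h2' + l * h l * I_mul_I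
  have hd (l : ℝ) : HasDerivAt h (-l * h l) l := by
    have h1 := (hasDerivAt_dunklT hk schwartzGaussian l).differentiableAt.hasDerivAt
    refine h1.congr_deriv ?_
    have h2 := hΛ l
    rcases eq_or_ne l 0 with rfl | hl
    · have h0 : (2 * (k : ℂ) + 2) ≠ 0 := by exact_mod_cast (by linarith : 2 * k + 2 ≠ 0)
      simpa [dunklOp, h0] using h2
    · simpa [dunklOp, hl, hev] using h2
  have hq (l : ℝ) : HasDerivAt (fun l => h l / schwartzGaussian l) 0 l := by
    refine ((hd l).div (hasDerivAt_schwartzGaussian l) (schwartzGaussian_ne_zero l)).congr_deriv ?_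
    ring
  have hconst := is_const_of_deriv_eq_zero (fun l => (hq l).differentiableAt)
    (fun l => (hq l).deriv) lam 0
  have h0 : h 0 = gaussianMass k := by
    rw [hdef, dunklT_eq, integral_muK hk, gaussianMass, ← integral_complex_ofReal]
    simp [dunklE_zero hk, schwartzGaussian_apply]
  rw [h0, div_eq_iff (schwartzGaussian_ne_zero _)] at hconst
  rw [hconst]
  simp [schwartzGaussian_apply 0]

/-- The inverse transform applied to the Dunkl transform. -/
noncomputable def dunklTInv (k : ℝ) (f : ℝ → ℂ) (y : ℝ) : ℂ :=
  ∫ l, dunklT k f l * dunklE k (y * l) ∂(muK k)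

lemma integrable_dunklT_mul_dunklE {k : ℝ} (hk : -(1/2) ≤ k) (f : 𝓢(ℝ, ℂ)) (y : ℝ) :
    Integrable (fun l => dunklT k f l * dunklE k (y * l)) (muK k) :=
  ((rapidDecay_dunklT hk f).mul_bounded (fun x => norm_dunklE_le_one hk _)).integrable hk
    (by have := continuous_dunklE hk; have := continuous_dunklT hk f; fun_prop)

lemma dunklTInv_schwartzMulId {k : ℝ} (hk : -(1/2) ≤ k) (f : 𝓢(ℝ, ℂ)) (y : ℝ) :
    dunklTInv k (schwartzMulId f) y = y * dunklTInv k f y := by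
  have e : dunklOp k (dunklT k f) = fun l => dunklT k (schwartzMulId f) l * -I :=
    funext fun l => by rw [dunklOp_dunklT hk, mul_comm]
  have h := integral_dunklOp_mul_dunklE hk (h := dunklT k f)
    (fun l => (hasDerivAt_dunklT hk f l).differentiableAt) (rapidDecay_dunklT hk f)
    (by rw [e]; exact (continuous_dunklT hk _).mul continuous_const)
    (by rw [e]; exact (rapidDecay_dunklT hk _).mul_bounded (fun _ => le_rfl)) y
  rw [e] at h
  have e2 : (fun l => dunklT k (schwartzMulId f) l * -I * dunklE k (y * l)) =
      fun l => -I * (dunklT k (schwartzMulId f) l * dunklE k (y * l)) := by ext l; ring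
  rw [e2, integral_const_mul] at h
  simp only [dunklTInv]
  refine mul_left_cancel₀ (neg_ne_zero.2 I_ne_zero) ?_
  rw [h]
  ring

lemma dunklTInv_add {k : ℝ} (hk : -(1/2) ≤ k) (f g : 𝓢(ℝ, ℂ)) (y : ℝ) :
    dunklTInv k (f + g) y = dunklTInv k f y + dunklTInv k g y := by
  have e (l : ℝ) : dunklT k (⇑f + ⇑g) l = dunklT k f l + dunklT k g l := by
    rw [dunklT_eq, dunklT_eq, dunklT_eq,
      ← integral_add (integrable_mul_dunklE hk _ _) (integrable_mul_dunklE hk _ _)]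
    simp [add_mul]
  rw [dunklTInv, dunklTInv, dunklTInv, ← integral_add (integrable_dunklT_mul_dunklE hk _ _)
    (integrable_dunklT_mul_dunklE hk _ _)]
  simp [e, add_mul]

lemma dunklTInv_smul (k : ℝ) (c : ℂ) (f : ℝ → ℂ) (y : ℝ) :
    dunklTInv k (fun x => c * f x) y = c * dunklTInv k f y := by
  have e (l : ℝ) : dunklT k (fun x => c * f x) l = c * dunklT k f l := by
    rw [dunklT_eq, dunklT_eq, ← integral_const_mul]
    simp [mul_assoc]
  rw [dunklTInv, dunklTInv, ← integral_const_mul]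
  simp [e, mul_assoc]

/-- The inversion formula, up to a positive constant. -/
lemma dunklTInv_eq {k : ℝ} (hk : -(1/2) ≤ k) (f : 𝓢(ℝ, ℂ)) (y : ℝ) :
    dunklTInv k f y = (gaussianMass k) ^ 2 * f y := by
  set c : ℂ := f y / schwartzGaussian y
  obtain ⟨q, hq⟩ := exists_schwartz_sub_mul_eq (f - c • schwartzGaussian) y
    (by simp [c, div_mul_cancel₀ _ (schwartzGaussian_ne_zero y)])
  have hf : (⇑f : ℝ → ℂ) = ⇑((schwartzMulId q + (-(y : ℂ)) • q) + c • schwartzGaussian) := by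
    ext x
    have := hq x
    simp at this
    simp
    linear_combination this
  have hs (a : ℂ) (g : 𝓢(ℝ, ℂ)) : dunklTInv k (⇑(a • g)) y = a * dunklTInv k g y :=
    dunklTInv_smul k a g y
  have ha (g h : 𝓢(ℝ, ℂ)) : dunklTInv k (⇑(g + h)) y = dunklTInv k g y + dunklTInv k h y :=
    dunklTInv_add hk g h y
  have hG : dunklTInv k schwartzGaussian y = gaussianMass k ^ 2 * schwartzGaussian y := by
    have h1 := dunklT_schwartzGaussian hk (-y)
    rw [dunklT_eq, neg_neg, schwartzGaussian_neg] at h1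
    rw [dunklTInv]
    simp only [dunklT_schwartzGaussian hk, mul_assoc]
    rw [integral_const_mul, h1]
    ring
  rw [hf, ha, ha, hs, hs, dunklTInv_schwartzMulId hk, hG, ← hf]
  simp only [c]
  field_simp [schwartzGaussian_ne_zero y]
  ring

lemma integral_dunklT_mul_conj {k : ℝ} (hk : -(1/2) ≤ k) (f : 𝓢(ℝ, ℂ)) :
    ∫ l, dunklT k f l * (starRingEnd ℂ) (dunklT k f l) ∂(muK k) =
      gaussianMass k ^ 2 * ∫ x, f x * (starRingEnd ℂ) (f x) ∂(muK k) := by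
  have : SFinite (muK k) := by rw [muK_eq]; infer_instance
  have hE := continuous_dunklE hk
  have hDc := continuous_dunklT hk f
  have hD : Integrable (fun l => (starRingEnd ℂ) (dunklT k f l)) (muK k) :=
    (((rapidDecay_dunklT hk f).integrable hk hDc).norm.mono' (by fun_prop) (by simp))
  have hf := f.rapidDecay.integrable hk f.continuous
  have hint : Integrable (fun p : ℝ × ℝ => (starRingEnd ℂ) (dunklT k f p.1) * f p.2 *
      dunklE k (-p.1 * p.2)) ((muK k).prod (muK k)) := by
    refine (hD.mul_prod hf).mul_bdd (c := 1) ?_ (.of_forall fun p => norm_dunklE_le_one hk _)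
    exact (by fun_prop : Continuous fun p : ℝ × ℝ => dunklE k (-p.1 * p.2)).aestronglyMeasurable
  calc _ = ∫ l, ∫ x, (starRingEnd ℂ) (dunklT k f l) * f x * dunklE k (-l * x) ∂(muK k) ∂(muK k) := by
        congr 1 with l
        rw [mul_comm, dunklT_eq k f l, ← integral_const_mul]
        simp only [mul_assoc]
    _ = ∫ x, ∫ l, (starRingEnd ℂ) (dunklT k f l) * f x * dunklE k (-l * x) ∂(muK k) ∂(muK k) :=
        integral_integral_swap hint
    _ = ∫ x, gaussianMass k ^ 2 * (f x * (starRingEnd ℂ) (f x)) ∂(muK k) := by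
        congr 1 with x
        have h1 := congrArg (starRingEnd ℂ) (dunklTInv_eq hk f x)
        rw [dunklTInv, ← integral_conj] at h1
        simp only [map_mul, map_pow, conj_ofReal, conj_dunklE] at h1
        have e : (fun l => (starRingEnd ℂ) (dunklT k f l) * f x * dunklE k (-l * x)) =
            fun l => f x * ((starRingEnd ℂ) (dunklT k f l) * dunklE k (-(x * l))) := by
          ext l
          rw [show -l * x = -(x * l) by ring]
          ring
        rw [e, integral_const_mul, h1]
        ring
    _ = _ := integral_const_mul _ _

lemma lintegral_enorm_sq_eq {α : Type*} [MeasurableSpace α] {μ : Measure α} {g : α → ℂ}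
    (hg : Integrable (fun x => g x * (starRingEnd ℂ) (g x)) μ) :
    ∫⁻ x, ‖g x‖ₑ ^ 2 ∂μ = ENNReal.ofReal (∫ x, g x * (starRingEnd ℂ) (g x) ∂μ).re := by
  have e : (fun x => g x * (starRingEnd ℂ) (g x)) = fun x => ((‖g x‖ ^ 2 : ℝ) : ℂ) := by
    ext x; rw [mul_conj, normSq_eq_norm_sq]
  rw [e] at hg ⊢
  rw [integral_complex_ofReal, ofReal_re, ofReal_integral_eq_lintegral_ofReal]
  · congr 1 with x
    rw [ENNReal.ofReal_pow (norm_nonneg _), ofReal_norm]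
  · exact hg.re
  · exact .of_forall fun x => by positivity

/-- Plancherel's identity, up to a positive constant. -/
lemma lintegral_dunklT_sq {k : ℝ} (hk : -(1/2) ≤ k) (f : 𝓢(ℝ, ℂ)) :
    ∫⁻ l, ‖dunklT k f l‖ₑ ^ 2 ∂(muK k) =
      ENNReal.ofReal (gaussianMass k ^ 2) * ∫⁻ x, ‖f x‖ₑ ^ 2 ∂(muK k) := by
  have hi {h : ℝ → ℂ} (hh : RapidDecay h) (hc : Continuous h) :
      Integrable (fun x => h x * (starRingEnd ℂ) (h x)) (muK k) := by
    obtain ⟨C, hC⟩ := hh 0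
    exact (hh.mul_bounded (g := fun x => (starRingEnd ℂ) (h x)) (B := C) fun x => by
      simpa using hC x).integrable hk (by fun_prop)
  rw [lintegral_enorm_sq_eq (hi (rapidDecay_dunklT hk f) (continuous_dunklT hk f)),
    lintegral_enorm_sq_eq (hi f.rapidDecay f.continuous), integral_dunklT_mul_conj hk,
    ← ENNReal.ofReal_mul (by positivity), ← ofReal_pow, re_ofReal_mul]

lemma eLpNorm_two_sq {α : Type*} [MeasurableSpace α] {μ : Measure α} (g : α → ℂ) :
    eLpNorm g 2 μ ^ 2 = ∫⁻ x, ‖g x‖ₑ ^ 2 ∂μ := by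
  have := eLpNorm_nnreal_pow_eq_lintegral (μ := μ) (f := g) (p := 2) two_ne_zero
  simpa only [NNReal.coe_ofNat, ENNReal.coe_ofNat, ENNReal.rpow_ofNat] using this

lemma lintegral_muK_comp_div {k b : ℝ} (hk : -(1/2) ≤ k) (hb : b ≠ 0) {F : ℝ → ℝ≥0∞}
    (hF : Measurable F) :
    ∫⁻ l, F (l / b) ∂(muK k) = ENNReal.ofReal (|b| ^ (2 * k + 2)) * ∫⁻ x, F x ∂(muK k) := by
  have hρ := measurable_muDensity hk
  have hb' : 0 < |b| := abs_pos.2 hb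
  rw [muK_eq, lintegral_withDensity_eq_lintegral_mul _ hρ (by fun_prop),
    lintegral_withDensity_eq_lintegral_mul _ hρ hF, ← Real.smul_map_volume_mul_left hb,
    lintegral_smul_measure, lintegral_map (by fun_prop) (by fun_prop),
    Real.smul_map_volume_mul_left hb, smul_eq_mul, ← lintegral_const_mul' _ _ (by simp),
    ← lintegral_const_mul' _ _ (by simp)]
  congr 1 with x
  simp only [Pi.mul_apply]
  rw [mul_div_cancel_left₀ x hb, ← mul_assoc, ← mul_assoc, ← ENNReal.ofReal_mul (by positivity),
    ← ENNReal.ofReal_mul (by positivity)]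
  congr 2
  rw [muDensity, muDensity, abs_mul, Real.mul_rpow (by positivity) (by positivity),
    show 2 * k + 2 = (2 * k + 1) + 1 by ring, Real.rpow_add_one hb'.ne' (2 * k + 1)]
  ring

/-- The quadratic chirp intertwining `lcdOp` with `dunklOp`. -/
noncomputable def chirp (s x : ℝ) : ℂ := cexp (I * (s * x ^ 2 : ℝ))

lemma norm_chirp (s x : ℝ) : ‖chirp s x‖ = 1 := by
  rw [chirp, mul_comm, norm_exp_ofReal_mul_I]

lemma chirp_mul_chirp_neg (s x : ℝ) : chirp s x * chirp (-s) x = 1 := by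
  rw [chirp, chirp, ← Complex.exp_add]
  simp

lemma hasDerivAt_chirp (s x : ℝ) : HasDerivAt (chirp s) (I * (2 * s * x) * chirp s x) x := by
  refine ((((hasDerivAt_pow 2 x).const_mul s).ofReal_comp.const_mul I).cexp).congr_deriv ?_
  simp only [chirp]
  push_cast
  ring

lemma dunklOp_chirp_mul (k a b : ℝ) {f : ℝ → ℂ} (hf : Differentiable ℝ f) :
    dunklOp k (fun x => chirp (a / b / 2) x * f x) =
      fun x => chirp (a / b / 2) x * lcdOp k a b f x := by
  have hd (x : ℝ) := ((hasDerivAt_chirp (a / b / 2) x).mul (hf x).hasDerivAt).deriv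
  ext x
  have hx := hd x
  have hneg : chirp (a / b / 2) (-x) = chirp (a / b / 2) x := by simp [chirp]
  rcases eq_or_ne x 0 with rfl | h
  · simp only [lcdOp, dunklOp, if_true]
    erw [hx]
    simp
    ring
  · simp only [lcdOp, dunklOp, if_neg h, hneg]
    erw [hx]
    push_cast
    ring

lemma dunklOp_iterate_chirp_mul (k a b : ℝ) {f : ℝ → ℂ} {g : 𝓢(ℝ, ℂ)}
    (hg : ∀ x, g x = chirp (a / b / 2) x * f x) (n : ℕ) (x : ℝ) :
    (dunklOp k)^[n] g x = chirp (a / b / 2) x * (lcdOp k a b)^[n] f x := by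
  induction n generalizing x with
  | zero => exact hg x
  | succ n ih =>
    obtain ⟨q, hq⟩ := exists_schwartz_dunklOp_iterate k g n
    have e : (lcdOp k a b)^[n] f = fun x => chirp (-(a / b / 2)) x * q x := by
      ext x
      rw [hq, ih]
      linear_combination (-(lcdOp k a b)^[n] f x) * chirp_mul_chirp_neg (a / b / 2) x
    have hd : Differentiable ℝ ((lcdOp k a b)^[n] f) := by
      rw [e]
      exact fun x => (hasDerivAt_chirp _ x).differentiableAt.mul (q.differentiable x)
    rw [Function.iterate_succ_apply', Function.iterate_succ_apply', funext ih,
      dunklOp_chirp_mul k a b hd]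

lemma norm_lcdt {k b : ℝ} (a d : ℝ) (hb : b ≠ 0) {f g : ℝ → ℂ}
    (hg : ∀ x, g x = chirp (a / b / 2) x * f x) (lam : ℝ) :
    ‖lcdt k a b d f lam‖ = (|b| ^ (k + 1))⁻¹ * ‖dunklT k g (lam / b)‖ := by
  have e : (fun x : ℝ => f x * cexp (I / 2 * (((d / b : ℝ) : ℂ) * (lam : ℂ) ^ 2 +
      ((a / b : ℝ) : ℂ) * (x : ℂ) ^ 2)) * dunklKernel k (-lam / b) x) =
      fun x => chirp (d / b / 2) lam * (g x * dunklE k (-(lam / b) * x)) := by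
    ext x
    rw [hg, dunklKernel_eq, neg_div, mul_add, Complex.exp_add, chirp, chirp]
    push_cast
    ring_nf
  have hbI : I * (b : ℂ) ≠ 0 := mul_ne_zero I_ne_zero (by exact_mod_cast hb)
  rw [lcdt, e, integral_const_mul, ← dunklT_eq, norm_mul, norm_mul, norm_chirp, one_mul, norm_inv,
    norm_cpow_of_ne_zero hbI]
  simp

lemma eLpNorm_lcdt_sq {k b : ℝ} (a d : ℝ) (hk : -(1/2) ≤ k) (hb : b ≠ 0) (m : ℕ)
    (f : 𝓢(ℝ, ℂ)) :
    (eLpNorm (fun lam : ℝ => (((1 + lam ^ 2) ^ ((m : ℝ) / 2) : ℝ) : ℂ) * lcdt k a b d f lam)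
      2 (muK k)) ^ 2 = ∑ n ∈ Finset.range (m + 1),
        ENNReal.ofReal (m.choose n * (b ^ 2) ^ n * gaussianMass k ^ 2) *
          (eLpNorm ((lcdOp k a b)^[n] f) 2 (muK k)) ^ 2 := by
  obtain ⟨g, hg⟩ := exists_schwartz_mul (hasTemperateGrowth_cexp_mul_sq (a / b / 2)) f
  replace hg (x : ℝ) : g x = chirp (a / b / 2) x * f x := hg x
  have hDc := continuous_dunklT hk g
  have hb' : 0 < |b| := abs_pos.2 hb
  have hterm (n : ℕ) : ∫⁻ x, ENNReal.ofReal ((x ^ 2) ^ n) * ‖dunklT k g x‖ₑ ^ 2 ∂(muK k) =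
      ENNReal.ofReal (gaussianMass k ^ 2) * eLpNorm ((lcdOp k a b)^[n] f) 2 (muK k) ^ 2 := by
    obtain ⟨q, hq⟩ := exists_schwartz_dunklOp_iterate k g n
    have h1 := lintegral_dunklT_sq hk q
    rw [hq] at h1
    rw [eLpNorm_two_sq]
    convert h1 using 2
    · ext x
      rw [dunklT_dunklOp_iterate hk, enorm_mul, mul_pow]
      congr 1
      rw [← ofReal_norm, norm_pow, norm_mul, norm_I, one_mul, norm_real, Real.norm_eq_abs,
        ← ENNReal.ofReal_pow (by positivity), pow_right_comm |x|, sq_abs]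
    · congr 1 with x
      rw [dunklOp_iterate_chirp_mul k a b hg, enorm_mul, ← ofReal_norm (chirp _ _), norm_chirp]
      simp
  set F : ℝ → ℝ≥0∞ := fun x => ENNReal.ofReal ((|b| ^ (2 * k + 2))⁻¹) *
    (ENNReal.ofReal ((1 + b ^ 2 * x ^ 2) ^ m) * ‖dunklT k g x‖ₑ ^ 2)
  have hF (l : ℝ) : ‖(((1 + l ^ 2) ^ ((m : ℝ) / 2) : ℝ) : ℂ) * lcdt k a b d f l‖ₑ ^ 2 =
      F (l / b) := by
    have h1 : 0 ≤ 1 + l ^ 2 := by positivity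
    simp only [F]
    rw [← ofReal_norm, ← ofReal_norm, ← ENNReal.ofReal_pow (by positivity),
      ← ENNReal.ofReal_pow (by positivity), ← ENNReal.ofReal_mul (by positivity),
      ← ENNReal.ofReal_mul (by positivity), norm_mul, norm_lcdt a d hb hg, norm_real,
      Real.norm_of_nonneg (by positivity), mul_pow, mul_pow, ← Real.rpow_mul_natCast h1, inv_pow,
      ← Real.rpow_mul_natCast hb'.le]
    congr 1
    rw [show (m : ℝ) / 2 * (2 : ℕ) = m by push_cast; ring, Real.rpow_natCast,
      show (k + 1) * (2 : ℕ) = 2 * k + 2 by push_cast; ring, div_pow, mul_div_cancel₀ _ (pow_ne_zero 2 hb)]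
    ring
  have hFm : Measurable F := by
    have : Measurable (dunklT k g) := hDc.measurable
    fun_prop
  rw [eLpNorm_two_sq, lintegral_congr hF, lintegral_muK_comp_div hk hb hFm]
  simp only [F]
  rw [lintegral_const_mul' _ _ (by simp), ← mul_assoc, ← ENNReal.ofReal_mul (by positivity),
    mul_inv_cancel₀ (by positivity), ENNReal.ofReal_one, one_mul]
  have hexp (x : ℝ) : ENNReal.ofReal ((1 + b ^ 2 * x ^ 2) ^ m) * ‖dunklT k g x‖ₑ ^ 2 =
      ∑ n ∈ Finset.range (m + 1), ENNReal.ofReal (m.choose n * (b ^ 2) ^ n) *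
        (ENNReal.ofReal ((x ^ 2) ^ n) * ‖dunklT k g x‖ₑ ^ 2) := by
    rw [add_comm, add_pow, ENNReal.ofReal_sum_of_nonneg (fun _ _ => by positivity), Finset.sum_mul]
    refine Finset.sum_congr rfl fun n _ => ?_
    rw [← mul_assoc, ← ENNReal.ofReal_mul (by positivity)]
    congr 2
    ring
  rw [lintegral_congr hexp, lintegral_finsetSum _ fun n _ => by
    have : Measurable (dunklT k g) := hDc.measurable
    fun_prop]
  refine Finset.sum_congr rfl fun n _ => ?_
  rw [lintegral_const_mul' _ _ ENNReal.ofReal_ne_top, hterm, ← mul_assoc, ← ENNReal.ofReal_mul (by positivity)]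

/-- **Equivalence of Sobolev norms.** For `m ∈ ℕ` there are `C₁, C₂ > 0` such that for every
`f ∈ S(ℝ)`:
`C₁ Σ_{n=0}^m ‖Λ_{k,M⁻¹}ⁿ f‖²_{L²_k} ≤ ‖(1+λ²)^{m/2} D_k^M f‖²_{L²_k} ≤ C₂ Σ_{n=0}^m ‖Λ_{k,M⁻¹}ⁿ f‖²_{L²_k}`. -/
theorem stmt_6 (k a b c d : ℝ) (hk : -(1/2) ≤ k) (hM : a * d - b * c = 1) (hb : b ≠ 0)
    (m : ℕ) :
    ∃ C₁ > (0 : ℝ), ∃ C₂ > (0 : ℝ), ∀ f : SchwartzMap ℝ ℂ,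
      ENNReal.ofReal C₁ * ∑ n ∈ Finset.range (m + 1), (eLpNorm ((lcdOp k a b)^[n] ⇑f) 2 (muK k)) ^ 2 ≤
        (eLpNorm (fun lam : ℝ => (((1 + lam ^ 2) ^ ((m : ℝ) / 2) : ℝ) : ℂ) * lcdt k a b d (⇑f) lam)
            2 (muK k)) ^ 2 ∧
      (eLpNorm (fun lam : ℝ => (((1 + lam ^ 2) ^ ((m : ℝ) / 2) : ℝ) : ℂ) * lcdt k a b d (⇑f) lam)
            2 (muK k)) ^ 2 ≤
        ENNReal.ofReal C₂ * ∑ n ∈ Finset.range (m + 1), (eLpNorm ((lcdOp k a b)^[n] ⇑f) 2 (muK k)) ^ 2 := by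
  set q : ℕ → ℝ := fun n => m.choose n * (b ^ 2) ^ n * gaussianMass k ^ 2
  have hq : ∀ n ∈ Finset.range (m + 1), 0 < q n := fun n hn => by
    have h1 := gaussianMass_pos hk
    have h2 : 0 < m.choose n := Nat.choose_pos (Finset.mem_range_succ_iff.1 hn)
    positivity
  have hne : (Finset.range (m + 1)).Nonempty := Finset.nonempty_range_add_one
  obtain ⟨i, hi, hmin⟩ := Finset.exists_min_image _ q hne
  obtain ⟨j, hj, hmax⟩ := Finset.exists_max_image _ q hne
  refine ⟨q i, hq i hi, q j, hq j hj, fun f => ?_⟩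
  rw [eLpNorm_lcdt_sq a d hk hb m f, Finset.mul_sum, Finset.mul_sum]
  refine ⟨Finset.sum_le_sum fun n hn => ?_, Finset.sum_le_sum fun n hn => ?_⟩
  · gcongr
    exact hmin n hn
  · gcongr
    exact hmax n hn
end
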